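/- arXiv:2001.02490 — 2 statements merged into one kernel-verified Lean document; each statement's English description precedes it below -/
import Mathlib

section
/- Let 0 < p ≤ q < ∞ and let (X,μ) be a standard σ-finite measure space with L_p(X,μ) infinite-dimensional. Then there exist a standard σ-finite measure space (Y,ν) and a group homomorphism Ψ from the group Isom(L_p(X,μ)) of surjective affine isometries of L_p(X,μ) to the group Isom(L_q(Y,ν)) of surjective affine isometries of L_q(Y,ν) such that Ψ is a homeomorphism onto its image (both groups carrying the topology of pointwise convergence) and the image of Ψ is a closed subgroup of Isom(L_q(Y,ν)); moreover Ψ satisfies ‖g(0)‖_{L_p}^p = ‖Ψ(g)(0)‖_{L_q}^q for all g ∈ Isom(L_p(X,μ)). -/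
open MeasureTheory ENNReal

/-- The quantity `‖f‖_p^p = ∫ |f|^p dμ`, valued in `ℝ≥0∞`. -/
noncomputable def pPow {X : Type*} [MeasurableSpace X] (μ : Measure X) (p : ℝ)
    {E : Type*} [NormedAddCommGroup E] (f : X →ₘ[μ] E) : ℝ≥0∞ :=
  ∫⁻ x, (‖f x‖₊ : ℝ≥0∞) ^ p ∂μ

/-- A surjective affine isometry of `L_p(X,μ)`: a bijection of `L_p(X,μ)` which is
affine (over `ℝ`) and preserves the `L_p` distance, expressed via `pPow` (this makes
sense for every `0 < p < ∞`, including `p < 1`). -/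
structure AffIsom {X : Type*} [MeasurableSpace X] (μ : Measure X) (p : ℝ) extends
    Equiv (Lp ℂ (ENNReal.ofReal p) μ) (Lp ℂ (ENNReal.ofReal p) μ) where
  isom : ∀ f f', pPow μ p ((toFun f : X →ₘ[μ] ℂ) - (toFun f' : X →ₘ[μ] ℂ))
      = pPow μ p ((f : X →ₘ[μ] ℂ) - (f' : X →ₘ[μ] ℂ))
  affine : ∀ (t : ℝ) (f f' : Lp ℂ (ENNReal.ofReal p) μ),
    toFun (t • f + (1 - t) • f') = t • toFun f + (1 - t) • toFun f'

/-- Composition of affine isometries, making `AffIsom μ p` a group (we only need the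
multiplication to state that `Ψ` below is a group homomorphism). -/
noncomputable def AffIsom.comp {X : Type*} [MeasurableSpace X] {μ : Measure X} {p : ℝ}
    (S T : AffIsom μ p) : AffIsom μ p where
  toEquiv := T.toEquiv.trans S.toEquiv
  isom := fun f f' => by
    simpa using (S.isom (T.toEquiv f) (T.toEquiv f')).trans (T.isom f f')
  affine := fun t f f' => by
    show S.toEquiv (T.toEquiv _) = _
    rw [show T.toEquiv (t • f + (1 - t) • f') = t • T.toEquiv f + (1 - t) • T.toEquiv f'
      from T.affine t f f']
    exact S.affine t (T.toEquiv f) (T.toEquiv f')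

/-- The topology of pointwise convergence on the group of affine isometries of
`L_p(X,μ)`: the coarsest topology making all maps `T ↦ ‖T(f) − v‖_p^p` continuous; for
it, `T_i → T` iff `T_i(f) → T(f)` in `L_p` for every `f`. -/
noncomputable instance {X : Type*} [MeasurableSpace X] (μ : Measure X) (p : ℝ) :
    TopologicalSpace (AffIsom μ p) :=
  ⨅ (f : Lp ℂ (ENNReal.ofReal p) μ) (v : Lp ℂ (ENNReal.ofReal p) μ),
    TopologicalSpace.induced
      (fun T : AffIsom μ p => pPow μ p ((T.toEquiv f : X →ₘ[μ] ℂ) - (v : X →ₘ[μ] ℂ)))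
      inferInstance


set_option linter.all false
open Filter Topology


section infra

universe u
variable {Z : Type u} [MeasurableSpace Z]

/-- `∫ |f|^q` at the level of functions. -/
noncomputable def pw (ν : Measure Z) (q : ℝ) (f : Z → ℂ) : ℝ≥0∞ := ∫⁻ x, ‖f x‖ₑ ^ q ∂ν

/-- `L_q` with our own group norm. -/
def LQ (ν : Measure Z) (q : ℝ) : Type u := Lp ℂ (ENNReal.ofReal q) ν

variable {ν : Measure Z} {q : ℝ}

noncomputable instance : AddCommGroup (LQ ν q) :=
  inferInstanceAs (AddCommGroup (Lp ℂ (ENNReal.ofReal q) ν))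
noncomputable instance : Module ℂ (LQ ν q) :=
  inferInstanceAs (Module ℂ (Lp ℂ (ENNReal.ofReal q) ν))
noncomputable instance : Module ℝ (LQ ν q) :=
  inferInstanceAs (Module ℝ (Lp ℂ (ENNReal.ofReal q) ν))
instance : IsScalarTower ℝ ℂ (LQ ν q) :=
  inferInstanceAs (IsScalarTower ℝ ℂ (Lp ℂ (ENNReal.ofReal q) ν))

/-- underlying function -/
noncomputable def LQ.fn (f : LQ ν q) : Z → ℂ := ((show Lp ℂ (ENNReal.ofReal q) ν from f) : Z → ℂ)

lemma pPow_eq_pw (f : Z →ₘ[ν] ℂ) : pPow ν q f = pw ν q f := rfl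

lemma pw_congr {f g : Z → ℂ} (h : f =ᵐ[ν] g) : pw ν q f = pw ν q g :=
  lintegral_congr_ae (h.mono fun x hx => by simp only [hx])

lemma pw_congr_norm {f g : Z → ℂ} (h : ∀ᵐ x ∂ν, ‖f x‖ₑ = ‖g x‖ₑ) : pw ν q f = pw ν q g :=
  lintegral_congr_ae (h.mono fun x hx => by simp only [hx])

lemma pw_mono (hq : 0 < q) {f g : Z → ℂ} (h : ∀ᵐ x ∂ν, ‖f x‖ₑ ≤ ‖g x‖ₑ) : pw ν q f ≤ pw ν q g :=
  lintegral_mono_ae (h.mono fun x hx => ENNReal.rpow_le_rpow hx hq.le)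

lemma pw_smul (hq : 0 < q) (c : ℂ) (f : Z → ℂ) : pw ν q (fun x => c * f x) = ‖c‖ₑ ^ q * pw ν q f := by
  unfold pw
  rw [← lintegral_const_mul' _ _ (by simp [hq.le])]
  refine lintegral_congr fun x => ?_
  rw [enorm_mul, ENNReal.mul_rpow_of_nonneg _ _ hq.le]

lemma eLpNorm_eq_pw (hq : 0 < q) (f : Z → ℂ) :
    eLpNorm f (ENNReal.ofReal q) ν = (pw ν q f) ^ (1 / q) := by
  rw [eLpNorm_eq_lintegral_rpow_enorm_toReal (by simpa using hq) (by simp)]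
  simp [pw, ENNReal.toReal_ofReal hq.le]

lemma memLp_iff_pw (hq : 0 < q) {f : Z → ℂ} (hf : AEStronglyMeasurable f ν) :
    MemLp f (ENNReal.ofReal q) ν ↔ pw ν q f < ⊤ := by
  unfold MemLp
  rw [eLpNorm_eq_pw hq]
  simp [hf, ENNReal.rpow_lt_top_iff_of_pos, hq]

lemma pw_quasi (hq : 0 < q) {f g : Z → ℂ} (hf : AEStronglyMeasurable f ν) :
    pw ν q (fun x => f x + g x) ≤ 2 ^ q * (pw ν q f + pw ν q g) := by
  unfold pw
  rw [← lintegral_add_left' (by fun_prop), ← lintegral_const_mul' _ _ (by simp [hq.le])]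
  refine lintegral_mono fun x => ?_
  have h1 : ‖f x + g x‖ₑ ≤ 2 * max ‖f x‖ₑ ‖g x‖ₑ := by
    rw [two_mul]
    exact (enorm_add_le _ _).trans (add_le_add (le_max_left _ _) (le_max_right _ _))
  calc ‖f x + g x‖ₑ ^ q ≤ (2 * max ‖f x‖ₑ ‖g x‖ₑ) ^ q := ENNReal.rpow_le_rpow h1 hq.le
    _ = 2 ^ q * (max ‖f x‖ₑ ‖g x‖ₑ) ^ q := ENNReal.mul_rpow_of_nonneg _ _ hq.le
    _ ≤ _ := by
      gcongr
      rcases max_cases ‖f x‖ₑ ‖g x‖ₑ with h | h <;> rw [h.1] <;> simp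

lemma pw_add_le (hq : 0 < q) {f g : Z → ℂ} (hf : AEStronglyMeasurable f ν)
    (hg : AEStronglyMeasurable g ν) :
    pw ν q (fun x => f x + g x) ^ (1 / max 1 q) ≤
      pw ν q f ^ (1 / max 1 q) + pw ν q g ^ (1 / max 1 q) := by
  rcases le_total 1 q with h | h
  · rw [max_eq_right h, ← eLpNorm_eq_pw hq, ← eLpNorm_eq_pw hq, ← eLpNorm_eq_pw hq]
    exact eLpNorm_add_le hf hg (by simpa using h)
  · rw [max_eq_left h]
    simp only [div_one, ENNReal.rpow_one]
    unfold pw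
    rw [← lintegral_add_left' (by fun_prop)]
    refine lintegral_mono fun x => ?_
    exact (ENNReal.rpow_le_rpow (enorm_add_le _ _) hq.le).trans
      (ENNReal.rpow_add_le_add_rpow _ _ hq.le h)

lemma LQ.aesm (f : LQ ν q) : AEStronglyMeasurable f.fn ν := Lp.aestronglyMeasurable _
lemma LQ.sm (f : LQ ν q) : StronglyMeasurable f.fn := Lp.stronglyMeasurable _
lemma LQ.fn_add (f g : LQ ν q) : (f + g).fn =ᵐ[ν] fun x => f.fn x + g.fn x := Lp.coeFn_add _ _
lemma LQ.fn_sub (f g : LQ ν q) : (f - g).fn =ᵐ[ν] fun x => f.fn x - g.fn x := Lp.coeFn_sub _ _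
lemma LQ.fn_neg (f : LQ ν q) : (- f).fn =ᵐ[ν] fun x => - f.fn x := Lp.coeFn_neg _
lemma LQ.fn_zero : (0 : LQ ν q).fn =ᵐ[ν] fun _ => 0 := Lp.coeFn_zero _ _ _
lemma LQ.fn_smul (c : ℂ) (f : LQ ν q) : (c • f).fn =ᵐ[ν] fun x => c * f.fn x := Lp.coeFn_smul _ _
lemma LQ.fn_rsmul (c : ℝ) (f : LQ ν q) : (c • f).fn =ᵐ[ν] fun x => (c : ℂ) * f.fn x := by
  refine (Lp.coeFn_smul (p := ENNReal.ofReal q) c f).trans (Eventually.of_forall fun x => ?_)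
  exact Complex.real_smul
lemma LQ.ext {f g : LQ ν q} (h : f.fn =ᵐ[ν] g.fn) : f = g := Lp.ext h
lemma LQ.fn_sum {ι : Type*} (s : Finset ι) (f : ι → LQ ν q) :
    (∑ i ∈ s, f i).fn =ᵐ[ν] fun x => ∑ i ∈ s, (f i).fn x := Lp.coeFn_fun_finsetSum s f

/-- class of a function -/
noncomputable def LQ.mk (f : Z → ℂ) (h : MemLp f (ENNReal.ofReal q) ν) : LQ ν q := h.toLp f
lemma LQ.fn_mk {f : Z → ℂ} (h : MemLp f (ENNReal.ofReal q) ν) : (LQ.mk f h).fn =ᵐ[ν] f :=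
  h.coeFn_toLp

lemma LQ.memLp (f : LQ ν q) : MemLp f.fn (ENNReal.ofReal q) ν := Lp.memLp _

variable [hq : Fact (0 < q)]

lemma LQ.pw_lt_top (f : LQ ν q) : pw ν q f.fn < ⊤ :=
  (memLp_iff_pw hq.out f.aesm).1 f.memLp

noncomputable instance : NormedAddCommGroup (LQ ν q) :=
  AddGroupNorm.toNormedAddCommGroup
    { toFun := fun f => (pw ν q f.fn ^ (1 / max 1 q)).toReal
      map_zero' := by
        rw [pw_congr LQ.fn_zero]
        have : 0 < max 1 q := by positivity
        simp [pw, hq.out, this]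
      add_le' := fun f g => by
        have h1 : pw ν q f.fn ^ (1 / max 1 q) ≠ ⊤ :=
          ENNReal.rpow_ne_top_of_nonneg (by positivity) f.pw_lt_top.ne
        have h2 : pw ν q g.fn ^ (1 / max 1 q) ≠ ⊤ :=
          ENNReal.rpow_ne_top_of_nonneg (by positivity) g.pw_lt_top.ne
        rw [← ENNReal.toReal_add h1 h2, pw_congr (LQ.fn_add f g)]
        exact ENNReal.toReal_mono (ENNReal.add_ne_top.2 ⟨h1, h2⟩) (pw_add_le hq.out f.aesm g.aesm)
      neg' := fun f => by
        rw [pw_congr (LQ.fn_neg f)]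
        simp [pw]
      eq_zero_of_map_eq_zero' := fun f hf => by
        have h1 : pw ν q f.fn ^ (1 / max 1 q) ≠ ⊤ :=
          ENNReal.rpow_ne_top_of_nonneg (by positivity) f.pw_lt_top.ne
        have h2 : pw ν q f.fn ^ (1 / max 1 q) = 0 := by
          have := (ENNReal.toReal_eq_zero_iff _).1 hf
          tauto
        have h3 : pw ν q f.fn = 0 := by
          rw [ENNReal.rpow_eq_zero_iff] at h2
          rcases h2 with h | h
          · exact h.1
          · have : 0 < 1 / max 1 q := by positivity
            linarith [h.2]
        have h4 := (lintegral_eq_zero_iff' (by have := f.aesm; fun_prop)).1 h3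
        apply LQ.ext
        filter_upwards [h4, LQ.fn_zero (ν := ν) (q := q)] with x hx hx0
        rw [hx0]
        have hx' : ‖f.fn x‖ₑ ^ q = 0 := hx
        rw [ENNReal.rpow_eq_zero_iff_of_pos hq.out] at hx'
        exact enorm_eq_zero.1 hx' }

lemma LQ.norm_def (f : LQ ν q) : ‖f‖ = (pw ν q f.fn ^ (1 / max 1 q)).toReal := rfl

lemma LQ.pw_eq (f : LQ ν q) : pw ν q f.fn = ENNReal.ofReal (‖f‖ ^ (max 1 q)) := by
  have h0 : 0 < max 1 q := by positivity
  rw [LQ.norm_def, ← ENNReal.toReal_rpow, ← Real.rpow_mul ENNReal.toReal_nonneg,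
    one_div_mul_cancel h0.ne', Real.rpow_one, ENNReal.ofReal_toReal f.pw_lt_top.ne]

lemma LQ.norm_eq_iff {Z' : Type*} [MeasurableSpace Z'] {ν' : Measure Z'} {f : LQ ν q} {g : LQ ν' q} :
    ‖f‖ = ‖g‖ ↔ pw ν q f.fn = pw ν' q g.fn := by
  constructor
  · intro h; rw [LQ.pw_eq, LQ.pw_eq, h]
  · intro h; rw [LQ.norm_def, LQ.norm_def, h]

lemma LQ.norm_sub_eq_iff {f g f' g' : LQ ν q} : ‖f - g‖ = ‖f' - g'‖ ↔
    pw ν q (fun x => f.fn x - g.fn x) = pw ν q (fun x => f'.fn x - g'.fn x) := by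
  rw [LQ.norm_eq_iff, pw_congr (LQ.fn_sub f g), pw_congr (LQ.fn_sub f' g')]

lemma LQ.tendsto_iff {α : Type*} {l : Filter α} {f : α → LQ ν q} {g : LQ ν q} :
    Tendsto f l (𝓝 g) ↔ Tendsto (fun a => pw ν q (fun x => (f a).fn x - g.fn x)) l (𝓝 0) := by
  have h0 : 0 < max 1 q := by positivity
  rw [tendsto_iff_norm_sub_tendsto_zero]
  have e : ∀ a, pw ν q (fun x => (f a).fn x - g.fn x) = ENNReal.ofReal (‖f a - g‖ ^ (max 1 q)) := by
    intro a; rw [← LQ.pw_eq, pw_congr (LQ.fn_sub _ _)]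
  simp_rw [e]
  constructor
  · intro h
    have := (h.rpow_const (p := max 1 q) (Or.inr h0.le))
    rw [Real.zero_rpow h0.ne'] at this
    simpa using ENNReal.tendsto_ofReal this
  · intro h
    have h1 := (ENNReal.tendsto_toReal ENNReal.zero_ne_top).comp h
    have h2 := h1.rpow_const (p := 1 / max 1 q) (Or.inr (by positivity))
    simp only [ENNReal.toReal_zero] at h2
    rw [Real.zero_rpow (by positivity)] at h2
    refine h2.congr fun a => ?_
    simp only [Function.comp]
    rw [ENNReal.toReal_ofReal (by positivity), ← Real.rpow_mul (norm_nonneg _),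
      mul_one_div_cancel h0.ne', Real.rpow_one]

lemma LQ.continuous_pw : Continuous (fun f : LQ ν q => pw ν q f.fn) := by
  simp_rw [LQ.pw_eq]
  refine ENNReal.continuous_ofReal.comp ?_
  exact continuous_norm.rpow_const fun _ => Or.inr (by positivity)

instance : ContinuousConstSMul ℂ (LQ ν q) where
  continuous_const_smul c := by
    rw [continuous_iff_continuousAt]
    intro f
    have h : Tendsto (fun g : LQ ν q => g) (𝓝 f) (𝓝 f) := tendsto_id
    rw [LQ.tendsto_iff] at h
    show Tendsto _ _ _
    rw [LQ.tendsto_iff]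
    have := ENNReal.Tendsto.const_mul (a := ‖c‖ₑ ^ q) h (Or.inr (by simp [hq.out.le]))
    rw [mul_zero] at this
    refine this.congr fun g => ?_
    rw [← pw_smul hq.out]
    apply pw_congr
    filter_upwards [LQ.fn_smul c f, LQ.fn_smul c g] with x h1 h2
    rw [h1, h2]; ring

instance : ContinuousConstSMul ℝ (LQ ν q) where
  continuous_const_smul c := by
    have := continuous_const_smul (T := LQ ν q) (c : ℂ)
    refine this.congr fun f => ?_
    apply LQ.ext
    filter_upwards [LQ.fn_smul (c : ℂ) f, LQ.fn_rsmul c f] with x h1 h2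
    rw [h1, h2]

lemma pw_fatou {u : ℕ → Z → ℂ} {f : Z → ℂ} (hu : ∀ n, AEStronglyMeasurable (u n) ν)
    (h : ∀ᵐ x ∂ν, Tendsto (fun n => u n x) atTop (𝓝 (f x))) :
    pw ν q f ≤ liminf (fun n => pw ν q (u n)) atTop := by
  refine le_trans (le_of_eq ?_) (lintegral_liminf_le' (fun n => ?_))
  · refine lintegral_congr_ae (h.mono fun x hx => ?_)
    exact (((ENNReal.continuous_rpow_const (y := q)).tendsto _).comp hx.enorm).liminf_eq.symm
  · have := hu n
    fun_prop

instance : CompleteSpace (LQ ν q) := by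
  have hq0 := hq.out
  have h0 : 0 < max 1 q := by positivity
  set B : ℕ → ℝ := fun n => (((2:ℝ)⁻¹) ^ n * ((2:ℝ)⁻¹ ^ n) ^ q) ^ (1 / max 1 q) with hB
  have hBpos : ∀ n, 0 < B n := fun n => by positivity
  refine Metric.complete_of_convergent_controlled_sequences B hBpos fun u hu => ?_
  have key : ∀ N n m, N ≤ n → N ≤ m → pw ν q (fun x => (u n).fn x - (u m).fn x) ≤
      ENNReal.ofReal (((2:ℝ)⁻¹) ^ N * ((2:ℝ)⁻¹ ^ N) ^ q) := by
    intro N n m hn hm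
    rw [← pw_congr (LQ.fn_sub _ _), LQ.pw_eq]
    apply ENNReal.ofReal_le_ofReal
    have := (hu N n m hn hm).le
    rw [dist_eq_norm] at this
    calc _ ≤ (B N) ^ (max 1 q) := Real.rpow_le_rpow (norm_nonneg _) this h0.le
      _ = _ := by
        rw [hB]; simp only
        rw [← Real.rpow_mul (by positivity), one_div_mul_cancel h0.ne', Real.rpow_one]
  -- a.e. convergence
  have hsum : ∫⁻ x, ∑' n, ((2:ℝ≥0∞) ^ n) ^ q * ‖(u n).fn x - (u (n+1)).fn x‖ₑ ^ q ∂ν < ⊤ := by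
    rw [lintegral_tsum (fun n => by
      have := (u n).aesm; have := (u (n+1)).aesm; fun_prop)]
    have : ∀ n, ∫⁻ x, ((2:ℝ≥0∞) ^ n) ^ q * ‖(u n).fn x - (u (n+1)).fn x‖ₑ ^ q ∂ν ≤
        (2⁻¹ : ℝ≥0∞) ^ n := by
      intro n
      rw [lintegral_const_mul' _ _ (by simp [hq0.le])]
      calc _ ≤ ((2:ℝ≥0∞) ^ n) ^ q * ENNReal.ofReal (((2:ℝ)⁻¹) ^ n * ((2:ℝ)⁻¹ ^ n) ^ q) := by
            gcongr; exact key n n (n+1) le_rfl (Nat.le_succ n)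
        _ = (2⁻¹ : ℝ≥0∞) ^ n := by
          rw [ENNReal.ofReal_mul (by positivity), ENNReal.ofReal_pow (by positivity),
            ← ENNReal.ofReal_rpow_of_nonneg (by positivity) hq0.le,
            ENNReal.ofReal_pow (by positivity),
            ENNReal.ofReal_inv_of_pos two_pos, ENNReal.ofReal_ofNat, mul_comm, mul_assoc,
            ← ENNReal.mul_rpow_of_nonneg _ _ hq0.le, ← mul_pow,
            ENNReal.inv_mul_cancel (by simp) (by simp)]
          simp
    refine (ENNReal.tsum_le_tsum this).trans_lt ?_
    rw [ENNReal.tsum_geometric]; simp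
  have hae : ∀ᵐ x ∂ν, ∃ l, Tendsto (fun n => (u n).fn x) atTop (𝓝 l) := by
    have := ae_lt_top' (by
      refine AEMeasurable.tsum fun n => ?_
      have := (u n).aesm; have := (u (n+1)).aesm; fun_prop) hsum.ne
    filter_upwards [this] with x hx
    set S := ∑' n, ((2:ℝ≥0∞) ^ n) ^ q * ‖(u n).fn x - (u (n+1)).fn x‖ₑ ^ q with hS
    refine cauchySeq_tendsto_of_complete
      (cauchySeq_of_le_geometric (2⁻¹ : ℝ) (S ^ (1/q)).toReal (by norm_num) fun n => ?_)
    have h1 : ((2:ℝ≥0∞) ^ n) ^ q * ‖(u n).fn x - (u (n+1)).fn x‖ₑ ^ q ≤ S :=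
      ENNReal.le_tsum (f := fun n => ((2:ℝ≥0∞) ^ n) ^ q * ‖(u n).fn x - (u (n+1)).fn x‖ₑ ^ q) n
    rw [← ENNReal.mul_rpow_of_nonneg _ _ hq0.le] at h1
    have h2 := ENNReal.rpow_le_rpow h1 (show 0 ≤ 1 / q by positivity)
    rw [← ENNReal.rpow_mul, mul_one_div_cancel hq0.ne', ENNReal.rpow_one] at h2
    have h3 := ENNReal.toReal_mono (ENNReal.rpow_ne_top_of_nonneg (by positivity) hx.ne) h2
    rw [ENNReal.toReal_mul] at h3
    simp only [ENNReal.toReal_pow, ENNReal.toReal_ofNat, toReal_enorm] at h3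
    rw [dist_eq_norm, inv_pow, ← div_eq_mul_inv, le_div_iff₀ (by positivity), mul_comm]
    exact h3
  obtain ⟨f, hf, hlim⟩ := exists_stronglyMeasurable_limit_of_tendsto_ae
    (fun n => (u n).aesm) hae
  have hfat : ∀ N, pw ν q (fun x => (u N).fn x - f x) ≤
      ENNReal.ofReal (((2:ℝ)⁻¹) ^ N * ((2:ℝ)⁻¹ ^ N) ^ q) := by
    intro N
    refine (pw_fatou (u := fun m x => (u N).fn x - (u m).fn x)
      (fun m => (u N).aesm.sub (u m).aesm) (hlim.mono fun x hx => hx.const_sub _)).trans ?_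
    refine liminf_le_of_le (by isBoundedDefault) fun b hb => ?_
    obtain ⟨m, hm1, hm2⟩ := (hb.and (eventually_ge_atTop N)).exists
    exact hm1.trans (key N N m le_rfl hm2)
  have hmem : MemLp f (ENNReal.ofReal q) ν := by
    have : MemLp (fun x => (u 0).fn x - f x) (ENNReal.ofReal q) ν :=
      (memLp_iff_pw hq0 ((u 0).aesm.sub hf.aestronglyMeasurable)).2
        ((hfat 0).trans_lt ENNReal.ofReal_lt_top)
    have h2 := (u 0).memLp.sub this
    convert h2 using 1
    ext x; simp
  refine ⟨LQ.mk f hmem, ?_⟩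
  rw [LQ.tendsto_iff]
  have hb : Tendsto (fun N : ℕ => ENNReal.ofReal (((2:ℝ)⁻¹) ^ N * ((2:ℝ)⁻¹ ^ N) ^ q)) atTop (𝓝 0) := by
    have h1 : Tendsto (fun N : ℕ => (2:ℝ)⁻¹ ^ N) atTop (𝓝 0) :=
      tendsto_pow_atTop_nhds_zero_of_lt_one (by norm_num) (by norm_num)
    have h2 := h1.rpow_const (p := q) (Or.inr hq0.le)
    have h3 := h1.mul h2
    rw [zero_mul] at h3
    simpa using ENNReal.tendsto_ofReal h3
  refine tendsto_of_tendsto_of_tendsto_of_le_of_le tendsto_const_nhds hb (fun _ => zero_le) fun N => ?_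
  refine le_trans (le_of_eq ?_) (hfat N)
  apply pw_congr
  filter_upwards [LQ.fn_mk hmem] with x hx
  rw [hx]

end infra


section abstractPart

/-- There is a closed embedding of isometry groups preserving norms. -/
def Good {X Y : Type*} [MeasurableSpace X] [MeasurableSpace Y] (μ : Measure X) (p : ℝ)
    (ν : Measure Y) (q : ℝ) : Prop :=
  ∃ Ψ : AffIsom μ p → AffIsom ν q,
    (∀ S T : AffIsom μ p, Ψ (S.comp T) = (Ψ S).comp (Ψ T)) ∧
    Topology.IsEmbedding Ψ ∧
    IsClosed (Set.range Ψ) ∧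
    ∀ S : AffIsom μ p,
      pPow μ p ((S.toEquiv 0 : X →ₘ[μ] ℂ)) = pPow ν q (((Ψ S).toEquiv 0 : Y →ₘ[ν] ℂ))

lemma Good.trans {X Y Z : Type*} [MeasurableSpace X] [MeasurableSpace Y] [MeasurableSpace Z]
    {μ : Measure X} {ν : Measure Y} {ρ : Measure Z} {p q r : ℝ}
    (h1 : Good μ p ν q) (h2 : Good ν q ρ r) : Good μ p ρ r := by
  obtain ⟨Ψ, a1, a2, a3, a4⟩ := h1
  obtain ⟨Ψ', b1, b2, b3, b4⟩ := h2
  refine ⟨Ψ' ∘ Ψ, fun S T => by simp [a1, b1], b2.comp a2, ?_, fun S => (a4 S).trans (b4 _)⟩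
  exact ((Topology.IsClosedEmbedding.mk b2 b3).comp (Topology.IsClosedEmbedding.mk a2 a3)).isClosed_range

variable {Z : Type*} [MeasurableSpace Z] {ν : Measure Z} {q : ℝ}

/-- action -/
noncomputable def AffIsom.act (T : AffIsom ν q) : LQ ν q → LQ ν q := T.toEquiv

/-- inverse action -/
noncomputable def AffIsom.iact (T : AffIsom ν q) : LQ ν q → LQ ν q := T.toEquiv.symm

lemma AffIsom.act_iact (T : AffIsom ν q) (f : LQ ν q) : T.act (T.iact f) = f :=
  T.toEquiv.apply_symm_apply f
lemma AffIsom.iact_act (T : AffIsom ν q) (f : LQ ν q) : T.iact (T.act f) = f :=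
  T.toEquiv.symm_apply_apply f
lemma AffIsom.act_comp (S T : AffIsom ν q) (f : LQ ν q) : (S.comp T).act f = S.act (T.act f) := rfl

lemma AffIsom.ext_act {S T : AffIsom ν q} (h : ∀ f, S.act f = T.act f) : S = T := by
  rcases S with ⟨s, _, _⟩
  rcases T with ⟨t, _, _⟩
  have : s = t := Equiv.ext h
  subst this; rfl

lemma pPow_sub_eq (f g : LQ ν q) :
    pPow ν q ((show Lp ℂ (ENNReal.ofReal q) ν from f : Z →ₘ[ν] ℂ) -
      (show Lp ℂ (ENNReal.ofReal q) ν from g : Z →ₘ[ν] ℂ)) = pw ν q (f - g).fn := rfl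

lemma AffIsom.act_pw (T : AffIsom ν q) (f g : LQ ν q) :
    pw ν q (T.act f - T.act g).fn = pw ν q (f - g).fn := T.isom f g

lemma AffIsom.act_affine (T : AffIsom ν q) (t : ℝ) (f g : LQ ν q) :
    T.act (t • f + (1 - t) • g) = t • T.act f + (1 - t) • T.act g := T.affine t f g

/-- constructor -/
noncomputable def AffIsom.mk' (a b : LQ ν q → LQ ν q) (hab : ∀ f, a (b f) = f) (hba : ∀ f, b (a f) = f)
    (hi : ∀ f g, pw ν q (a f - a g).fn = pw ν q (f - g).fn)
    (haff : ∀ (t : ℝ) (f g : LQ ν q), a (t • f + (1 - t) • g) = t • a f + (1 - t) • a g) :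
    AffIsom ν q where
  toFun := a
  invFun := b
  left_inv := hba
  right_inv := hab
  isom := hi
  affine := haff

lemma AffIsom.act_mk' (a b : LQ ν q → LQ ν q) (hab : ∀ f, a (b f) = f) (hba : ∀ f, b (a f) = f)
    (hi : ∀ f g, pw ν q (a f - a g).fn = pw ν q (f - g).fn)
    (haff : ∀ (t : ℝ) (f g : LQ ν q), a (t • f + (1 - t) • g) = t • a f + (1 - t) • a g) :
    (AffIsom.mk' a b hab hba hi haff).act = a := rfl

/-- inverse -/
noncomputable def AffIsom.inv' (T : AffIsom ν q) : AffIsom ν q :=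
  AffIsom.mk' T.iact T.act T.iact_act T.act_iact
    (fun f g => by rw [← T.act_pw, T.act_iact, T.act_iact])
    (fun t f g => by
      have := T.act_affine t (T.iact f) (T.iact g)
      rw [T.act_iact, T.act_iact] at this
      rw [← this, T.iact_act])

lemma AffIsom.act_inv' (T : AffIsom ν q) : T.inv'.act = T.iact := rfl

/-- the linear part -/
noncomputable def AffIsom.lin (T : AffIsom ν q) : LQ ν q →ₗ[ℝ] LQ ν q :=
  have hs : ∀ (t : ℝ) (f : LQ ν q), T.act (t • f) - T.act 0 = t • (T.act f - T.act 0) := by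
    intro t f
    have := T.act_affine t f 0
    rw [smul_zero, add_zero] at this
    rw [this]
    module
  { toFun := fun f => T.act f - T.act 0
    map_add' := fun f g => by
      have h := T.act_affine (1/2 : ℝ) ((2:ℝ) • f) ((2:ℝ) • g)
      have e : (1/2 : ℝ) • ((2:ℝ) • f) + (1 - 1/2 : ℝ) • ((2:ℝ) • g) = f + g := by module
      rw [e] at h
      have h1 := hs 2 f
      have h2 := hs 2 g
      rw [sub_eq_iff_eq_add] at h1 h2
      rw [h, h1, h2]
      module
    map_smul' := fun t f => hs t f }

lemma AffIsom.lin_apply (T : AffIsom ν q) (f : LQ ν q) : T.lin f = T.act f - T.act 0 := rfl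
lemma AffIsom.act_eq (T : AffIsom ν q) (f : LQ ν q) : T.act f = T.lin f + T.act 0 := by
  rw [T.lin_apply]; abel

lemma AffIsom.lin_surj (T : AffIsom ν q) : Function.Surjective T.lin := fun f => by
  refine ⟨T.iact (f + T.act 0), ?_⟩
  rw [T.lin_apply, T.act_iact]; abel

lemma AffIsom.lin_pw (T : AffIsom ν q) (f : LQ ν q) : pw ν q (T.lin f).fn = pw ν q f.fn := by
  rw [T.lin_apply, T.act_pw, sub_zero]

variable [hq : Fact (0 < q)]

lemma AffIsom.act_norm (T : AffIsom ν q) (f g : LQ ν q) : ‖T.act f - T.act g‖ = ‖f - g‖ :=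
  LQ.norm_eq_iff.2 (T.act_pw f g)

lemma LQ.tendsto_iff' {α : Type*} {l : Filter α} {f : α → LQ ν q} {g : LQ ν q} :
    Tendsto f l (𝓝 g) ↔ Tendsto (fun a => pw ν q (f a - g).fn) l (𝓝 0) := by
  rw [LQ.tendsto_iff]
  simp_rw [pw_congr (LQ.fn_sub _ _)]

lemma AffIsom.tendsto_iff {α : Type*} {l : Filter α} {G : α → AffIsom ν q} {T : AffIsom ν q} :
    Tendsto G l (𝓝 T) ↔ ∀ f, Tendsto (fun a => (G a).act f) l (𝓝 (T.act f)) := by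
  rw [nhds_iInf, tendsto_iInf]
  refine forall_congr' fun f => ?_
  rw [nhds_iInf, tendsto_iInf]
  simp_rw [nhds_induced, tendsto_comap_iff]
  constructor
  · intro h
    have := h (T.act f)
    rw [LQ.tendsto_iff']
    have e : pw ν q (T.act f - T.act f).fn = 0 := by
      rw [sub_self, pw_congr LQ.fn_zero]; simp [pw, hq.out]
    rw [← e]
    exact this
  · intro h v
    have : ∀ v' : LQ ν q, Tendsto (fun a => pw ν q ((G a).act f - v').fn) l (𝓝 (pw ν q (T.act f - v').fn)) :=
      fun v' => (LQ.continuous_pw.tendsto _).comp (Tendsto.sub_const h v')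
    exact this v

lemma ext_exists {W E : Type*} [AddCommGroup W] [Module ℂ W] [NormedAddCommGroup E] [Module ℂ E]
    [ContinuousConstSMul ℂ E] [CompleteSpace E] (A B : W →ₗ[ℂ] E) (hN : ∀ w, ‖B w‖ = ‖A w‖)
    (hd : DenseRange A) : ∃ π : E →ₗ[ℂ] E, (∀ w, π (A w) = B w) ∧ ∀ k, ‖π k‖ = ‖k‖ := by
  have hseq : ∀ k, ∃ w : ℕ → W, Tendsto (fun n => A (w n)) atTop (𝓝 k) := by
    intro k
    obtain ⟨x, hx, hk⟩ := mem_closure_iff_seq_limit.1 (hd k)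
    choose w hw using hx
    exact ⟨w, by simpa [hw] using hk⟩
  have hex : ∀ k, ∃ y, ∀ w, ‖B w - y‖ = ‖A w - k‖ := by
    intro k
    obtain ⟨w, hw⟩ := hseq k
    have hc : CauchySeq (fun n => B (w n)) := by
      have h1 := hw.cauchySeq
      rw [Metric.cauchySeq_iff] at h1 ⊢
      intro ε hε
      obtain ⟨N, hN'⟩ := h1 ε hε
      refine ⟨N, fun m hm n hn => ?_⟩
      have := hN' m hm n hn
      rwa [dist_eq_norm, ← map_sub, hN, map_sub, ← dist_eq_norm]
    obtain ⟨y, hy⟩ := cauchySeq_tendsto_of_complete hc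
    refine ⟨y, fun v => ?_⟩
    have h1 := (hy.const_sub (B v)).norm
    have h2 := (hw.const_sub (A v)).norm
    refine tendsto_nhds_unique h1 (h2.congr fun n => ?_)
    rw [← map_sub, ← map_sub, hN]
  choose π hπ using hex
  have hlim : ∀ {k : E} {w : ℕ → W}, Tendsto (fun n => A (w n)) atTop (𝓝 k) →
      Tendsto (fun n => B (w n)) atTop (𝓝 (π k)) := by
    intro k w h
    rw [tendsto_iff_norm_sub_tendsto_zero] at h ⊢
    simpa [hπ] using h
  refine ⟨{ toFun := π, map_add' := ?_, map_smul' := ?_ }, ?_, ?_⟩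
  · intro k k'
    obtain ⟨w, hw⟩ := hseq k
    obtain ⟨w', hw'⟩ := hseq k'
    have h1 := hlim (w := fun n => w n + w' n) (k := k + k') (by simpa using hw.add hw')
    have h2 := (hlim hw).add (hlim hw')
    exact tendsto_nhds_unique h1 (by simpa using h2)
  · intro c k
    obtain ⟨w, hw⟩ := hseq k
    have h1 := hlim (w := fun n => c • w n) (k := c • k) (by simpa using hw.const_smul c)
    have h2 := (hlim hw).const_smul c
    exact tendsto_nhds_unique h1 (by simpa using h2)
  · intro w
    have := hπ (A w) w
    rw [sub_self, norm_zero, norm_eq_zero, sub_eq_zero] at this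
    exact this.symm
  · intro k
    have := hπ k 0
    simpa using this

lemma hΦt {X : Type*} [MeasurableSpace X] {μ : Measure X} {p : ℝ} [hp : Fact (0 < p)]
    (Φ : LQ μ p → LQ ν q)
    (hiso : ∀ f f', pw ν q (Φ f - Φ f').fn = pw μ p (f - f').fn) {α : Type*} {l : Filter α}
    {f : α → LQ μ p} {g : LQ μ p} :
      Tendsto f l (𝓝 g) ↔ Tendsto (fun a => Φ (f a)) l (𝓝 (Φ g)) := by
  rw [LQ.tendsto_iff', LQ.tendsto_iff']
  simp_rw [hiso]

theorem good_of_phi {X : Type*} [MeasurableSpace X] {μ : Measure X} {p : ℝ} [hp : Fact (0 < p)]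
    (Φ : LQ μ p → LQ ν q) (h0 : Φ 0 = 0)
    (hiso : ∀ f f', pw ν q (Φ f - Φ f').fn = pw μ p (f - f').fn)
    (hdense : DenseRange (Finsupp.linearCombination ℂ Φ))
    (hinv : ∀ (T : AffIsom μ p) (w : LQ μ p →₀ ℂ),
      ‖Finsupp.linearCombination ℂ (fun f => Φ (T.act f) - Φ (T.act 0)) w‖ =
        ‖Finsupp.linearCombination ℂ Φ w‖) :
    Good μ p ν q := by
  have hex := fun T => ext_exists _ _ (hinv T) hdense
  choose π hπ hπn using hex
  have hπΦ : ∀ T f, π T (Φ f) = Φ (T.act f) - Φ (T.act 0) := by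
    intro T f
    have := hπ T (Finsupp.single f 1)
    simpa using this
  have hπc : ∀ T, Continuous (π T) := by
    intro T
    have : Isometry (π T) := by
      refine Isometry.of_dist_eq fun a b => ?_
      rw [dist_eq_norm, dist_eq_norm, ← map_sub, hπn]
    exact this.continuous
  have hcomp : ∀ S T k, π S (π T k) = π (S.comp T) k := by
    intro S T k
    refine congrFun (hdense.equalizer ((hπc S).comp (hπc T)) (hπc _) ?_) k
    have : (π S).comp ((π T).comp (Finsupp.linearCombination ℂ Φ)) =
        (π (S.comp T)).comp (Finsupp.linearCombination ℂ Φ) := by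
      ext f
      simp only [LinearMap.comp_apply, Finsupp.lsingle_apply, Finsupp.linearCombination_single, one_smul]
      rw [hπΦ, map_sub, hπΦ, hπΦ, hπΦ, S.act_comp, S.act_comp]
      abel
    ext w
    exact LinearMap.congr_fun this w
  have hid : ∀ T : AffIsom μ p, (∀ f, T.act f = f) → ∀ k, π T k = k := by
    intro T hT k
    refine congrFun (hdense.equalizer (hπc T) continuous_id ?_) k
    have : (π T).comp (Finsupp.linearCombination ℂ Φ) = Finsupp.linearCombination ℂ Φ := by
      ext f
      simp only [LinearMap.comp_apply, Finsupp.lsingle_apply, Finsupp.linearCombination_single, one_smul]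
      rw [hπΦ, hT, hT, h0, sub_zero]
    ext w
    exact LinearMap.congr_fun this w
  have hπr : ∀ T (t : ℝ) k, π T (t • k) = t • π T k := by
    intro T t k
    have e : ∀ k : LQ ν q, t • k = (t : ℂ) • k := by
      intro k
      rw [← IsScalarTower.algebraMap_smul ℂ t k]; rfl
    rw [e, map_smul, e]
  let ψ : AffIsom μ p → LQ ν q → LQ ν q := fun T k => π T k + Φ (T.act 0)
  have hψc : ∀ S T k, ψ S (ψ T k) = ψ (S.comp T) k := by
    intro S T k
    show π S (π T k + Φ (T.act 0)) + Φ (S.act 0) = π (S.comp T) k + Φ (S.act (T.act 0))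
    rw [map_add, hcomp, hπΦ]
    abel
  have hψid : ∀ T : AffIsom μ p, (∀ f, T.act f = f) → ∀ k, ψ T k = k := by
    intro T hT k
    show π T k + Φ (T.act 0) = k
    rw [hid T hT, hT, h0, add_zero]
  have hψΦ : ∀ T f, ψ T (Φ f) = Φ (T.act f) := by
    intro T f
    show π T (Φ f) + Φ (T.act 0) = _
    rw [hπΦ]; abel
  let Ψ : AffIsom μ p → AffIsom ν q := fun T =>
    AffIsom.mk' (ψ T) (ψ T.inv')
      (fun k => by
        rw [hψc]; apply hψid; intro f
        rw [AffIsom.act_comp, AffIsom.act_inv', AffIsom.act_iact])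
      (fun k => by
        rw [hψc]; apply hψid; intro f
        rw [AffIsom.act_comp, AffIsom.act_inv', AffIsom.iact_act])
      (fun f g => by
        rw [← LQ.norm_eq_iff]
        show ‖π T f + Φ (T.act 0) - (π T g + Φ (T.act 0))‖ = _
        rw [add_sub_add_right_eq_sub, ← map_sub, hπn])
      (fun t f g => by
        show π T _ + Φ (T.act 0) = t • (π T f + Φ (T.act 0)) + (1 - t) • (π T g + Φ (T.act 0))
        rw [map_add, hπr, hπr]
        module)
  have hΨa : ∀ T k, (Ψ T).act k = ψ T k := fun T k => rfl
  have hΨΦ : ∀ T f, (Ψ T).act (Φ f) = Φ (T.act f) := hψΦ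
  -- topology
  have hcont : ∀ {l : Filter (AffIsom μ p)} {T : AffIsom μ p}, Tendsto id l (𝓝 T) →
      Tendsto Ψ l (𝓝 (Ψ T)) := by
    intro l T h
    rw [AffIsom.tendsto_iff] at h ⊢
    intro k
    refine Tendsto.add ?_ ((hΦt Φ hiso).1 (h 0))
    rw [Metric.tendsto_nhds]
    intro ε hε
    obtain ⟨_, ⟨w, rfl⟩, hw'⟩ := Metric.mem_closure_iff.1 (hdense k) (ε / 3) (by positivity)
    have ht : Tendsto (fun a => π (id a) (Finsupp.linearCombination ℂ Φ w)) l
        (𝓝 (π T (Finsupp.linearCombination ℂ Φ w))) := by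
      simp_rw [hπ, Finsupp.linearCombination_apply, Finsupp.sum]
      exact tendsto_finset_sum _ fun f _ => (((hΦt Φ hiso).1 (h f)).sub ((hΦt Φ hiso).1 (h 0))).const_smul _
    filter_upwards [Metric.tendsto_nhds.1 ht (ε / 3) (by positivity)] with a ha
    have e : ∀ T, dist (π T k) (π T (Finsupp.linearCombination ℂ Φ w)) < ε / 3 := by
      intro T
      rw [dist_eq_norm, ← map_sub, hπn, ← dist_eq_norm]; exact hw'
    have e1 := e a
    have e2 := e T
    rw [dist_comm] at e2
    have t1 := dist_triangle (π a k) (π a (Finsupp.linearCombination ℂ Φ w)) (π T k)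
    have t2 := dist_triangle (π a (Finsupp.linearCombination ℂ Φ w)) (π T (Finsupp.linearCombination ℂ Φ w)) (π T k)
    change dist (π a k) (π T k) < ε
    simp only [id] at ha
    linarith
  have hback : ∀ {l : Filter (AffIsom μ p)} {T : AffIsom μ p}, Tendsto Ψ l (𝓝 (Ψ T)) →
      Tendsto id l (𝓝 T) := by
    intro l T h
    rw [AffIsom.tendsto_iff] at h ⊢
    intro f
    rw [hΦt Φ hiso]
    simpa [hΨΦ] using h (Φ f)
  have hΦinj : Function.Injective Φ := by
    intro f g h1
    have h2 := hiso f g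
    rw [h1, sub_self] at h2
    have h3 : ‖f - g‖ = ‖(0 : LQ μ p)‖ := by
      rw [LQ.norm_eq_iff, ← h2, pw_congr LQ.fn_zero, pw_congr LQ.fn_zero]
      simp [pw, hp.out, hq.out]
    rw [norm_zero, norm_eq_zero, sub_eq_zero] at h3
    exact h3
  have hpq' : ∀ f g, ‖Φ f - Φ g‖ ^ (max 1 q) = ‖f - g‖ ^ (max 1 p) := by
    intro f g
    have h2 := hiso f g
    rwa [LQ.pw_eq, LQ.pw_eq, ENNReal.ofReal_eq_ofReal_iff (by positivity) (by positivity)] at h2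
  have hclosed : IsClosed (Set.range Φ) := by
    refine isClosed_of_closure_subset fun y hy => ?_
    obtain ⟨x, hx, hxy⟩ := mem_closure_iff_seq_limit.1 hy
    choose f hf using hx
    obtain rfl : (fun n => Φ (f n)) = x := funext hf
    have hc : CauchySeq f := by
      have h1 := hxy.cauchySeq
      have m1 : (0:ℝ) < max 1 p := by positivity
      have m2 : (0:ℝ) < max 1 q := by positivity
      rw [Metric.cauchySeq_iff] at h1 ⊢
      intro ε hε
      obtain ⟨N, hN⟩ := h1 ((ε ^ (max 1 p)) ^ (max 1 q)⁻¹) (by positivity)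
      refine ⟨N, fun m hm n hn => ?_⟩
      have h3 := hN m hm n hn
      rw [dist_eq_norm] at h3 ⊢
      rw [Real.lt_rpow_inv_iff_of_pos (by positivity) (by positivity) m2, hpq'] at h3
      exact (Real.rpow_lt_rpow_iff (by positivity) hε.le m1).1 h3
    obtain ⟨z, hz⟩ := cauchySeq_tendsto_of_complete hc
    exact ⟨z, tendsto_nhds_unique ((hΦt Φ hiso).1 hz) hxy⟩
  have hinj : Function.Injective Ψ := by
    intro S T h
    apply AffIsom.ext_act
    intro f
    have h1 : Φ (S.act f) = Φ (T.act f) := by rw [← hΨΦ, ← hΨΦ, h]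
    have h2 := hiso (S.act f) (T.act f)
    rw [h1, sub_self] at h2
    have h3 : ‖S.act f - T.act f‖ = ‖(0 : LQ μ p)‖ := by
      rw [LQ.norm_eq_iff, ← h2, pw_congr LQ.fn_zero, pw_congr LQ.fn_zero]
      simp [pw, hp.out, hq.out]
    rw [norm_zero, norm_eq_zero, sub_eq_zero] at h3
    exact h3
  have hind : Topology.IsInducing Ψ := by
    rw [isInducing_iff_nhds]
    intro T
    apply le_antisymm
    · rw [← tendsto_iff_comap]
      exact hcont tendsto_id
    · exact hback (l := comap Ψ (𝓝 (Ψ T))) tendsto_comap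
  refine ⟨Ψ, ?_, ⟨hind, hinj⟩, ?_, ?_⟩
  · intro S T
    apply AffIsom.ext_act
    intro k
    rw [AffIsom.act_comp, hΨa, hΨa, hΨa, hψc]
  · refine isClosed_of_closure_subset fun S hS => ?_
    rw [mem_closure_iff_frequently] at hS
    set F := comap Ψ (𝓝 S) with hF
    haveI : F.NeBot := comap_neBot_iff_frequently.2 hS
    have hFS : Tendsto Ψ F (𝓝 S) := tendsto_comap
    have hFS' := AffIsom.tendsto_iff.1 hFS
    have hex1 : ∀ f, ∃ t, S.act (Φ f) = Φ t := by
      intro f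
      have : S.act (Φ f) ∈ Set.range Φ := by
        refine hclosed.mem_of_tendsto (hFS' (Φ f)) (Eventually.of_forall fun g => ?_)
        rw [hΨΦ]; exact ⟨_, rfl⟩
      obtain ⟨t, ht⟩ := this
      exact ⟨t, ht.symm⟩
    have hFSi : ∀ k, Tendsto (fun g => (Ψ g).iact k) F (𝓝 (S.iact k)) := by
      intro k
      rw [tendsto_iff_norm_sub_tendsto_zero]
      have h1 := hFS' (S.iact k)
      rw [tendsto_iff_norm_sub_tendsto_zero] at h1
      refine h1.congr fun g => ?_
      rw [← (Ψ g).act_norm ((Ψ g).iact k), AffIsom.act_iact, AffIsom.act_iact, norm_sub_rev]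
    have hiΦ : ∀ g f, (Ψ g).iact (Φ f) = Φ (g.iact f) := by
      intro g f
      have := hΨΦ g (g.iact f)
      rw [g.act_iact] at this
      rw [← this, AffIsom.iact_act]
    have hex2 : ∀ f, ∃ t, S.iact (Φ f) = Φ t := by
      intro f
      have : S.iact (Φ f) ∈ Set.range Φ := by
        refine hclosed.mem_of_tendsto (hFSi (Φ f)) (Eventually.of_forall fun g => ?_)
        rw [hiΦ]; exact ⟨_, rfl⟩
      obtain ⟨t, ht⟩ := this
      exact ⟨t, ht.symm⟩
    choose a ha using hex1
    choose b hb using hex2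
    have hla : ∀ f, Tendsto (fun g : AffIsom μ p => g.act f) F (𝓝 (a f)) := by
      intro f
      rw [hΦt Φ hiso, ← ha]
      simpa [hΨΦ] using hFS' (Φ f)
    let T : AffIsom μ p := AffIsom.mk' a b
      (fun f => hΦinj (by rw [← ha, ← hb, AffIsom.act_iact]))
      (fun f => hΦinj (by rw [← hb, ← ha, AffIsom.iact_act]))
      (fun f g => by rw [← hiso, ← ha, ← ha, AffIsom.act_pw, hiso])
      (fun t f g => by
        refine tendsto_nhds_unique (hla _) ?_
        simp_rw [AffIsom.act_affine]
        exact ((hla f).const_smul t).add ((hla g).const_smul (1 - t)))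
    have hT : Tendsto id F (𝓝 T) := AffIsom.tendsto_iff.2 hla
    have hST := AffIsom.tendsto_iff.1 (hcont hT)
    refine ⟨T, AffIsom.ext_act fun k => tendsto_nhds_unique (hST k) (hFS' k)⟩
  · intro S
    have h1 := hiso (S.act 0) 0
    rw [h0, sub_zero, sub_zero] at h1
    have h2 : (Ψ S).act 0 = Φ (S.act 0) := by rw [← hΨΦ, h0]
    rw [← h2] at h1
    exact h1.symm

end abstractPart


section transport

lemma good_of_linequiv {X Y : Type*} [MeasurableSpace X] [MeasurableSpace Y]
    {μ : Measure X} {ν : Measure Y} {p q : ℝ} [hp : Fact (0 < p)] [hq : Fact (0 < q)]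
    (J : LQ μ p → LQ ν q) (K : LQ ν q → LQ μ p) (hJK : ∀ f, J (K f) = f) (hKJ : ∀ f, K (J f) = f)
    (hJ : ∀ f g, pw ν q (J f - J g).fn = pw μ p (f - g).fn)
    (h0 : J 0 = 0)
    (hJl : ∀ (t : ℝ) f g, J (t • f + (1 - t) • g) = t • J f + (1 - t) • J g) : Good μ p ν q := by
  have hKl : ∀ (t : ℝ) f g, K (t • f + (1 - t) • g) = t • K f + (1 - t) • K g := by
    intro t f g
    have := hJl t (K f) (K g)
    rw [hJK, hJK] at this
    rw [← this, hKJ]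
  have hK : ∀ f g, pw μ p (K f - K g).fn = pw ν q (f - g).fn := by
    intro f g
    rw [← hJ, hJK, hJK]
  let Ψ : AffIsom μ p → AffIsom ν q := fun T => AffIsom.mk' (fun k => J (T.act (K k)))
    (fun k => J (T.iact (K k))) (fun f => by rw [hKJ, T.act_iact, hJK])
    (fun f => by rw [hKJ, T.iact_act, hJK])
    (fun f g => by rw [hJ, T.act_pw, hK])
    (fun t f g => by rw [hKl, T.act_affine, hJl])
  let Ψ' : AffIsom ν q → AffIsom μ p := fun T => AffIsom.mk' (fun k => K (T.act (J k)))
    (fun k => K (T.iact (J k))) (fun f => by rw [hJK, T.act_iact, hKJ])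
    (fun f => by rw [hJK, T.iact_act, hKJ])
    (fun f g => by rw [hK, T.act_pw, hJ])
    (fun t f g => by rw [hJl, T.act_affine, hKl])
  have h1 : ∀ T k, (Ψ T).act k = J (T.act (K k)) := fun _ _ => rfl
  have h2 : ∀ T k, (Ψ' T).act k = K (T.act (J k)) := fun _ _ => rfl
  have hc : Continuous Ψ := by
    rw [continuous_iff_continuousAt]
    intro T
    have h := AffIsom.tendsto_iff.1 (tendsto_id (x := 𝓝 T))
    refine AffIsom.tendsto_iff.2 fun k => ?_
    simp_rw [h1]
    exact (hΦt J hJ).1 (h (K k))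
  have hc' : Continuous Ψ' := by
    rw [continuous_iff_continuousAt]
    intro T
    have h := AffIsom.tendsto_iff.1 (tendsto_id (x := 𝓝 T))
    refine AffIsom.tendsto_iff.2 fun k => ?_
    simp_rw [h2]
    exact (hΦt K hK).1 (h (J k))
  have hl : Function.LeftInverse Ψ' Ψ := fun T => AffIsom.ext_act fun k => by
    rw [h2, h1, hKJ, hKJ]
  have hr : Function.LeftInverse Ψ Ψ' := fun T => AffIsom.ext_act fun k => by
    rw [h1, h2, hJK, hJK]
  refine ⟨Ψ, ?_, ?_, ?_, ?_⟩
  · intro S T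
    apply AffIsom.ext_act
    intro k
    rw [AffIsom.act_comp, h1, h1, h1, AffIsom.act_comp, hKJ]
  · exact .of_leftInverse hl hc' hc
  · rw [hr.surjective.range_eq]; exact isClosed_univ
  · intro S
    have h3 := hJ (S.act 0) 0
    have hK0 : K 0 = 0 := by rw [← h0, hKJ]
    have h4 : (Ψ S).act 0 = J (S.act 0) := by rw [h1, hK0]
    rw [h0, sub_zero, sub_zero, ← h4] at h3
    exact h3.symm

lemma good_map {X Y : Type*} [MeasurableSpace X] [MeasurableSpace Y]
    {μ : Measure X} {p : ℝ} [hp : Fact (0 < p)] (e : X ≃ᵐ Y) : Good μ p (μ.map e) p := by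
  have he : MeasurePreserving e μ (μ.map e) := e.measurable.measurePreserving μ
  have he' : MeasurePreserving e.symm (μ.map e) μ := he.symm e
  let J : LQ μ p → LQ (μ.map e) p := Lp.compMeasurePreserving e.symm he'
  let K : LQ (μ.map e) p → LQ μ p := Lp.compMeasurePreserving e he
  have hJ : ∀ f, (J f).fn =ᵐ[μ.map e] f.fn ∘ e.symm := fun f => Lp.coeFn_compMeasurePreserving _ he'
  have hK : ∀ f, (K f).fn =ᵐ[μ] f.fn ∘ e := fun f => Lp.coeFn_compMeasurePreserving _ he
  have Jsub : ∀ f g, J (f - g) = J f - J g := fun f g => map_sub (Lp.compMeasurePreserving e.symm he') _ _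
  have Jadd : ∀ f g, J (f + g) = J f + J g := fun f g => map_add (Lp.compMeasurePreserving e.symm he') _ _
  have Jsmul : ∀ (t : ℝ) f, J (t • f) = t • J f := by
    intro t f
    apply LQ.ext
    filter_upwards [hJ (t • f), LQ.fn_rsmul t (J f), hJ f,
      he'.quasiMeasurePreserving.ae (LQ.fn_rsmul t f)] with x h1 h2 h3 h4
    rw [h1, h2, h3, Function.comp, h4]; rfl
  refine good_of_linequiv J K ?_ ?_ ?_ ?_ ?_
  · intro f
    apply LQ.ext
    filter_upwards [hJ (K f), he'.quasiMeasurePreserving.ae (hK f)] with x h1 h2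
    rw [h1, Function.comp, h2]; simp
  · intro f
    apply LQ.ext
    filter_upwards [hK (J f), he.quasiMeasurePreserving.ae (hJ f)] with x h1 h2
    rw [h1, Function.comp, h2]; simp
  · intro f g
    rw [← Jsub, pw_congr (hJ _)]
    exact he'.lintegral_comp_emb e.symm.measurableEmbedding (fun x => ‖(f - g).fn x‖ₑ ^ p)
  · exact map_zero (Lp.compMeasurePreserving e.symm he')
  · intro t f g
    rw [Jadd, Jsmul, Jsmul]

lemma exists_type0 {X : Type*} [MeasurableSpace X] [StandardBorelSpace X] :
    ∃ (Y : Type) (_ : MeasurableSpace Y) (_ : StandardBorelSpace Y), Nonempty (X ≃ᵐ Y) := by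
  obtain ⟨e, he⟩ := exists_measurableEmbedding_real X
  exact ⟨Set.range e, inferInstance, he.measurableSet_range.standardBorel, ⟨he.equivRange⟩⟩

end transport


section scheme

variable {X : Type*} [MeasurableSpace X] {μ : Measure X} {p : ℝ} [hp : Fact (0 < p)]
  {Z : Type*} [mZ : MeasurableSpace Z] {M : Measure Z} {q : ℝ} [hq : Fact (0 < q)]

/-- exponential -/
noncomputable def eE (x : ℝ) : ℂ := Complex.exp (x * Complex.I)

lemma eE_add (x y : ℝ) : eE (x + y) = eE x * eE y := by
  simp [eE, add_mul, Complex.exp_add]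
lemma eE_zero : eE 0 = 1 := by simp [eE]
lemma norm_eE (x : ℝ) : ‖eE x‖ = 1 := Complex.norm_exp_ofReal_mul_I x
lemma enorm_eE (x : ℝ) : ‖eE x‖ₑ = 1 := by
  rw [← ofReal_norm_eq_enorm, norm_eE]; simp
lemma continuous_eE : Continuous eE := by unfold eE; fun_prop
lemma measurable_eE : Measurable eE := continuous_eE.measurable

/-- the abstract data -/
structure XiData (μ : Measure X) (p : ℝ) (M : Measure Z) (q : ℝ) where
  ξ : LQ μ p → Z → ℝ
  meas : ∀ f, Measurable (ξ f)
  add : ∀ f g, ξ (f + g) =ᵐ[M] fun z => ξ f z + ξ g z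
  smul : ∀ (t : ℝ) f, ξ (t • f) =ᵐ[M] fun z => t * ξ f z
  h1 : ∀ f, pw M q (fun z => eE (ξ f z) - 1) = pw μ p f.fn
  h2 : ∀ (T : AffIsom μ p) (w : LQ μ p →₀ ℂ),
    pw M q (fun z => w.sum fun f c => c * (eE (ξ (T.lin f) z) - 1)) =
    pw M q (fun z => w.sum fun f c => c * (eE (ξ f z) - 1))
  h3 : ∀ m : MeasurableSpace Z, 
    (∀ A B, MeasurableSet[mZ] A → MeasurableSet[m] B → A =ᵐ[M] B → MeasurableSet[m] A) →
    (∀ f, Measurable[m] (ξ f)) → ∀ A, MeasurableSet[mZ] A → MeasurableSet[m] A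
  h4 : ∃ f : ℕ → LQ μ p, ∀ᵐ z ∂M, ∃ n, ξ (f n) z ≠ 0

namespace XiData

variable (d : XiData μ p M q)

lemma memφ (f : LQ μ p) : MemLp (fun z => eE (d.ξ f z) - 1) (ENNReal.ofReal q) M := by
  have hm : AEStronglyMeasurable (fun z => eE (d.ξ f z) - 1) M :=
    ((measurable_eE.comp (d.meas f)).sub_const 1).aestronglyMeasurable
  rw [memLp_iff_pw hq.out hm, d.h1]
  exact LQ.pw_lt_top f

/-- the map -/
noncomputable def Φ (f : LQ μ p) : LQ M q := LQ.mk _ (d.memφ f)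

lemma fn_Φ (f : LQ μ p) : (d.Φ f).fn =ᵐ[M] fun z => eE (d.ξ f z) - 1 := LQ.fn_mk _

/-- closed span -/
noncomputable def D : Submodule ℂ (LQ M q) := (Submodule.span ℂ (Set.range d.Φ)).topologicalClosure

/-- approximable -/
def Appr (k : Z → ℂ) : Prop := ∃ u ∈ d.D, u.fn =ᵐ[M] k

lemma Appr.congr {d : XiData μ p M q} {k k' : Z → ℂ} (h : d.Appr k) (e : k =ᵐ[M] k') : d.Appr k' := by
  obtain ⟨u, hu, h⟩ := h
  exact ⟨u, hu, h.trans e⟩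

lemma Appr.add {d : XiData μ p M q} {k k' : Z → ℂ} (h : d.Appr k) (h' : d.Appr k') :
    d.Appr (fun z => k z + k' z) := by
  obtain ⟨u, hu, h⟩ := h
  obtain ⟨u', hu', h'⟩ := h'
  refine ⟨u + u', d.D.add_mem hu hu', ?_⟩
  filter_upwards [LQ.fn_add u u', h, h'] with z a b c
  rw [a, b, c]

lemma Appr.smul {d : XiData μ p M q} {k : Z → ℂ} (h : d.Appr k) (c : ℂ) :
    d.Appr (fun z => c * k z) := by
  obtain ⟨u, hu, h⟩ := h
  refine ⟨c • u, d.D.smul_mem c hu, ?_⟩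
  filter_upwards [LQ.fn_smul c u, h] with z a b
  rw [a, b]

lemma Appr.aesm {d : XiData μ p M q} {k : Z → ℂ} (h : d.Appr k) : AEStronglyMeasurable k M := by
  obtain ⟨u, hu, h⟩ := h
  exact u.aesm.congr h

lemma Appr.pw_lt {d : XiData μ p M q} {k : Z → ℂ} (h : d.Appr k) : pw M q k < ⊤ := by
  obtain ⟨u, hu, h⟩ := h
  rw [← pw_congr h]
  exact u.pw_lt_top

lemma appr_dct {k : ℕ → Z → ℂ} {k' : Z → ℂ} {h : Z → ℝ≥0∞} (hk : ∀ n, d.Appr (k n))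
    (hlim : ∀ᵐ z ∂M, Tendsto (fun n => k n z) atTop (𝓝 (k' z)))
    (hb : ∀ n, ∀ᵐ z ∂M, ‖k n z‖ₑ ≤ h z) (hh : ∫⁻ z, h z ^ q ∂M < ⊤) : d.Appr k' := by
  have hm : AEStronglyMeasurable k' M := aestronglyMeasurable_of_tendsto_ae atTop (fun n => (hk n).aesm) hlim
  have hb' : ∀ᵐ z ∂M, ‖k' z‖ₑ ≤ h z := by
    filter_upwards [hlim, ae_all_iff.2 hb] with z h1 h2
    exact le_of_tendsto h1.enorm (Eventually.of_forall h2)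
  have hmem : MemLp k' (ENNReal.ofReal q) M := by
    rw [memLp_iff_pw hq.out hm]
    refine lt_of_le_of_lt (lintegral_mono_ae ?_) hh
    filter_upwards [hb'] with z h2
    exact ENNReal.rpow_le_rpow h2 hq.out.le
  choose u huD hu using hk
  refine ⟨LQ.mk k' hmem, ?_, LQ.fn_mk _⟩
  refine IsClosed.mem_of_tendsto (Submodule.isClosed_topologicalClosure _) (b := atTop) (f := u) ?_
    (Eventually.of_forall huD)
  rw [LQ.tendsto_iff]
  have e : ∀ n, pw M q (fun x => (u n).fn x - (LQ.mk k' hmem).fn x) = ∫⁻ z, ‖k n z - k' z‖ₑ ^ q ∂M := by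
    intro n
    refine pw_congr ?_
    filter_upwards [hu n, LQ.fn_mk hmem] with z a b
    rw [a, b]
  simp_rw [e]
  have e0 : (0 : ℝ≥0∞) = ∫⁻ z, 0 ∂M := by simp
  rw [e0]
  refine tendsto_lintegral_of_dominated_convergence' (fun z => (2 * h z) ^ q) ?_ ?_ ?_ ?_
  · intro n
    have : AEStronglyMeasurable (k n) M := (u n).aesm.congr (hu n)
    exact (this.sub hm).enorm.pow_const q
  · intro n
    filter_upwards [hb n, hb'] with z a b
    refine ENNReal.rpow_le_rpow ?_ hq.out.le
    calc _ ≤ ‖k n z‖ₑ + ‖k' z‖ₑ := enorm_sub_le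
      _ ≤ h z + h z := by gcongr
      _ = _ := by ring
  · simp_rw [ENNReal.mul_rpow_of_nonneg _ _ hq.out.le]
    rw [lintegral_const_mul' _ _ (by simp [hq.out.le])]
    exact ENNReal.mul_ne_top (by simp [hq.out.le]) hh.ne
  · filter_upwards [hlim] with z hz
    have h1 : Tendsto (fun n => ‖k n z - k' z‖ₑ) atTop (𝓝 0) := by
      have := (hz.sub_const (k' z)).enorm
      simpa using this
    have h2 := (ENNReal.continuous_rpow_const (y := q)).tendsto 0 |>.comp h1
    rw [ENNReal.zero_rpow_of_pos hq.out] at h2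
    exact h2

/-- multiplier -/
def Mult (m : Z → ℂ) : Prop := ∀ k, d.Appr k → d.Appr (fun z => m z * k z)

variable {d}

lemma Mult.congr {m m' : Z → ℂ} (h : d.Mult m) (e : m =ᵐ[M] m') : d.Mult m' := fun k hk =>
  (h k hk).congr (by filter_upwards [e] with z hz; rw [hz])

lemma Mult.add {m m' : Z → ℂ} (h : d.Mult m) (h' : d.Mult m') : d.Mult (fun z => m z + m' z) :=
  fun k hk => ((h k hk).add (h' k hk)).congr (by refine .of_forall fun z => ?_; simp only []; ring)

lemma Mult.mul {m m' : Z → ℂ} (h : d.Mult m) (h' : d.Mult m') : d.Mult (fun z => m z * m' z) :=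
  fun k hk => (h _ (h' k hk)).congr (by refine .of_forall fun z => ?_; simp only []; ring)

lemma mult_const (c : ℂ) : d.Mult (fun _ => c) := fun k hk => hk.smul c

lemma mult_dct {m : ℕ → Z → ℂ} {m' : Z → ℂ} (C : ℝ) (hm : ∀ n, d.Mult (m n))
    (hlim : ∀ᵐ z ∂M, Tendsto (fun n => m n z) atTop (𝓝 (m' z)))
    (hb : ∀ n z, ‖m n z‖ ≤ C) : d.Mult m' := by
  intro k hk
  refine d.appr_dct (k := fun n z => m n z * k z) (h := fun z => ENNReal.ofReal C * ‖k z‖ₑ)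
    (fun n => hm n k hk) ?_ ?_ ?_
  · filter_upwards [hlim] with z hz
    exact hz.mul_const _
  · intro n
    refine .of_forall fun z => ?_
    rw [enorm_mul]
    gcongr
    rw [← ofReal_norm_eq_enorm]
    exact ENNReal.ofReal_le_ofReal (hb n z)
  · simp_rw [ENNReal.mul_rpow_of_nonneg _ _ hq.out.le]
    rw [lintegral_const_mul' _ _ (by simp [hq.out.le])]
    exact ENNReal.mul_lt_top (ENNReal.rpow_lt_top_of_nonneg hq.out.le ENNReal.ofReal_ne_top) hk.pw_lt

lemma mult_eE (b : LQ μ p) : d.Mult (fun z => eE (d.ξ b z)) := by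
  have hE : AEStronglyMeasurable (fun z => eE (d.ξ b z)) M :=
    (measurable_eE.comp (d.meas b)).aestronglyMeasurable
  have hmem : ∀ u : LQ M q, MemLp (fun z => eE (d.ξ b z) * u.fn z) (ENNReal.ofReal q) M := by
    intro u
    have hm : AEStronglyMeasurable (fun z => eE (d.ξ b z) * u.fn z) M := hE.mul u.aesm
    rw [memLp_iff_pw hq.out hm]
    rw [pw_congr_norm (g := u.fn) (.of_forall fun z => by rw [enorm_mul, enorm_eE, one_mul])]
    exact u.pw_lt_top
  let L : LQ M q →ₗ[ℂ] LQ M q :=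
    { toFun := fun u => LQ.mk _ (hmem u)
      map_add' := by
        intro u v
        apply LQ.ext
        filter_upwards [LQ.fn_mk (hmem (u + v)), LQ.fn_mk (hmem u), LQ.fn_mk (hmem v), LQ.fn_add u v,
          LQ.fn_add (LQ.mk _ (hmem u)) (LQ.mk _ (hmem v))] with z h1 h2 h3 h4 h5
        rw [h1, h5, h2, h3, h4]; ring
      map_smul' := by
        intro c u
        apply LQ.ext
        simp only [RingHom.id_apply]
        filter_upwards [LQ.fn_mk (hmem (c • u)), LQ.fn_mk (hmem u), LQ.fn_smul c u,
          LQ.fn_smul c (LQ.mk _ (hmem u))] with z h1 h2 h3 h4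
        rw [h1, h4, h2, h3]; ring }
  have hL : ∀ u, (L u).fn =ᵐ[M] fun z => eE (d.ξ b z) * u.fn z := fun u => LQ.fn_mk (hmem u)
  have hLc : Continuous L := by
    have : Isometry L := by
      refine AddMonoidHomClass.isometry_of_norm L fun u => ?_
      rw [LQ.norm_eq_iff, pw_congr (hL u)]
      exact pw_congr_norm (.of_forall fun z => by rw [enorm_mul, enorm_eE, one_mul])
    exact this.continuous
  have hspan : ∀ u ∈ Submodule.span ℂ (Set.range d.Φ), L u ∈ Submodule.span ℂ (Set.range d.Φ) := by
    intro u hu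
    have : Submodule.span ℂ (Set.range d.Φ) ≤ (Submodule.span ℂ (Set.range d.Φ)).comap L := by
      rw [Submodule.span_le]
      rintro _ ⟨f, rfl⟩
      have : L (d.Φ f) = d.Φ (f + b) - d.Φ b := by
        apply LQ.ext
        filter_upwards [hL (d.Φ f), d.fn_Φ f, d.fn_Φ b, d.fn_Φ (f + b), d.add f b,
          LQ.fn_sub (d.Φ (f + b)) (d.Φ b)] with z h1 h2 h3 h4 h5 h6
        rw [h1, h6, h2, h3, h4, h5, eE_add]; ring
      show L (d.Φ f) ∈ Submodule.span ℂ (Set.range d.Φ)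
      rw [this]
      exact Submodule.sub_mem _ (Submodule.subset_span ⟨_, rfl⟩) (Submodule.subset_span ⟨_, rfl⟩)
    exact this hu
  rintro k ⟨u, hu, huk⟩
  refine ⟨L u, ?_, ?_⟩
  · exact map_mem_closure hLc hu hspan
  · filter_upwards [hL u, huk] with z h1 h2
    rw [h1, h2]

lemma mult_sin (b : LQ μ p) : d.Mult (fun z => ((Real.sin (d.ξ b z) : ℝ) : ℂ)) := by
  have h1 := (mult_eE (d := d) b).mul (mult_const (1 / (2 * Complex.I)))
  have h2 := (mult_eE (d := d) ((-1 : ℝ) • b)).mul (mult_const (-1 / (2 * Complex.I)))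
  refine (h1.add h2).congr ?_
  filter_upwards [d.smul (-1) b] with z hz
  rw [hz]
  simp only [eE, Complex.ofReal_sin, Complex.sin]
  have : Complex.I ≠ 0 := Complex.I_ne_zero
  push_cast
  field_simp
  have : Complex.I ^ 2 = -1 := Complex.I_sq
  ring_nf
  rw [this]; ring

lemma mult_poly (b : LQ μ p) (P : Polynomial ℝ) :
    d.Mult (fun z => ((P.eval (Real.sin (d.ξ b z)) : ℝ) : ℂ)) := by
  induction P using Polynomial.induction_on' with
  | add P Q hP hQ => simpa using hP.add hQ
  | monomial n a =>
    simp only [Polynomial.eval_monomial, Complex.ofReal_mul, Complex.ofReal_pow]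
    refine (mult_const (a : ℂ)).mul ?_
    induction n with
    | zero => simpa using mult_const (d := d) 1
    | succ n ih =>
      simp_rw [pow_succ]
      exact ih.mul (mult_sin b)

lemma mult_cont (b : LQ μ p) (g : ℝ → ℝ) (hg : Continuous g) :
    d.Mult (fun z => ((g (Real.sin (d.ξ b z)) : ℝ) : ℂ)) := by
  have hP : ∀ n : ℕ, ∃ P : Polynomial ℝ, ∀ x ∈ Set.Icc (-1 : ℝ) 1, |P.eval x - g x| < 1 / ((n : ℝ) + 1) :=
    fun n => exists_polynomial_near_of_continuousOn _ _ g hg.continuousOn _ (by positivity)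
  choose P hP using hP
  obtain ⟨C, hC⟩ := (isCompact_Icc (a := (-1 : ℝ)) (b := 1)).exists_bound_of_continuousOn hg.continuousOn
  refine mult_dct (m := fun n z => ((P n).eval (Real.sin (d.ξ b z)) : ℝ)) (C + 1) (fun n => mult_poly b _) ?_ ?_
  · refine .of_forall fun z => ?_
    refine (Complex.continuous_ofReal.tendsto _).comp ?_
    rw [tendsto_iff_norm_sub_tendsto_zero]
    refine squeeze_zero (fun _ => norm_nonneg _) (fun n => (hP n _ (Real.sin_mem_Icc _)).le)
      tendsto_one_div_add_atTop_nhds_zero_nat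
  · intro n z
    rw [Complex.norm_real]
    have h1 := (hP n _ (Real.sin_mem_Icc (d.ξ b z))).le
    have h2 := hC _ (Real.sin_mem_Icc (d.ξ b z))
    have h3 : 1 / ((n : ℝ) + 1) ≤ 1 := by
      rw [div_le_one (by positivity)]; linarith [n.cast_nonneg (α := ℝ)]
    have h4 := norm_sub_norm_le ((P n).eval (Real.sin (d.ξ b z))) (g (Real.sin (d.ξ b z)))
    rw [Real.norm_eq_abs (_ - _)] at h4
    linarith

lemma mult_le (b : LQ μ p) (a : ℝ) :
    d.Mult ({z | Real.sin (d.ξ b z) ≤ a}.indicator fun _ => (1 : ℂ)) := by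
  refine mult_dct (m := fun n z => ((max 0 (1 - (n : ℝ) * max 0 (Real.sin (d.ξ b z) - a)) : ℝ) : ℂ)) 1
    (fun n => mult_cont b (fun x => max 0 (1 - (n : ℝ) * max 0 (x - a))) (by fun_prop)) ?_ ?_
  · refine .of_forall fun z => ?_
    by_cases h : Real.sin (d.ξ b z) ≤ a
    · rw [Set.indicator_of_mem (show z ∈ {z | Real.sin (d.ξ b z) ≤ a} from h)]
      rw [max_eq_left (sub_nonpos.2 h)]
      simp
    · rw [Set.indicator_of_notMem (show z ∉ {z | Real.sin (d.ξ b z) ≤ a} from h)]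
      push Not at h
      rw [max_eq_right (sub_pos.2 h).le]
      refine tendsto_const_nhds.congr' ?_
      have h1 : Tendsto (fun n : ℕ => (n : ℝ) * (Real.sin (d.ξ b z) - a)) atTop atTop :=
        tendsto_natCast_atTop_atTop.atTop_mul_const (sub_pos.2 h)
      filter_upwards [h1.eventually_ge_atTop 1] with n hn
      rw [max_eq_left (by linarith)]; simp
  · intro n z
    rw [Complex.norm_real, Real.norm_eq_abs, abs_of_nonneg (le_max_left _ _)]
    refine max_le zero_le_one ?_
    have : 0 ≤ (n : ℝ) * max 0 (Real.sin (d.ξ b z) - a) := mul_nonneg n.cast_nonneg (le_max_left _ _)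
    linarith

lemma mult_compl {A : Set Z} (h : d.Mult (A.indicator fun _ => (1 : ℂ))) :
    d.Mult (Aᶜ.indicator fun _ => (1 : ℂ)) := by
  refine ((mult_const 1).add ((mult_const (-1)).mul h)).congr (.of_forall fun z => ?_)
  by_cases hz : z ∈ A <;> simp [hz]

lemma mult_union {A B : Set Z} (h : d.Mult (A.indicator fun _ => (1 : ℂ)))
    (h' : d.Mult (B.indicator fun _ => (1 : ℂ))) :
    d.Mult ((A ∪ B).indicator fun _ => (1 : ℂ)) := by
  refine (h.add ((mult_compl h).mul h')).congr (.of_forall fun z => ?_)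
  by_cases hz : z ∈ A <;> by_cases hz' : z ∈ B <;> simp [hz, hz']

variable (d) in
/-- the sigma-algebra -/
def sig : MeasurableSpace Z where
  MeasurableSet' A := MeasurableSet A ∧ d.Mult (A.indicator fun _ => (1 : ℂ))
  measurableSet_empty := ⟨.empty, by simpa using mult_const 0⟩
  measurableSet_compl A h := ⟨h.1.compl, mult_compl h.2⟩
  measurableSet_iUnion A h := by
    refine ⟨.iUnion fun n => (h n).1, ?_⟩
    have h1 : ∀ n, d.Mult ((Set.accumulate A n).indicator fun _ => (1 : ℂ)) := by
      intro n
      induction n with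
      | zero => simpa using (h 0).2
      | succ n ih =>
        rw [Set.accumulate_succ]
        exact mult_union ih (h _).2
    refine mult_dct (m := fun n => (Set.accumulate A n).indicator fun _ => (1 : ℂ)) 1 h1 ?_ ?_
    · refine .of_forall fun z => ?_
      have := Set.monotone_accumulate (s := A) |>.tendsto_indicator _ (fun _ => (1 : ℂ)) z
      rw [Set.iUnion_accumulate] at this
      exact this.mono_right (pure_le_nhds _)
    · intro n z
      by_cases hz : z ∈ Set.accumulate A n <;> simp [hz]

lemma sig_all (A : Set Z) (hA : MeasurableSet A) : d.Mult (A.indicator fun _ => (1 : ℂ)) := by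
  have hae : ∀ A B, MeasurableSet A → MeasurableSet[d.sig] B → A =ᵐ[M] B → MeasurableSet[d.sig] A := by
    intro A B hA hB e
    refine ⟨hA, hB.2.congr ?_⟩
    exact (indicator_ae_eq_of_ae_eq_set e).symm
  refine (d.h3 d.sig hae ?_ A hA).2
  intro f
  have h1 : ∀ n : ℕ, Measurable[d.sig] (fun z => ((n : ℝ) + 1) * Real.sin (((n : ℝ) + 1)⁻¹ * d.ξ f z)) := by
    intro n
    refine Measurable.const_mul (m := d.sig) ?_ _
    refine @measurable_of_Iic ℝ Z _ _ _ d.sig _ _ _ _ ?_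
    intro a
    have hm : MeasurableSet {z | Real.sin (d.ξ (((n : ℝ) + 1)⁻¹ • f) z) ≤ a} :=
      (Real.measurable_sin.comp (d.meas _)) measurableSet_Iic
    refine hae _ {z | Real.sin (d.ξ (((n : ℝ) + 1)⁻¹ • f) z) ≤ a} ?_ ⟨hm, mult_le _ a⟩ ?_
    · exact (Real.measurable_sin.comp ((d.meas f).const_mul _)) measurableSet_Iic
    · filter_upwards [d.smul ((n : ℝ) + 1)⁻¹ f] with z hz
      apply propext
      show Real.sin (((n : ℝ) + 1)⁻¹ * d.ξ f z) ≤ a ↔ Real.sin (d.ξ (((n : ℝ) + 1)⁻¹ • f) z) ≤ a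
      rw [hz]
  refine @measurable_of_tendsto_metrizable _ _ d.sig _ _ _ _ _ _ h1 ?_
  rw [tendsto_pi_nhds]
  intro z
  have h2 : HasDerivAt (fun t : ℝ => Real.sin (t * d.ξ f z)) (d.ξ f z) 0 := by
    have := ((hasDerivAt_id (0 : ℝ)).mul_const (d.ξ f z)).sin
    simpa using this
  rw [hasDerivAt_iff_tendsto_slope_zero] at h2
  have h3 : Tendsto (fun n : ℕ => ((n : ℝ) + 1)⁻¹) atTop (𝓝[≠] 0) := by
    rw [tendsto_nhdsWithin_iff]
    refine ⟨by simpa using tendsto_one_div_add_atTop_nhds_zero_nat (𝕜 := ℝ), .of_forall fun n => ?_⟩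
    simp only [Set.mem_compl_iff, Set.mem_singleton_iff]
    positivity
  refine (h2.comp h3).congr fun n => ?_
  simp

lemma mult_simple (s : SimpleFunc Z ℂ) : d.Mult s := by
  induction s using SimpleFunc.induction with
  | const c hs =>
    refine ((mult_const c).mul (sig_all _ hs)).congr (.of_forall fun z => ?_)
    simp [SimpleFunc.coe_piecewise, Set.piecewise, Set.indicator]
  | add _ hf hg => exact hf.add hg

lemma mult_bdd (r : Z → ℂ) (hr : StronglyMeasurable r) (C : ℝ) (hC : ∀ z, ‖r z‖ ≤ C) : d.Mult r := by
  by_cases hZ : Nonempty Z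
  · have hC0 : 0 ≤ C := (norm_nonneg _).trans (hC hZ.some)
    refine mult_dct (m := fun n => hr.approxBounded C n) C (fun n => mult_simple _) ?_ ?_
    · exact hr.tendsto_approxBounded_ae (.of_forall hC)
    · intro n z
      exact hr.norm_approxBounded_le hC0 n z
  · rw [not_nonempty_iff] at hZ
    exact (mult_const 0).congr (.of_forall fun z => isEmptyElim z)

variable (d)

lemma exists_phi (d : XiData μ p M q) : ∃ f : ℕ → LQ μ p, ∀ᵐ z ∂M, ∃ n, eE (d.ξ (f n) z) - 1 ≠ 0 := by
  obtain ⟨f, hf⟩ := d.h4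
  let F : ℕ × ℕ → LQ μ p := fun a => ((a.2 : ℝ) + 1)⁻¹ • f a.1
  refine ⟨fun n => F (Nat.unpair n), ?_⟩
  have hs := ae_all_iff.2 fun a : ℕ × ℕ => d.smul ((a.2 : ℝ) + 1)⁻¹ (f a.1)
  filter_upwards [hf, hs] with z hz hs
  obtain ⟨n, hn⟩ := hz
  obtain ⟨m, hm⟩ := exists_nat_gt (|d.ξ (f n) z|)
  refine ⟨Nat.pair n m, ?_⟩
  simp only [Nat.unpair_pair]
  have e : d.ξ (F (n, m)) z = ((m : ℝ) + 1)⁻¹ * d.ξ (f n) z := hs (n, m)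
  rw [e]
  intro h
  have him : Real.sin (((m : ℝ) + 1)⁻¹ * d.ξ (f n) z) = 0 := by
    have := congrArg Complex.im h
    simpa only [eE, Complex.sub_im, Complex.exp_ofReal_mul_I_im, Complex.one_im, sub_zero, Complex.zero_im] using this
  have hlt : |((m : ℝ) + 1)⁻¹ * d.ξ (f n) z| < 1 := by
    rw [abs_mul, abs_of_pos (by positivity), inv_mul_lt_one₀ (by positivity)]
    linarith
  rw [abs_lt] at hlt
  have := (Real.sin_eq_zero_iff_of_lt_of_lt (by linarith [Real.pi_gt_three]) (by linarith [Real.pi_gt_three])).1 him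
  have hm1 : ((m : ℝ) + 1)⁻¹ ≠ 0 := by positivity
  simp_all

lemma sigmaFinite (d : XiData μ p M q) : SigmaFinite M := by
  obtain ⟨f, hf⟩ := d.exists_phi
  let S : ℕ × ℕ → Set Z := fun a => {z | (1 : ℝ≥0∞) ≤ (a.2 : ℝ≥0∞) * ‖eE (d.ξ (f a.1) z) - 1‖ₑ ^ q}
  have hN : M {z | ¬ ∃ n, eE (d.ξ (f n) z) - 1 ≠ 0} = 0 := hf
  refine Measure.sigmaFinite_of_countable (S := insert {z | ¬ ∃ n, eE (d.ξ (f n) z) - 1 ≠ 0} (Set.range S))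
    ((Set.countable_range S).insert _) ?_ ?_
  · rintro s (rfl | ⟨a, rfl⟩)
    · rw [hN]; simp
    · have hm : Measurable fun z => (a.2 : ℝ≥0∞) * ‖eE (d.ξ (f a.1) z) - 1‖ₑ ^ q := by
        have := measurable_eE.comp (d.meas (f a.1))
        have := (this.sub_const 1).enorm.pow_const q
        exact this.const_mul _
      have := mul_meas_ge_le_lintegral hm (μ := M) 1
      rw [one_mul] at this
      refine lt_of_le_of_lt this ?_
      rw [lintegral_const_mul' _ _ (by simp)]
      refine ENNReal.mul_lt_top (by simp) ?_
      have := d.h1 (f a.1)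
      unfold pw at this
      rw [this]
      exact LQ.pw_lt_top _
  · rw [Set.eq_univ_iff_forall]
    intro z
    by_cases h : ∃ n, eE (d.ξ (f n) z) - 1 ≠ 0
    · obtain ⟨n, hn⟩ := h
      have h0 : ‖eE (d.ξ (f n) z) - 1‖ₑ ^ q ≠ 0 := by simp [hn, hq.out.le]
      obtain ⟨m, hm⟩ := ENNReal.exists_nat_mul_gt h0 one_ne_top
      exact ⟨S (n, m), Or.inr ⟨_, rfl⟩, hm.le⟩
    · exact ⟨_, Or.inl rfl, h⟩

lemma dense (d : XiData μ p M q) : d.D = ⊤ := by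
  rw [eq_top_iff]
  intro u _
  obtain ⟨f, hf⟩ := d.exists_phi
  suffices h : d.Appr u.fn by
    obtain ⟨v, hv, e⟩ := h
    rwa [← LQ.ext e]
  let φ : ℕ → Z → ℂ := fun n z => eE (d.ξ (f n) z) - 1
  have hφm : ∀ n, Measurable (φ n) := fun n => (measurable_eE.comp (d.meas _)).sub_const 1
  have hφ : ∀ n, d.Appr (φ n) := fun n =>
    ⟨d.Φ (f n), Submodule.le_topologicalClosure _ (Submodule.subset_span ⟨_, rfl⟩), d.fn_Φ _⟩
  have hφn : ∀ n, d.Appr (fun z => (‖φ n z‖ : ℂ)) := by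
    intro n
    have := mult_bdd (d := d) (fun z => (‖φ n z‖ : ℂ) / φ n z)
      (Measurable.stronglyMeasurable (by have := hφm n; fun_prop)) 1 (fun z => by
        simp only [norm_div, Complex.norm_real, norm_norm]; exact div_self_le_one _)
    refine (this _ (hφ n)).congr (.of_forall fun z => ?_)
    by_cases h : φ n z = 0
    · simp [h]
    · field_simp
  let ψ : ℕ → Z → ℝ := fun N z => ∑ j ∈ Finset.range N, ‖φ j z‖
  have hψm : ∀ n, Measurable (ψ n) := fun n => by
    refine Finset.measurable_fun_sum _ fun j _ => (hφm j).norm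
  have hψ0 : ∀ n z, 0 ≤ ψ n z := fun n z => Finset.sum_nonneg fun _ _ => norm_nonneg _
  have hψ : ∀ N, d.Appr (fun z => (ψ N z : ℂ)) := by
    intro N
    induction N with
    | zero =>
      refine ((hφ 0).smul 0).congr (.of_forall fun z => ?_)
      simp [ψ]
    | succ n ih =>
      refine (ih.add (hφn n)).congr (.of_forall fun z => ?_)
      simp [ψ, Finset.sum_range_succ]
  let B : ℕ → Set Z := fun N => {z | ‖u.fn z‖ ≤ N * ψ N z}
  have hB : ∀ N, MeasurableSet (B N) := fun N =>
    measurableSet_le u.sm.measurable.norm ((hψm N).const_mul _)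
  refine d.appr_dct (k := fun N => (B N).indicator u.fn) (h := fun z => ‖u.fn z‖ₑ) ?_ ?_ ?_ u.pw_lt_top
  · intro N
    have := mult_bdd (d := d) ((B N).indicator fun z => u.fn z / (ψ N z : ℂ)) (by
      refine StronglyMeasurable.indicator ?_ (hB N)
      exact Measurable.stronglyMeasurable (u.sm.measurable.div (Complex.measurable_ofReal.comp (hψm N)))) N
      (fun z => by
        by_cases hz : z ∈ B N
        · rw [Set.indicator_of_mem hz, norm_div, Complex.norm_real, Real.norm_of_nonneg (hψ0 _ _)]
          exact div_le_of_le_mul₀ (hψ0 _ _) N.cast_nonneg hz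
        · simp [hz])
    refine (this _ (hψ N)).congr (.of_forall fun z => ?_)
    by_cases hz : z ∈ B N
    · simp only [Set.indicator_of_mem hz]
      by_cases h : ψ N z = 0
      · have : ‖u.fn z‖ ≤ N * ψ N z := hz
        rw [h, mul_zero] at this
        have := norm_le_zero_iff.1 this
        simp [this]
      · have : (ψ N z : ℂ) ≠ 0 := by exact_mod_cast h
        field_simp
    · simp [hz]
  · filter_upwards [hf] with z hz
    obtain ⟨n, hn⟩ := hz
    refine tendsto_const_nhds.congr' ?_
    have hpos : 0 < ‖φ n z‖ := norm_pos_iff.2 hn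
    have h1 : Tendsto (fun N : ℕ => (N : ℝ) * ‖φ n z‖) atTop atTop :=
      tendsto_natCast_atTop_atTop.atTop_mul_const hpos
    filter_upwards [h1.eventually_ge_atTop ‖u.fn z‖, eventually_gt_atTop n] with N h2 h3
    rw [Set.indicator_of_mem]
    refine h2.trans ?_
    gcongr
    exact Finset.single_le_sum (f := fun j => ‖φ j z‖) (fun _ _ => norm_nonneg _) (Finset.mem_range.2 h3)
  · intro N
    refine .of_forall fun z => ?_
    by_cases hz : z ∈ B N <;> simp [hz]

lemma fn_lc {V : Type*} (G : V → LQ M q) (w : V →₀ ℂ) :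
    (Finsupp.linearCombination ℂ G w).fn =ᵐ[M] fun z => w.sum fun f c => c * (G f).fn z := by
  rw [Finsupp.linearCombination_apply, Finsupp.sum]
  have h := ae_all_iff.2 fun f : w.support => LQ.fn_smul (w f) (G f)
  filter_upwards [LQ.fn_sum w.support (fun f => w f • G f), h] with z h1 h2
  rw [h1, Finsupp.sum]
  exact Finset.sum_congr rfl fun f hf => h2 ⟨f, hf⟩

theorem good (d : XiData μ p M q) : Good μ p M q := by
  have hz : d.ξ 0 =ᵐ[M] fun _ => 0 := by
    have := d.smul 0 0
    simpa using this
  refine good_of_phi d.Φ ?_ ?_ ?_ ?_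
  · apply LQ.ext
    filter_upwards [d.fn_Φ 0, hz, LQ.fn_zero (ν := M) (q := q)] with z h1 h2 h3
    rw [h1, h2, h3, eE_zero, sub_self]
  · intro f f'
    rw [← d.h1]
    refine pw_congr_norm ?_
    have := d.add (f - f') f'
    rw [sub_add_cancel] at this
    filter_upwards [LQ.fn_sub (d.Φ f) (d.Φ f'), d.fn_Φ f, d.fn_Φ f', this] with z h1 h2 h3 h4
    rw [h1, h2, h3, h4, eE_add]
    have : eE (d.ξ (f - f') z) * eE (d.ξ f' z) - 1 - (eE (d.ξ f' z) - 1) = eE (d.ξ f' z) * (eE (d.ξ (f - f') z) - 1) := by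
      ring
    rw [this, enorm_mul, enorm_eE, one_mul]
  · have h := d.dense
    rw [DenseRange, ← LinearMap.coe_range, Finsupp.range_linearCombination, Submodule.dense_iff_topologicalClosure_eq_top]
    exact h
  · intro T w
    rw [LQ.norm_eq_iff, pw_congr (fn_lc _ w), pw_congr (fn_lc _ w)]
    have e2 : pw M q (fun z => w.sum fun f c => c * (d.Φ f).fn z) =
        pw M q (fun z => w.sum fun f c => c * (eE (d.ξ f z) - 1)) := by
      refine pw_congr ?_
      have h := ae_all_iff.2 fun f : w.support => d.fn_Φ f
      filter_upwards [h] with z h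
      exact Finset.sum_congr rfl fun f hf => by simp only []; rw [h ⟨f, hf⟩]
    rw [e2, ← d.h2 T w]
    refine pw_congr_norm ?_
    have h1 := ae_all_iff.2 fun f : w.support => d.fn_Φ (T.act f)
    have h2 := ae_all_iff.2 fun f : w.support => LQ.fn_sub (d.Φ (T.act f)) (d.Φ (T.act 0))
    have h3 := ae_all_iff.2 fun f : w.support => d.add (T.lin f) (T.act 0)
    filter_upwards [h1, h2, h3, d.fn_Φ (T.act 0)] with z h1 h2 h3 h4
    have : (w.sum fun f c => c * (d.Φ (T.act f) - d.Φ (T.act 0)).fn z) =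
        eE (d.ξ (T.act 0) z) * w.sum fun f c => c * (eE (d.ξ (T.lin f) z) - 1) := by
      rw [Finsupp.mul_sum]
      refine Finset.sum_congr rfl fun f hf => ?_
      have h3' := h3 ⟨f, hf⟩
      simp only [← T.act_eq] at h3'
      simp only []
      rw [h2 ⟨f, hf⟩]
      simp only []
      rw [h1 ⟨f, hf⟩, h4]
      simp only []
      rw [h3', eE_add]
      ring
    rw [this, enorm_mul, enorm_eE, one_mul]

end XiData

end scheme


section levy

/-- unnormalised Levy measure -/
noncomputable def lam0 (p : ℝ) : Measure ℂ :=
  (volume : Measure ℂ).withDensity fun ζ => ENNReal.ofReal (‖ζ‖ ^ (-(2 + p)))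

lemma meas_dens (p : ℝ) : Measurable fun ζ : ℂ => ENNReal.ofReal (‖ζ‖ ^ (-(2 + p))) := by
  fun_prop

instance (p : ℝ) : SigmaFinite (lam0 p) := by
  unfold lam0
  exact SigmaFinite.withDensity_ofReal _

lemma map_mul_volume (a : ℂ) (ha : a ≠ 0) :
    (volume : Measure ℂ).map (fun ζ => a * ζ) = ENNReal.ofReal (‖a‖ ^ (-2 : ℝ)) • volume := by
  have hdet : LinearMap.det (LinearMap.mulLeft ℝ a) = ‖a‖ ^ 2 := by
    have := Algebra.norm_complex_apply a
    rw [Complex.normSq_eq_norm_sq] at this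
    exact this
  have h := Measure.map_linearMap_addHaar_eq_smul_addHaar (volume : Measure ℂ) (f := LinearMap.mulLeft ℝ a)
    (by rw [hdet]; positivity)
  rw [hdet] at h
  have e : |(‖a‖ ^ 2)⁻¹| = ‖a‖ ^ (-2 : ℝ) := by
    rw [abs_of_nonneg (by positivity), Real.rpow_neg (norm_nonneg _)]
    norm_num
  rw [e] at h
  exact h

lemma lam0_scale (p : ℝ) (a : ℂ) (ha : a ≠ 0) (G : ℂ → ℝ≥0∞) (hG : Measurable G) :
    ∫⁻ ζ, G (a * ζ) ∂(lam0 p) = ‖a‖ₑ ^ p * ∫⁻ ζ, G ζ ∂(lam0 p) := by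
  have hn : 0 < ‖a‖ := norm_pos_iff.2 ha
  unfold lam0
  rw [lintegral_withDensity_eq_lintegral_mul _ (meas_dens p) hG,
    lintegral_withDensity_eq_lintegral_mul _ (meas_dens p) (by fun_prop)]
  have e1 : ∀ ζ : ℂ, ((fun ζ : ℂ => ENNReal.ofReal (‖ζ‖ ^ (-(2 + p)))) * fun a_1 => G (a * a_1)) ζ =
      ENNReal.ofReal (‖a‖ ^ (2 + p)) *
      ((fun ζ => (fun ζ : ℂ => ENNReal.ofReal (‖ζ‖ ^ (-(2 + p)))) ζ * G ζ) (a * ζ)) := by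
    intro ζ
    simp only [Pi.mul_apply]
    rw [← mul_assoc, ← ENNReal.ofReal_mul (by positivity), norm_mul, Real.mul_rpow (by positivity) (by positivity),
      ← mul_assoc, ← Real.rpow_add hn]
    simp
  have hm : Measurable (fun ζ => (fun ζ : ℂ => ENNReal.ofReal (‖ζ‖ ^ (-(2 + p)))) ζ * G ζ) :=
    (meas_dens p).mul hG
  have hm' : Measurable (fun ζ => (fun ζ => (fun ζ : ℂ => ENNReal.ofReal (‖ζ‖ ^ (-(2 + p)))) ζ * G ζ) (a * ζ)) :=
    hm.comp (measurable_const_mul a)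
  rw [lintegral_congr e1, lintegral_const_mul _ hm', ← lintegral_map hm (measurable_const_mul a), map_mul_volume a ha,
    lintegral_smul_measure, smul_eq_mul, ← mul_assoc, ← ENNReal.ofReal_mul (by positivity), ← Real.rpow_add hn,
    ← ofReal_norm_eq_enorm, ENNReal.ofReal_rpow_of_pos hn]
  congr 3
  ring

lemma lam0_conj (p : ℝ) (G : ℂ → ℝ≥0∞) (hG : Measurable G) :
    ∫⁻ ζ, G (starRingEnd ℂ ζ) ∂(lam0 p) = ∫⁻ ζ, G ζ ∂(lam0 p) := by
  unfold lam0
  have hG' : Measurable fun ζ => G (starRingEnd ℂ ζ) := hG.comp Complex.continuous_conj.measurable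
  rw [lintegral_withDensity_eq_lintegral_mul _ (meas_dens p) hG,
    lintegral_withDensity_eq_lintegral_mul _ (meas_dens p) hG']
  have hm : Measurable (fun ζ => (fun ζ : ℂ => ENNReal.ofReal (‖ζ‖ ^ (-(2 + p)))) ζ * G ζ) :=
    (meas_dens p).mul hG
  have := Complex.conjLIE.measurePreserving.lintegral_comp hm
  simpa using this

/-- normalising constant -/
noncomputable def kap (p q : ℝ) : ℝ≥0∞ := ∫⁻ ζ, ‖eE ζ.re - 1‖ₑ ^ q ∂(lam0 p)

lemma norm_eE_sub_one_le (x : ℝ) : ‖eE x - 1‖ ≤ |x| := by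
  have := Real.norm_exp_I_mul_ofReal_sub_one_le (x := x)
  rw [mul_comm] at this
  exact this

lemma measF (q : ℝ) : Measurable fun ζ : ℂ => ‖eE ζ.re - 1‖ₑ ^ q := by
  have := (measurable_eE.comp Complex.measurable_re).sub_const 1
  exact this.enorm.pow_const q

lemma kap_lt_top {p q : ℝ} (hp : 0 < p) (hpq : p < q) : kap p q < ⊤ := by
  have hq : 0 < q := hp.trans hpq
  have hint : Integrable (fun ζ : ℂ => (fun y : ℝ => min y 1 ^ q * y ^ (-(2 + p))) ‖ζ‖) := by
    rw [integrable_fun_norm_addHaar (volume : Measure ℂ) (f := fun y : ℝ => min y 1 ^ q * y ^ (-(2 + p)))]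
    rw [Complex.finrank_real_complex]
    rw [← Set.Ioc_union_Ioi_eq_Ioi (zero_le_one' ℝ)]
    refine IntegrableOn.union ?_ ?_
    · have h : IntegrableOn (fun y : ℝ => y ^ (q - p - 1)) (Set.Ioc 0 1) :=
        (intervalIntegrable_iff_integrableOn_Ioc_of_le zero_le_one).1
          (intervalIntegral.intervalIntegrable_rpow' (by linarith))
      refine h.congr_fun (fun y hy => ?_) measurableSet_Ioc
      simp only [smul_eq_mul]
      have hy0 := hy.1
      rw [min_eq_left hy.2, ← Real.rpow_add hy0]
      norm_num
      nth_rw 2 [← Real.rpow_one y]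
      rw [← Real.rpow_add hy0]
      congr 1; ring
    · have h : IntegrableOn (fun y : ℝ => y ^ (- p - 1)) (Set.Ioi 1) :=
        integrableOn_Ioi_rpow_of_lt (by linarith) zero_lt_one
      refine h.congr_fun (fun y hy => ?_) measurableSet_Ioi
      simp only [smul_eq_mul]
      have hy1 : 1 < y := hy
      have hy0 : 0 < y := by linarith
      rw [min_eq_right hy1.le]
      norm_num
      nth_rw 2 [← Real.rpow_one y]
      rw [← Real.rpow_add hy0]
      congr 1; ring
  unfold kap lam0
  rw [lintegral_withDensity_eq_lintegral_mul _ (meas_dens p) (measF q)]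
  have hfin := hint.lintegral_lt_top
  refine lt_of_le_of_lt (lintegral_mono (g := fun ζ : ℂ => ENNReal.ofReal (2 ^ q) *
    ENNReal.ofReal (min ‖ζ‖ 1 ^ q * ‖ζ‖ ^ (-(2 + p)))) ?_) ?_
  · intro ζ
    simp only [Pi.mul_apply]
    have h1 : ‖eE ζ.re - 1‖ₑ ^ q ≤ ENNReal.ofReal (2 ^ q) * ENNReal.ofReal (min ‖ζ‖ 1 ^ q) := by
      rw [← ofReal_norm_eq_enorm, ENNReal.ofReal_rpow_of_nonneg (norm_nonneg _) hq.le,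
        ← ENNReal.ofReal_mul (by positivity), ← Real.mul_rpow (by positivity) (by positivity)]
      refine ENNReal.ofReal_le_ofReal (Real.rpow_le_rpow (norm_nonneg _) ?_ hq.le)
      rcases le_total ‖ζ‖ 1 with h | h
      · rw [min_eq_left h]
        have := norm_eE_sub_one_le ζ.re
        have := Complex.abs_re_le_norm ζ
        linarith [norm_nonneg ζ]
      · rw [min_eq_right h]
        have := norm_sub_le (eE ζ.re) 1
        rw [norm_eE, norm_one] at this
        linarith
    rw [ENNReal.ofReal_mul (by positivity), mul_comm, ← mul_assoc]
    gcongr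
  · rw [lintegral_const_mul' _ _ ENNReal.ofReal_ne_top]
    exact ENNReal.mul_lt_top ENNReal.ofReal_lt_top hfin

lemma ae_lam0_iff {p : ℝ} {P : ℂ → Prop} (h : ∀ᵐ ζ ∂(lam0 p), P ζ) : ∀ᵐ ζ : ℂ, P ζ := by
  unfold lam0 at h
  rw [ae_withDensity_iff (meas_dens p)] at h
  have h0 : ∀ᵐ ζ : ℂ, ζ ≠ 0 := by
    rw [ae_iff]; simp
  filter_upwards [h, h0] with ζ h1 h2
  apply h1
  have : 0 < ‖ζ‖ := norm_pos_iff.2 h2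
  have : 0 < ‖ζ‖ ^ (-(2 + p)) := by positivity
  simpa using this

lemma kap_ne_zero {p q : ℝ} (hq : 0 < q) : kap p q ≠ 0 := by
  unfold kap
  rw [Ne, lintegral_eq_zero_iff (measF q)]
  intro h
  have h2 := ae_lam0_iff h
  rw [ae_iff] at h2
  have hopen : IsOpen {ζ : ℂ | 0 < ζ.re ∧ ζ.re < 1} :=
    (isOpen_lt continuous_const Complex.continuous_re).inter (isOpen_lt Complex.continuous_re continuous_const)
  have hne : ({ζ : ℂ | 0 < ζ.re ∧ ζ.re < 1}).Nonempty := ⟨((1/2 : ℝ) : ℂ), by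
    simp only [Set.mem_setOf_eq, Complex.ofReal_re]; norm_num⟩
  refine (hopen.measure_pos volume hne).ne' (measure_mono_null ?_ h2)
  intro ζ hζ
  show ¬ (‖eE ζ.re - 1‖ₑ ^ q = 0)
  rw [ENNReal.rpow_eq_zero_iff_of_pos hq, enorm_eq_zero]
  intro h3
  have him : Real.sin ζ.re = 0 := by
    have := congrArg Complex.im h3
    simpa only [eE, Complex.sub_im, Complex.exp_ofReal_mul_I_im, Complex.one_im, sub_zero, Complex.zero_im] using this
  exact (Real.sin_pos_of_pos_of_lt_pi hζ.1 (by linarith [hζ.2, Real.pi_gt_three])).ne' him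

/-- Levy measure -/
noncomputable def lam (p q : ℝ) : Measure ℂ := (kap p q)⁻¹ • lam0 p

lemma lam_sf {p q : ℝ} (hp : 0 < p) (hpq : p < q) : SigmaFinite (lam p q) := by
  unfold lam
  have h : (kap p q)⁻¹ ≠ ⊤ := ENNReal.inv_ne_top.2 (kap_ne_zero (hp.trans hpq))
  lift (kap p q)⁻¹ to NNReal using h with c
  exact inferInstanceAs (SigmaFinite (c • lam0 p))

lemma lam_scale (p q : ℝ) (a : ℂ) (ha : a ≠ 0) (G : ℂ → ℝ≥0∞) (hG : Measurable G) :
    ∫⁻ ζ, G (a * ζ) ∂(lam p q) = ‖a‖ₑ ^ p * ∫⁻ ζ, G ζ ∂(lam p q) := by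
  unfold lam
  rw [lintegral_smul_measure, lintegral_smul_measure, lam0_scale p a ha G hG, smul_eq_mul, smul_eq_mul]
  ring

lemma lam_conj (p q : ℝ) (G : ℂ → ℝ≥0∞) (hG : Measurable G) :
    ∫⁻ ζ, G (starRingEnd ℂ ζ) ∂(lam p q) = ∫⁻ ζ, G ζ ∂(lam p q) := by
  unfold lam
  rw [lintegral_smul_measure, lintegral_smul_measure, lam0_conj p G hG]

lemma lam_ae {p q : ℝ} (hp : 0 < p) (hpq : p < q) {P : ℂ → Prop} (h : ∀ᵐ ζ : ℂ, P ζ) :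
    ∀ᵐ ζ ∂(lam p q), P ζ := by
  have h1 : lam p q ≪ volume := by
    unfold lam lam0
    exact (Measure.smul_absolutelyContinuous).trans (withDensity_absolutelyContinuous _ _)
  exact h1.ae_le h

/-- pairing -/
noncomputable def pr (ζ z : ℂ) : ℝ := (starRingEnd ℂ ζ * z).re

lemma continuous_pr : Continuous fun a : ℂ × ℂ => pr a.1 a.2 := by
  unfold pr; fun_prop

/-- theta function -/
noncomputable def Th (p q : ℝ) {V : Type*} (w : V →₀ ℂ) (z : V → ℂ) : ℝ≥0∞ :=
  ∫⁻ ζ, ‖w.sum fun f c => c * (eE (pr ζ (z f)) - 1)‖ₑ ^ q ∂(lam p q)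

lemma Th_meas {V : Type*} (q : ℝ) (w : V →₀ ℂ) (z : V → ℂ) :
    Measurable fun ζ => ‖w.sum fun f c => c * (eE (pr ζ (z f)) - 1)‖ₑ ^ q := by
  have : Continuous fun ζ => w.sum fun f c => c * (eE (pr ζ (z f)) - 1) := by
    unfold Finsupp.sum
    refine continuous_finset_sum _ fun f _ => ?_
    have := continuous_eE
    unfold pr
    fun_prop
  exact this.measurable.enorm.pow_const q

lemma Th_zero {p q : ℝ} (hq : 0 < q) {V : Type*} (w : V →₀ ℂ) : Th p q w (fun _ => 0) = 0 := by
  unfold Th pr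
  simp [eE_zero, hq]

lemma Th_mul {p q : ℝ} (hp : 0 < p) (hq : 0 < q) {V : Type*} (w : V →₀ ℂ) (z : V → ℂ) (a : ℂ) :
    Th p q w (fun f => a * z f) = ‖a‖ₑ ^ p * Th p q w z := by
  by_cases ha : a = 0
  · subst ha
    simp [Th_zero hq, hp]
  · have h := lam_scale p q (starRingEnd ℂ a) (by simpa using ha) _ (Th_meas q w z)
    have e : ‖starRingEnd ℂ a‖ₑ = ‖a‖ₑ := by
      rw [← ofReal_norm_eq_enorm, RCLike.norm_conj, ofReal_norm_eq_enorm]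
    rw [e] at h
    unfold Th
    rw [← h]
    refine lintegral_congr fun ζ => ?_
    have : ∀ f, pr ζ (a * z f) = pr (starRingEnd ℂ a * ζ) (z f) := by
      intro f
      unfold pr
      simp only [map_mul, Complex.conj_conj]
      congr 1; ring
    simp_rw [this]

lemma Th_conj {p q : ℝ} {V : Type*} (w : V →₀ ℂ) (z : V → ℂ) :
    Th p q w (fun f => starRingEnd ℂ (z f)) = Th p q w z := by
  have h := lam_conj p q _ (Th_meas q w z)
  unfold Th
  rw [← h]
  refine lintegral_congr fun ζ => ?_
  have : ∀ f, pr ζ (starRingEnd ℂ (z f)) = pr (starRingEnd ℂ ζ) (z f) := by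
    intro f
    unfold pr
    rw [← map_mul, Complex.conj_re, Complex.conj_conj]
  simp_rw [this]

lemma Th_one {p q : ℝ} (hp : 0 < p) (hpq : p < q) (a : ℂ) :
    ∫⁻ ζ, ‖eE (pr ζ a) - 1‖ₑ ^ q ∂(lam p q) = ‖a‖ₑ ^ p := by
  have h := Th_mul (p := p) hp (hp.trans hpq) (Finsupp.single () 1) (fun _ => 1) a
  have h1 : Th p q (Finsupp.single () 1) (fun _ => 1) = 1 := by
    unfold Th pr
    simp only [mul_one, Complex.conj_re, zero_mul, Finsupp.sum_single_index, one_mul]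
    unfold lam
    rw [lintegral_smul_measure]
    exact ENNReal.inv_mul_cancel (kap_ne_zero (hp.trans hpq)) (kap_lt_top hp hpq).ne
  rw [h1] at h
  simp only [mul_one] at h
  rw [← h]
  unfold Th
  simp

end levy


section clarkson

lemma rpow_add_lt_of_lt_one {a b r : ℝ} (ha : 0 < a) (hb : 0 < b) (hr : r < 1) :
    (a + b) ^ r < a ^ r + b ^ r := by
  have e : ∀ x : ℝ, 0 < x → x ^ r = x * x ^ (r - 1) := by
    intro x hx
    nth_rw 2 [← Real.rpow_one x]
    rw [← Real.rpow_add hx]; congr 1; ring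
  rw [e _ (add_pos ha hb), e a ha, e b hb, add_mul]
  have h1 := Real.rpow_lt_rpow_of_neg ha (by linarith : a < a + b) (by linarith : r - 1 < 0)
  have h2 := Real.rpow_lt_rpow_of_neg hb (by linarith : b < a + b) (by linarith : r - 1 < 0)
  nlinarith [mul_lt_mul_of_pos_left h1 ha, mul_lt_mul_of_pos_left h2 hb]

lemma rpow_add_lt_of_one_lt {a b r : ℝ} (ha : 0 < a) (hb : 0 < b) (hr : 1 < r) :
    a ^ r + b ^ r < (a + b) ^ r := by
  have e : ∀ x : ℝ, 0 < x → x ^ r = x * x ^ (r - 1) := by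
    intro x hx
    nth_rw 2 [← Real.rpow_one x]
    rw [← Real.rpow_add hx]; congr 1; ring
  rw [e _ (add_pos ha hb), e a ha, e b hb, add_mul]
  have h1 := Real.rpow_lt_rpow ha.le (by linarith : a < a + b) (by linarith : 0 < r - 1)
  have h2 := Real.rpow_lt_rpow hb.le (by linarith : b < a + b) (by linarith : 0 < r - 1)
  nlinarith [mul_lt_mul_of_pos_left h1 ha, mul_lt_mul_of_pos_left h2 hb]

lemma norm_rpow_sq (z : ℂ) (p : ℝ) : ‖z‖ ^ p = (‖z‖ ^ 2) ^ (p / 2) := by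
  rw [← Real.rpow_natCast, ← Real.rpow_mul (norm_nonneg _)]
  congr 1; push_cast; ring

lemma para (z w : ℂ) : ‖z + w‖ ^ 2 + ‖z - w‖ ^ 2 = 2 * (‖z‖ ^ 2 + ‖w‖ ^ 2) := by
  have := parallelogram_law_with_norm ℝ z w
  nlinarith [this]

lemma clarkson_lt {p : ℝ} (hp : 0 < p) (h2 : p < 2) (z w : ℂ) :
    ‖z + w‖ ^ p + ‖z - w‖ ^ p ≤ 2 * ‖z‖ ^ p + 2 * ‖w‖ ^ p ∧
    (‖z + w‖ ^ p + ‖z - w‖ ^ p = 2 * ‖z‖ ^ p + 2 * ‖w‖ ^ p → z = 0 ∨ w = 0) := by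
  by_cases hz : z = 0
  · subst hz
    simp [Real.zero_rpow hp.ne', two_mul]
  by_cases hw : w = 0
  · subst hw
    simp [Real.zero_rpow hp.ne', two_mul]
  have hz' : 0 < ‖z‖ ^ 2 := by positivity
  have hw' : 0 < ‖w‖ ^ 2 := by positivity
  have key : ‖z + w‖ ^ p + ‖z - w‖ ^ p < 2 * ‖z‖ ^ p + 2 * ‖w‖ ^ p := by
    simp_rw [norm_rpow_sq _ p]
    have h3 := rpow_add_lt_of_lt_one hz' hw' (show p / 2 < 1 by linarith)
    have h4 := (Real.concaveOn_rpow (p := p / 2) (by linarith) (by linarith)).2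
      (Set.mem_Ici.2 (show (0:ℝ) ≤ ‖z + w‖ ^ 2 by positivity)) (Set.mem_Ici.2 (show (0:ℝ) ≤ ‖z - w‖ ^ 2 by positivity))
      (show (0:ℝ) ≤ 1/2 by norm_num) (show (0:ℝ) ≤ 1/2 by norm_num) (by norm_num)
    simp only [smul_eq_mul] at h4
    have e : 1/2 * ‖z + w‖ ^ 2 + 1/2 * ‖z - w‖ ^ 2 = ‖z‖ ^ 2 + ‖w‖ ^ 2 := by linarith [para z w]
    rw [e] at h4
    linarith
  exact ⟨key.le, fun h => absurd h key.ne⟩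

lemma clarkson_gt {p : ℝ} (h2 : 2 < p) (z w : ℂ) :
    2 * ‖z‖ ^ p + 2 * ‖w‖ ^ p ≤ ‖z + w‖ ^ p + ‖z - w‖ ^ p ∧
    (‖z + w‖ ^ p + ‖z - w‖ ^ p = 2 * ‖z‖ ^ p + 2 * ‖w‖ ^ p → z = 0 ∨ w = 0) := by
  have hp : 0 < p := by linarith
  by_cases hz : z = 0
  · subst hz
    simp [Real.zero_rpow hp.ne', two_mul]
  by_cases hw : w = 0
  · subst hw
    simp [Real.zero_rpow hp.ne', two_mul]
  have hz' : 0 < ‖z‖ ^ 2 := by positivity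
  have hw' : 0 < ‖w‖ ^ 2 := by positivity
  have key : 2 * ‖z‖ ^ p + 2 * ‖w‖ ^ p < ‖z + w‖ ^ p + ‖z - w‖ ^ p := by
    simp_rw [norm_rpow_sq _ p]
    have h3 := rpow_add_lt_of_one_lt hz' hw' (show 1 < p / 2 by linarith)
    have h4 := (convexOn_rpow (p := p / 2) (by linarith)).2
      (Set.mem_Ici.2 (show (0:ℝ) ≤ ‖z + w‖ ^ 2 by positivity)) (Set.mem_Ici.2 (show (0:ℝ) ≤ ‖z - w‖ ^ 2 by positivity))
      (show (0:ℝ) ≤ 1/2 by norm_num) (show (0:ℝ) ≤ 1/2 by norm_num) (by norm_num)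
    simp only [smul_eq_mul] at h4
    have e : 1/2 * ‖z + w‖ ^ 2 + 1/2 * ‖z - w‖ ^ 2 = ‖z‖ ^ 2 + ‖w‖ ^ 2 := by linarith [para z w]
    rw [e] at h4
    linarith
  exact ⟨key.le, fun h => absurd h key.ne'⟩

variable {X : Type*} [MeasurableSpace X] {μ : Measure X} {p : ℝ} [hp : Fact (0 < p)]

/-- disjointness -/
def Dj (f g : LQ μ p) : Prop := ∀ᵐ x ∂μ, f.fn x = 0 ∨ g.fn x = 0

lemma enorm_rpow_real (z : ℂ) (hp : 0 < p) : ‖z‖ₑ ^ p = ENNReal.ofReal (‖z‖ ^ p) := by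
  rw [← ofReal_norm_eq_enorm, ENNReal.ofReal_rpow_of_nonneg (norm_nonneg _) hp.le]

lemma dj_iff (hp2 : p ≠ 2) (f g : LQ μ p) :
    Dj f g ↔ pw μ p (f + g).fn + pw μ p (f - g).fn = 2 * pw μ p f.fn + 2 * pw μ p g.fn := by
  have hpp := hp.out
  let a : X → ℝ≥0∞ := fun x => ‖f.fn x + g.fn x‖ₑ ^ p + ‖f.fn x - g.fn x‖ₑ ^ p
  let b : X → ℝ≥0∞ := fun x => 2 * ‖f.fn x‖ₑ ^ p + 2 * ‖g.fn x‖ₑ ^ p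
  have mf := f.sm.measurable
  have mg := g.sm.measurable
  have ha : pw μ p (f + g).fn + pw μ p (f - g).fn = ∫⁻ x, a x ∂μ := by
    rw [pw_congr (LQ.fn_add f g), pw_congr (LQ.fn_sub f g)]
    unfold pw
    rw [lintegral_add_left]
    exact (mf.add mg).enorm.pow_const p
  have hb : 2 * pw μ p f.fn + 2 * pw μ p g.fn = ∫⁻ x, b x ∂μ := by
    unfold pw
    rw [lintegral_add_left ((mf.enorm.pow_const p).const_mul 2), lintegral_const_mul _ (mf.enorm.pow_const p),
      lintegral_const_mul _ (mg.enorm.pow_const p)]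
  have ea : ∀ x, a x = ENNReal.ofReal (‖f.fn x + g.fn x‖ ^ p + ‖f.fn x - g.fn x‖ ^ p) := by
    intro x
    rw [ENNReal.ofReal_add (by positivity) (by positivity), ← enorm_rpow_real _ hpp, ← enorm_rpow_real _ hpp]
  have eb : ∀ x, b x = ENNReal.ofReal (2 * ‖f.fn x‖ ^ p + 2 * ‖g.fn x‖ ^ p) := by
    intro x
    rw [ENNReal.ofReal_add (by positivity) (by positivity), ENNReal.ofReal_mul (by norm_num), ENNReal.ofReal_mul (by norm_num),
       ← enorm_rpow_real _ hpp, ← enorm_rpow_real _ hpp]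
    simp [b]
  have hma : Measurable a := ((mf.add mg).enorm.pow_const p).add ((mf.sub mg).enorm.pow_const p)
  have hmb : Measurable b := ((mf.enorm.pow_const p).const_mul 2).add ((mg.enorm.pow_const p).const_mul 2)
  have hfa : ∫⁻ x, a x ∂μ ≠ ⊤ := by
    rw [← ha]; exact ENNReal.add_ne_top.2 ⟨(LQ.pw_lt_top _).ne, (LQ.pw_lt_top _).ne⟩
  have hfb : ∫⁻ x, b x ∂μ ≠ ⊤ := by
    rw [← hb]; exact ENNReal.add_ne_top.2 ⟨ENNReal.mul_ne_top (by simp) (LQ.pw_lt_top _).ne,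
      ENNReal.mul_ne_top (by simp) (LQ.pw_lt_top _).ne⟩
  rw [ha, hb]
  have fin : a =ᵐ[μ] b → ∀ᵐ x ∂μ, f.fn x = 0 ∨ g.fn x = 0 := by
    intro h
    filter_upwards [h] with x hx
    rw [ea, eb, ENNReal.ofReal_eq_ofReal_iff (by positivity) (by positivity)] at hx
    rcases lt_or_gt_of_ne hp2 with h2 | h2
    · exact (clarkson_lt hpp h2 _ _).2 hx
    · exact (clarkson_gt h2 _ _).2 hx
  constructor
  · intro h
    refine lintegral_congr_ae ?_
    filter_upwards [h] with x hx
    rcases hx with hx | hx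
    · simp [a, b, hx, hpp, two_mul]
    · simp [a, b, hx, hpp, two_mul]
  · intro h
    apply fin
    rcases lt_or_gt_of_ne hp2 with h2 | h2
    · refine ae_eq_of_ae_le_of_lintegral_le (.of_forall fun x => ?_) hfa hmb.aemeasurable h.ge
      rw [ea, eb]
      exact ENNReal.ofReal_le_ofReal (clarkson_lt hpp h2 _ _).1
    · refine (ae_eq_of_ae_le_of_lintegral_le (.of_forall fun x => ?_) hfb hma.aemeasurable h.le).symm
      rw [ea, eb]
      exact ENNReal.ofReal_le_ofReal (clarkson_gt h2 _ _).1

lemma Dj.symm {f g : LQ μ p} (h : Dj f g) : Dj g f := by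
  filter_upwards [h] with x hx
  exact hx.symm

end clarkson

section lamperti

variable {X : Type*} [MeasurableSpace X] {μ : Measure X} {p : ℝ} [hp : Fact (0 < p)]

lemma dj_map (hp2 : p ≠ 2) (U : LQ μ p →ₗ[ℝ] LQ μ p) (hU : ∀ f, pw μ p (U f).fn = pw μ p f.fn) (f g : LQ μ p) :
    Dj (U f) (U g) ↔ Dj f g := by
  rw [dj_iff hp2, dj_iff hp2, ← map_add, ← map_sub, hU, hU, hU, hU]

lemma U_inj (U : LQ μ p →ₗ[ℝ] LQ μ p) (hU : ∀ f, pw μ p (U f).fn = pw μ p f.fn) : Function.Injective U := by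
  rw [← LinearMap.ker_eq_bot, LinearMap.ker_eq_bot']
  intro f hf
  have h : ‖U f‖ = ‖f‖ := LQ.norm_eq_iff.2 (hU f)
  rw [hf, norm_zero] at h
  exact norm_eq_zero.1 h.symm

lemma memLp_ind {A : Set X} (hA : MeasurableSet A) (hμ : μ A < ⊤) (z : ℂ) :
    MemLp (A.indicator fun _ => z) (ENNReal.ofReal p) μ :=
  memLp_indicator_const _ hA z (Or.inr hμ.ne)

/-- indicator -/
noncomputable def ind (p : ℝ) {A : Set X} (hA : MeasurableSet A) (hμ : μ A < ⊤) (z : ℂ) : LQ μ p :=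
  LQ.mk _ (memLp_indicator_const _ hA z (Or.inr hμ.ne))

lemma fn_ind {A : Set X} (hA : MeasurableSet A) (hμ : μ A < ⊤) (z : ℂ) :
    (ind p hA hμ z).fn =ᵐ[μ] A.indicator fun _ => z := LQ.fn_mk _

lemma cut_exists (f : LQ μ p) {C : Set X} (hC : MeasurableSet C) :
    ∃ g : LQ μ p, g.fn =ᵐ[μ] C.indicator f.fn := ⟨LQ.mk _ ((Lp.memLp (show Lp ℂ (ENNReal.ofReal p) μ from f)).indicator hC), LQ.fn_mk _⟩

lemma lamp_norm [SigmaFinite μ] (hp2 : p ≠ 2) (U : LQ μ p →ₗ[ℝ] LQ μ p) (hU : ∀ f, pw μ p (U f).fn = pw μ p f.fn)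
    (hs : Function.Surjective U) {A : Set X} (hA : MeasurableSet A) (hμ : μ A < ⊤) (z : ℂ) :
    ∀ᵐ x ∂μ, ‖(U (ind p hA hμ z)).fn x‖ = ‖z‖ * ‖(U (ind p hA hμ 1)).fn x‖ := by
  have hpp := hp.out
  by_cases hz0 : z = 0
  · have : ind p hA hμ z = 0 := by
      apply LQ.ext
      filter_upwards [fn_ind (p := p) hA hμ z, LQ.fn_zero (ν := μ) (q := p)] with x h1 h2
      rw [h1, h2, hz0]; simp
    rw [this, map_zero, hz0]
    filter_upwards [LQ.fn_zero (ν := μ) (q := p)] with x h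
    rw [h]; simp
  set F := U (ind p hA hμ 1) with hF
  set Fz := U (ind p hA hμ z) with hFz
  have key : (fun x => ‖Fz.fn x‖ₑ ^ p) =ᵐ[μ] fun x => ‖z‖ₑ ^ p * ‖F.fn x‖ₑ ^ p := by
    refine ae_eq_of_forall_setLIntegral_eq_of_sigmaFinite₀ (Fz.sm.measurable.enorm.pow_const p).aemeasurable
      ((F.sm.measurable.enorm.pow_const p).const_mul _).aemeasurable ?_
    intro C hC _
    -- preimages
    have hdec : ∀ y : ℂ, ∃ g g' : LQ μ p, (U g).fn =ᵐ[μ] C.indicator (U (ind p hA hμ y)).fn ∧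
        (U g').fn =ᵐ[μ] Cᶜ.indicator (U (ind p hA hμ y)).fn ∧ g + g' = ind p hA hμ y := by
      intro y
      obtain ⟨u, hu⟩ := cut_exists (U (ind p hA hμ y)) hC
      obtain ⟨u', hu'⟩ := cut_exists (U (ind p hA hμ y)) hC.compl
      obtain ⟨g, rfl⟩ := hs u
      obtain ⟨g', rfl⟩ := hs u'
      refine ⟨g, g', hu, hu', U_inj U hU ?_⟩
      rw [map_add]
      apply LQ.ext
      filter_upwards [LQ.fn_add (U g) (U g'), hu, hu'] with x h1 h2 h3
      rw [h1, h2, h3]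
      by_cases hx : x ∈ C <;> simp [hx]
    obtain ⟨g, g', hg, hg', hgg⟩ := hdec 1
    obtain ⟨k, k', hk, hk', hkk⟩ := hdec z
    have hd : ∀ {u u' a b : LQ μ p}, (U u).fn =ᵐ[μ] C.indicator a.fn → (U u').fn =ᵐ[μ] Cᶜ.indicator b.fn →
        Dj u u' := by
      intro u u' a b h1 h2
      rw [← dj_map hp2 U hU]
      filter_upwards [h1, h2] with x h1 h2
      rw [h1, h2]
      by_cases hx : x ∈ C <;> simp [hx]
    have d1 := hd hg hg'
    have d2 := hd hk hk'
    have d3 := hd hk hg'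
    have d4 := hd hg hk'
    have e : k.fn =ᵐ[μ] fun x => z * g.fn x := by
      have a1 := LQ.fn_add g g'
      have a2 := LQ.fn_add k k'
      rw [hgg] at a1
      rw [hkk] at a2
      filter_upwards [d1, d2, d3, d4, a1, a2, fn_ind (p := p) hA hμ 1, fn_ind (p := p) hA hμ z] with x d1 d2 d3 d4 a1 a2 i1 i2
      rw [i1] at a1
      rw [i2] at a2
      by_cases hx : x ∈ A
      · simp only [hx, Set.indicator_of_mem] at a1 a2
        rcases eq_or_ne (k.fn x) 0 with h | h
        · rw [h, zero_add] at a2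
          have : k'.fn x ≠ 0 := by rw [← a2]; exact hz0
          have := d4.resolve_right this
          rw [h, this, mul_zero]
        · have h1 := d3.resolve_left h
          rw [h1, add_zero] at a1
          have h2 : g.fn x ≠ 0 := by rw [← a1]; exact one_ne_zero
          have h3 := d4.resolve_left h2
          rw [h3, add_zero] at a2
          rw [← a1, ← a2, mul_one]
      · simp only [hx, not_false_eq_true, Set.indicator_of_notMem] at a1 a2
        have h1 : k.fn x = 0 := by
          rcases d2 with h | h
          · exact h
          · rw [h, add_zero] at a2; exact a2.symm
        have h2 : g.fn x = 0 := by
          rcases d1 with h | h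
          · exact h
          · rw [h, add_zero] at a1; exact a1.symm
        rw [h1, h2, mul_zero]
    have cut : ∀ {u a : LQ μ p}, (U u).fn =ᵐ[μ] C.indicator a.fn → ∫⁻ x in C, ‖a.fn x‖ₑ ^ p ∂μ = pw μ p u.fn := by
      intro u a h
      rw [← hU, pw_congr h, pw, ← lintegral_indicator hC]
      refine lintegral_congr fun x => ?_
      by_cases hx : x ∈ C <;> simp [hx, hpp]
    rw [cut hk, pw_congr e, pw_smul hpp, lintegral_const_mul _ (F.sm.measurable.enorm.pow_const p), cut hg]
  filter_upwards [key] with x hx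
  rw [← ENNReal.mul_rpow_of_nonneg _ _ hpp.le, ← enorm_mul] at hx
  have := (ENNReal.rpow_left_injective hpp.ne') hx
  rw [← norm_mul]
  have h2 := congrArg ENNReal.toReal this
  simpa using h2

lemma ind_add {A : Set X} (hA : MeasurableSet A) (hμ : μ A < ⊤) (z w : ℂ) :
    ind p hA hμ (z + w) = ind p hA hμ z + ind p hA hμ w := by
  apply LQ.ext
  filter_upwards [LQ.fn_add (ind p hA hμ z) (ind p hA hμ w), fn_ind (p := p) hA hμ z, fn_ind (p := p) hA hμ w,
    fn_ind (p := p) hA hμ (z + w)] with x h1 h2 h3 h4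
  rw [h1, h2, h3, h4]
  by_cases hx : x ∈ A <;> simp [hx]

lemma ind_smul {A : Set X} (hA : MeasurableSet A) (hμ : μ A < ⊤) (t : ℝ) (w : ℂ) :
    ind p hA hμ (t * w) = t • ind p hA hμ w := by
  apply LQ.ext
  filter_upwards [LQ.fn_rsmul t (ind p hA hμ w), fn_ind (p := p) hA hμ w,
    fn_ind (p := p) hA hμ (t * w)] with x h1 h2 h3
  rw [h1, h2, h3]
  by_cases hx : x ∈ A <;> simp [hx]

lemma two_cases {a b : ℂ} (h1 : ‖b‖ = ‖a‖) (h2 : ‖a + b‖ ^ 2 = 2 * ‖a‖ ^ 2) :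
    b = Complex.I * a ∨ b = - (Complex.I * a) := by
  by_cases ha : a = 0
  · subst ha
    left
    simpa using h1
  · obtain ⟨c, rfl⟩ : ∃ c, b = c * a := ⟨b / a, by field_simp⟩
    have hn : 0 < ‖a‖ := norm_pos_iff.2 ha
    have h3 : ‖c‖ = 1 := by
      rw [norm_mul] at h1
      exact mul_right_cancel₀ hn.ne' (by linarith)
    have h4 : ‖1 + c‖ ^ 2 = 2 := by
      have : a + c * a = (1 + c) * a := by ring
      rw [this, norm_mul, mul_pow] at h2
      exact mul_right_cancel₀ (pow_ne_zero 2 hn.ne') h2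
    rw [← Complex.normSq_eq_norm_sq, Complex.normSq_apply] at h4
    have h5 : ‖c‖ ^ 2 = 1 := by rw [h3]; norm_num
    rw [← Complex.normSq_eq_norm_sq, Complex.normSq_apply] at h5
    simp only [Complex.add_re, Complex.one_re, Complex.add_im, Complex.one_im, zero_add] at h4
    have hr : c.re = 0 := by nlinarith
    have hi : c.im * c.im = 1 := by rw [hr] at h5; linarith
    rcases mul_self_eq_one_iff.1 hi with h | h
    · left; congr 1; apply Complex.ext <;> simp [hr, h]
    · right
      have : c = - Complex.I := by apply Complex.ext <;> simp [hr, h]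
      rw [this]; ring

lemma lamp_form [SigmaFinite μ] (hp2 : p ≠ 2) (U : LQ μ p →ₗ[ℝ] LQ μ p) (hU : ∀ f, pw μ p (U f).fn = pw μ p f.fn)
    (hs : Function.Surjective U) {A : Set X} (hA : MeasurableSet A) (hμ : μ A < ⊤) {ι : Type*} [Countable ι] (z : ι → ℂ) :
    ∀ᵐ x ∂μ, (∀ j, (U (ind p hA hμ (z j))).fn x = (U (ind p hA hμ 1)).fn x * z j) ∨
      (∀ j, (U (ind p hA hμ (z j))).fn x = (U (ind p hA hμ 1)).fn x * starRingEnd ℂ (z j)) := by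
  have hz : ∀ z : ℂ, U (ind p hA hμ z) = z.re • U (ind p hA hμ 1) + z.im • U (ind p hA hμ Complex.I) := by
    intro z
    rw [← map_smul, ← map_smul, ← map_add, ← ind_smul, ← ind_smul, ← ind_add]
    congr 2
    rw [mul_one, Complex.re_add_im]
  have hz' : ∀ z : ℂ, (U (ind p hA hμ z)).fn =ᵐ[μ] fun x =>
      (z.re : ℂ) * (U (ind p hA hμ 1)).fn x + (z.im : ℂ) * (U (ind p hA hμ Complex.I)).fn x := by
    intro z
    rw [hz]
    filter_upwards [LQ.fn_add (z.re • U (ind p hA hμ 1)) (z.im • U (ind p hA hμ Complex.I)),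
      LQ.fn_rsmul z.re (U (ind p hA hμ 1)), LQ.fn_rsmul z.im (U (ind p hA hμ Complex.I))] with x h1 h2 h3
    rw [h1, h2, h3]
  have ha := ae_all_iff.2 fun j => hz' (z j)
  filter_upwards [ha, hz' (1 + Complex.I), lamp_norm hp2 U hU hs hA hμ (1 + Complex.I),
    lamp_norm hp2 U hU hs hA hμ Complex.I] with x ha h1 h2 h3
  simp only [Complex.add_re, Complex.one_re, Complex.I_re, add_zero, Complex.ofReal_one, one_mul,
    Complex.add_im, Complex.one_im, Complex.I_im, zero_add] at h1
  rw [h1] at h2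
  rw [Complex.norm_I, one_mul] at h3
  have h4 : ‖(1 : ℂ) + Complex.I‖ ^ 2 = 2 := by
    rw [← Complex.normSq_eq_norm_sq, Complex.normSq_apply]; norm_num
  rcases two_cases h3 (by rw [h2, mul_pow, h4]) with h | h
  · left
    intro j
    rw [ha, h]
    conv_rhs => rw [← Complex.re_add_im (z j)]
    ring
  · right
    intro j
    rw [ha, h]
    conv_rhs => rw [← Complex.re_add_im (z j)]
    simp only [map_add, map_mul, Complex.conj_ofReal, Complex.conj_I]
    ring

end lamperti


section caseD

variable {X : Type*} [MeasurableSpace X] {μ : Measure X} {p q : ℝ} [hp : Fact (0 < p)] [hq : Fact (0 < q)]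
  {ι : Type*} [Fintype ι]

lemma joint_meas {V : Type*} (w : V →₀ ℂ) {Y : Type*} [MeasurableSpace Y] (g : V → Y → ℂ)
    (hg : ∀ j, Measurable (g j)) :
    Measurable fun z : Y × ℂ => w.sum fun f c => c * (eE (pr z.2 (g f z.1)) - 1) := by
  unfold Finsupp.sum
  refine Finset.measurable_fun_sum _ fun f _ => ?_
  refine Measurable.const_mul ?_ _
  refine Measurable.sub_const ?_ _
  refine measurable_eE.comp ?_
  exact continuous_pr.measurable.comp (measurable_snd.prodMk ((hg f).comp measurable_fst))

lemma Th_measurable (hpq : p < q) {V : Type*} (w : V →₀ ℂ) {Y : Type*} [MeasurableSpace Y] (g : V → Y → ℂ)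
    (hg : ∀ j, Measurable (g j)) : Measurable fun y => Th p q w (fun j => g j y) := by
  haveI := lam_sf hp.out hpq
  unfold Th
  exact ((joint_meas w g hg).enorm.pow_const q).lintegral_prod_right'

lemma Th_dj {V : Type*} (w : V →₀ ℂ) (a b : V → ℂ) (h : ∀ j k, a j = 0 ∨ b k = 0) :
    Th p q w (fun j => a j + b j) = Th p q w a + Th p q w b := by
  have hqq := hq.out
  by_cases ha : ∀ j, a j = 0
  · have : a = fun _ => 0 := funext ha
    subst this
    simp [Th_zero hqq]
  · push Not at ha
    obtain ⟨j, hj⟩ := ha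
    have : b = fun _ => 0 := funext fun k => (h j k).resolve_left hj
    subst this
    simp [Th_zero hqq]

/-- the functional -/
noncomputable def JJ (q : ℝ) (w : ι →₀ ℂ) (h : ι → LQ μ p) : ℝ≥0∞ := ∫⁻ x, Th p q w (fun j => (h j).fn x) ∂μ

lemma JJ_add (hpq : p < q) (w : ι →₀ ℂ) (f g : ι → LQ μ p) (h : ∀ j k, Dj (f j) (g k)) :
    JJ q w (fun j => f j + g j) = JJ q w f + JJ q w g := by
  unfold JJ
  rw [← lintegral_add_left (Th_measurable hpq w (fun j => (f j).fn) fun j => (f j).sm.measurable)]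
  refine lintegral_congr_ae ?_
  have h1 := ae_all_iff.2 fun j => LQ.fn_add (f j) (g j)
  have h2 := ae_all_iff.2 fun j => ae_all_iff.2 fun k => h j k
  filter_upwards [h1, h2] with x h1 h2
  rw [← Th_dj w _ _ h2]
  congr 1
  funext j
  exact h1 j

lemma JJ_simple [SigmaFinite μ] (hp2 : p ≠ 2) (hpq : p < q) (U : LQ μ p →ₗ[ℝ] LQ μ p)
    (hU : ∀ f, pw μ p (U f).fn = pw μ p f.fn)
    (hs : Function.Surjective U) (w : ι →₀ ℂ) (s : SimpleFunc X (ι → ℂ)) :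
    ∀ h : ι → LQ μ p, (∀ j, (h j).fn =ᵐ[μ] fun x => s x j) → JJ q w (fun j => U (h j)) = JJ q w h := by
  have hpp := hp.out
  have hqq := hq.out
  induction s using SimpleFunc.induction with
  | const c hA =>
    rename_i A
    intro h hh
    by_cases hc : c = 0
    · have : h = fun _ => 0 := by
        funext j
        apply LQ.ext
        filter_upwards [hh j, LQ.fn_zero (ν := μ) (q := p)] with x h1 h2
        rw [h1, h2, hc]; simp [SimpleFunc.coe_piecewise, Set.piecewise]
      subst this
      simp
    · obtain ⟨j0, hj0⟩ : ∃ j, c j ≠ 0 := by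
        by_contra hcon
        push Not at hcon
        exact hc (funext hcon)
      have hμ : μ A < ⊤ := by
        have h1 := LQ.pw_lt_top (h j0)
        rw [pw_congr (hh j0)] at h1
        have e : pw μ p (fun x => (SimpleFunc.piecewise A hA (SimpleFunc.const X c) (SimpleFunc.const X 0)) x j0) =
            ‖c j0‖ₑ ^ p * μ A := by
          unfold pw
          rw [← lintegral_indicator_const hA]
          refine lintegral_congr fun x => ?_
          by_cases hx : x ∈ A <;> simp [SimpleFunc.coe_piecewise, hx, hpp]
        rw [e] at h1
        have h0 : ‖c j0‖ₑ ^ p ≠ 0 := by simp [hj0, hpp.le]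
        by_contra hcon
        rw [not_lt, top_le_iff] at hcon
        rw [hcon, ENNReal.mul_top h0] at h1
        exact lt_irrefl _ h1
      have eh : h = fun j => ind p hA hμ (c j) := by
        funext j
        apply LQ.ext
        filter_upwards [hh j, fn_ind (p := p) hA hμ (c j)] with x h1 h2
        rw [h1, h2]
        by_cases hx : x ∈ A <;> simp [SimpleFunc.coe_piecewise, hx]
      subst eh
      have e1 : JJ q w (fun j => U (ind p hA hμ (c j))) = pw μ p (U (ind p hA hμ 1)).fn * Th p q w c := by
        unfold JJ pw
        rw [← lintegral_mul_const _ ((U (ind p hA hμ 1)).sm.measurable.enorm.pow_const p)]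
        refine lintegral_congr_ae ?_
        filter_upwards [lamp_form hp2 U hU hs hA hμ c] with x hx
        rcases hx with hx | hx
        · simp_rw [hx]
          rw [Th_mul hpp hqq]
        · simp_rw [hx]
          rw [Th_mul hpp hqq, Th_conj]
      have e2 : JJ q w (fun j => ind p hA hμ (c j)) = pw μ p (ind p hA hμ 1).fn * Th p q w c := by
        unfold JJ pw
        rw [← lintegral_mul_const _ ((ind p hA hμ 1).sm.measurable.enorm.pow_const p)]
        refine lintegral_congr_ae ?_
        filter_upwards [ae_all_iff.2 fun j => fn_ind (p := p) hA hμ (c j), fn_ind (p := p) hA hμ 1] with x h1 h2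
        simp_rw [h1]
        rw [h2, ← Th_mul hpp hqq]
        congr 1
        funext j
        by_cases hx : x ∈ A <;> simp [hx]
      rw [e1, e2, hU]
  | add hd hf hg =>
    rename_i f g
    intro h hh
    have hfg : ∀ x, f x = 0 ∨ g x = 0 := by
      intro x
      by_contra hcon
      push Not at hcon
      exact Set.disjoint_left.1 hd hcon.1 hcon.2
    have hS : MeasurableSet (Function.support f) := f.measurableSet_support
    have hm : ∀ j, ∃ u : LQ μ p, u.fn =ᵐ[μ] fun x => f x j := by
      intro j
      obtain ⟨u, hu⟩ := cut_exists (h j) hS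
      refine ⟨u, ?_⟩
      filter_upwards [hu, hh j] with x h1 h2
      rw [h1]
      by_cases hx : x ∈ Function.support f
      · rw [Set.indicator_of_mem hx, h2]
        have := (hfg x).resolve_left hx
        simp [this]
      · rw [Set.indicator_of_notMem hx]
        have : f x = 0 := by simpa using hx
        rw [this]; rfl
    choose u hu using hm
    have hv : ∀ j, (h j - u j).fn =ᵐ[μ] fun x => g x j := by
      intro j
      filter_upwards [LQ.fn_sub (h j) (u j), hu j, hh j] with x h1 h2 h3
      rw [h1, h2, h3]; simp
    have hdj : ∀ j k, Dj (u j) (h k - u k) := by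
      intro j k
      filter_upwards [hu j, hv k] with x h1 h2
      rw [h1, h2]
      rcases hfg x with h | h
      · left; rw [h]; rfl
      · right; rw [h]; rfl
    have e : h = fun j => u j + (h j - u j) := by funext j; abel
    rw [e]
    simp only [map_add]
    rw [JJ_add hpq w (fun j => U (u j)) (fun j => U (h j - u j)) (fun j k => (dj_map hp2 U hU _ _).2 (hdj j k)),
      JJ_add hpq w u (fun j => h j - u j) hdj, hf u hu, hg _ hv]

/-- the cocycle variable -/
noncomputable def xiP (f : LQ μ p) (z : X × ℂ) : ℝ := pr z.2 (f.fn z.1)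

lemma xiP_meas (f : LQ μ p) : Measurable (xiP f) :=
  continuous_pr.measurable.comp (measurable_snd.prodMk (f.sm.measurable.comp measurable_fst))

lemma xiP_add (hpq : p < q) (f g : LQ μ p) : xiP (f + g) =ᵐ[μ.prod (lam p q)] fun z => xiP f z + xiP g z := by
  have h := Measure.quasiMeasurePreserving_fst (ν := lam p q) |>.ae (LQ.fn_add f g)
  filter_upwards [h] with z hz
  unfold xiP
  rw [hz]
  unfold pr
  rw [mul_add, Complex.add_re]

lemma xiP_smul (hpq : p < q) (t : ℝ) (f : LQ μ p) : xiP (t • f) =ᵐ[μ.prod (lam p q)] fun z => t * xiP f z := by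
  have h := Measure.quasiMeasurePreserving_fst (ν := lam p q) |>.ae (LQ.fn_rsmul t f)
  filter_upwards [h] with z hz
  unfold xiP
  rw [hz]
  unfold pr
  rw [mul_left_comm, Complex.re_ofReal_mul]

lemma xiP_meas' (f : LQ μ p) : Measurable (fun z => eE (xiP f z) - 1) :=
  (measurable_eE.comp (xiP_meas f)).sub_const 1

lemma xiP_h1 (hpq : p < q) (f : LQ μ p) : pw (μ.prod (lam p q)) q (fun z => eE (xiP f z) - 1) = pw μ p f.fn := by
  haveI := lam_sf hp.out hpq
  unfold pw
  rw [lintegral_prod _ ((xiP_meas' f).enorm.pow_const q).aemeasurable]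
  refine lintegral_congr fun x => ?_
  simp only [xiP]
  exact Th_one hp.out hpq (f.fn x)

lemma JJ_pw (hpq : p < q) (w : ι →₀ ℂ) (h : ι → LQ μ p) :
    pw (μ.prod (lam p q)) q (fun z => w.sum fun j c => c * (eE (xiP (h j) z) - 1)) = JJ q w h := by
  haveI := lam_sf hp.out hpq
  unfold pw JJ
  have hm : Measurable (fun z : X × ℂ => w.sum fun j c => c * (eE (xiP (h j) z) - 1)) :=
    joint_meas w (fun j => (h j).fn) fun j => (h j).sm.measurable
  rw [lintegral_prod _ (hm.enorm.pow_const q).aemeasurable]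
  rfl

lemma xiP_mem (hpq : p < q) (f : LQ μ p) :
    MemLp (fun z => eE (xiP f z) - 1) (ENNReal.ofReal q) (μ.prod (lam p q)) := by
  rw [memLp_iff_pw hq.out (xiP_meas' f).aestronglyMeasurable, xiP_h1 hpq]
  exact f.pw_lt_top

/-- the embedding -/
noncomputable def PhiP (hpq : p < q) (f : LQ μ p) : LQ (μ.prod (lam p q)) q := LQ.mk _ (xiP_mem hpq f)

lemma fn_PhiP (hpq : p < q) (f : LQ μ p) :
    (PhiP hpq f).fn =ᵐ[μ.prod (lam p q)] fun z => eE (xiP f z) - 1 := LQ.fn_mk _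

lemma PhiP_iso (hpq : p < q) (f f' : LQ μ p) :
    pw (μ.prod (lam p q)) q (PhiP hpq f - PhiP hpq f').fn = pw μ p (f - f').fn := by
  rw [← xiP_h1 hpq]
  refine pw_congr_norm ?_
  have := xiP_add hpq (f - f') f'
  rw [sub_add_cancel] at this
  filter_upwards [LQ.fn_sub (PhiP hpq f) (PhiP hpq f'), fn_PhiP hpq f, fn_PhiP hpq f', this] with z h1 h2 h3 h4
  rw [h1, h2, h3, h4, eE_add]
  have : eE (xiP (f - f') z) * eE (xiP f' z) - 1 - (eE (xiP f' z) - 1) = eE (xiP f' z) * (eE (xiP (f - f') z) - 1) := by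
    ring
  rw [this, enorm_mul, enorm_eE, one_mul]

lemma JJ_eq (hpq : p < q) (w : ι →₀ ℂ) (h : ι → LQ μ p) :
    JJ q w h = pw (μ.prod (lam p q)) q (Finsupp.linearCombination ℂ (fun j => PhiP hpq (h j)) w).fn := by
  rw [pw_congr (XiData.fn_lc _ w), ← JJ_pw hpq]
  refine pw_congr ?_
  filter_upwards [ae_all_iff.2 fun j => fn_PhiP hpq (h j)] with z hz
  simp_rw [hz]

lemma JJ_tendsto (hpq : p < q) (w : ι →₀ ℂ) (h : ι → LQ μ p) (hn : ℕ → ι → LQ μ p)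
    (ht : ∀ j, Tendsto (fun n => hn n j) atTop (𝓝 (h j))) : Tendsto (fun n => JJ q w (hn n)) atTop (𝓝 (JJ q w h)) := by
  simp_rw [JJ_eq hpq]
  refine (LQ.continuous_pw.tendsto _).comp ?_
  simp_rw [Finsupp.linearCombination_apply, Finsupp.sum]
  exact tendsto_finset_sum _ fun j _ => ((hΦt (PhiP hpq) (PhiP_iso hpq)).1 (ht j)).const_smul _

lemma JJ_inv [SigmaFinite μ] (hp2 : p ≠ 2) (hpq : p < q) (U : LQ μ p →ₗ[ℝ] LQ μ p)
    (hU : ∀ f, pw μ p (U f).fn = pw μ p f.fn)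
    (hs : Function.Surjective U) (w : ι →₀ ℂ) (h : ι → LQ μ p) :
    JJ q w (fun j => U (h j)) = JJ q w h := by
  have hpp := hp.out
  have hmem : MemLp (fun x j => (h j).fn x) (ENNReal.ofReal p) μ := MemLp.of_eval fun j => (h j).memLp
  have hap := fun n : ℕ => hmem.exists_simpleFunc_eLpNorm_sub_lt ENNReal.ofReal_ne_top
    (ε := ((n : ℝ≥0∞))⁻¹) (by simp)
  choose s hs1 hs2 using hap
  let g : ℕ → ι → LQ μ p := fun n j => LQ.mk _ ((memLp_pi_iff.1 (hs2 n)) j)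
  have hg : ∀ n j, (g n j).fn =ᵐ[μ] fun x => s n x j := fun n j => LQ.fn_mk _
  have ht : ∀ j, Tendsto (fun n => g n j) atTop (𝓝 (h j)) := by
    intro j
    rw [LQ.tendsto_iff']
    have e : ∀ n, pw μ p (g n j - h j).fn ≤ ((n : ℝ≥0∞)⁻¹) ^ p := by
      intro n
      have h1 : eLpNorm (g n j - h j).fn (ENNReal.ofReal p) μ ≤ (n : ℝ≥0∞)⁻¹ := by
        refine le_trans ?_ (hs1 n).le
        refine eLpNorm_mono_ae ?_
        filter_upwards [LQ.fn_sub (g n j) (h j), hg n j] with x h1 h2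
        rw [h1, h2, norm_sub_rev]
        exact norm_le_pi_norm ((fun x j => (h j).fn x) x - s n x) j
      rw [eLpNorm_eq_pw hpp] at h1
      have := ENNReal.rpow_le_rpow h1 hpp.le
      rwa [← ENNReal.rpow_mul, one_div, inv_mul_cancel₀ hpp.ne', ENNReal.rpow_one] at this
    refine tendsto_of_tendsto_of_tendsto_of_le_of_le tendsto_const_nhds ?_ (fun _ => zero_le) e
    have := (ENNReal.continuous_rpow_const (y := p)).tendsto 0 |>.comp ENNReal.tendsto_inv_nat_nhds_zero
    rw [ENNReal.zero_rpow_of_pos hpp] at this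
    exact this
  have hUiso : ∀ f f', pw μ p (U f - U f').fn = pw μ p (f - f').fn := by
    intro f f'
    rw [← map_sub, hU]
  have t1 := JJ_tendsto hpq w h g ht
  have t2 := JJ_tendsto hpq w (fun j => U (h j)) (fun n j => U (g n j)) fun j => (hΦt U hUiso).1 (ht j)
  refine tendsto_nhds_unique t2 (t1.congr fun n => ?_)
  exact (JJ_simple hp2 hpq U hU hs w (s n) (g n) (hg n)).symm

lemma re_ne_zero (hpq : p < q) : ∀ᵐ ζ ∂(lam p q), ζ.re ≠ 0 := by
  refine lam_ae hp.out hpq ?_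
  have h := Measure.addHaar_submodule (volume : Measure ℂ) (LinearMap.ker Complex.reLm) (by
    rw [Ne, LinearMap.ker_eq_top]
    intro h
    have := congrArg (fun l => l 1) h
    simp at this)
  rw [ae_iff]
  convert h using 2
  ext ζ
  simp

lemma xiP_ind (hpq : p < q) {A : Set X} (hA : MeasurableSet A) (hμ : μ A < ⊤) (c : ℂ) :
    xiP (ind p hA hμ c) =ᵐ[μ.prod (lam p q)] fun z => pr z.2 (A.indicator (fun _ => c) z.1) := by
  have h := Measure.quasiMeasurePreserving_fst (ν := lam p q) |>.ae (fn_ind (p := p) hA hμ c)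
  filter_upwards [h] with z hz
  unfold xiP
  rw [hz]

/-- the data for `p ≠ 2` -/
noncomputable def dataD [SigmaFinite μ] (hp2 : p ≠ 2) (hpq : p < q) : XiData μ p (μ.prod (lam p q)) q where
  ξ := xiP
  meas := xiP_meas
  add := xiP_add hpq
  smul := xiP_smul hpq
  h1 := xiP_h1 hpq
  h2 := by
    intro T w
    let w' : w.support →₀ ℂ := w.subtypeDomain (· ∈ w.support)
    have e : ∀ k : LQ μ p → LQ μ p, pw (μ.prod (lam p q)) q (fun z => w.sum fun f c => c * (eE (xiP (k f) z) - 1)) =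
        JJ q w' (fun j => k j) := by
      intro k
      rw [← JJ_pw hpq]
      congr 1
      funext z
      exact (Finsupp.sum_subtypeDomain_index (h := fun f c => c * (eE (xiP (k f) z) - 1)) fun x hx => hx).symm
    rw [e fun f => T.lin f, e fun f => f]
    exact JJ_inv hp2 hpq T.lin T.lin_pw T.lin_surj w' _
  h3 := by
    intro m hae hm
    have hfin : ∀ (A : Set X) (B : Set ℂ), MeasurableSet A → MeasurableSet B → μ A < ⊤ → MeasurableSet[m] (A ×ˢ B) := by
      intro A B hA hB hμ
      let G : X × ℂ → ℂ := fun z => (xiP (ind p hA hμ 1) z : ℂ) + (xiP (ind p hA hμ Complex.I) z : ℂ) * Complex.I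
      have hG : Measurable[m] G := by
        have a1 := hm (ind p hA hμ 1)
        have a2 := hm (ind p hA hμ Complex.I)
        have a3 : Measurable fun a : ℝ × ℝ => (a.1 : ℂ) + (a.2 : ℂ) * Complex.I := by fun_prop
        exact a3.comp (a1.prodMk a2)
      refine hae _ (G ⁻¹' (B \ {0})) (hA.prod hB) (hG (hB.diff (measurableSet_singleton 0))) ?_
      have h0 := Measure.quasiMeasurePreserving_snd (μ := μ) |>.ae (re_ne_zero hpq)
      filter_upwards [xiP_ind hpq hA hμ 1, xiP_ind hpq hA hμ Complex.I, h0] with z h1 h2 h3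
      apply propext
      show z ∈ A ×ˢ B ↔ G z ∈ B \ {0}
      have hz0 : z.2 ≠ 0 := by
        intro h; rw [h] at h3; simp at h3
      have : G z = A.indicator (fun _ => z.2) z.1 := by
        simp only [G]
        rw [h1, h2]
        by_cases hz : z.1 ∈ A
        · simp only [hz, Set.indicator_of_mem, pr]
          apply Complex.ext <;> simp
        · simp [hz, pr]
      rw [this]
      by_cases hz : z.1 ∈ A
      · simp [hz, Set.mem_prod, hz0]
      · simp [hz, Set.mem_prod]
    have hle : (Prod.instMeasurableSpace : MeasurableSpace (X × ℂ)) ≤ m := by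
      rw [← generateFrom_prod]
      refine MeasurableSpace.generateFrom_le ?_
      rintro _ ⟨A, hA, B, hB, rfl⟩
      have : A ×ˢ B = ⋃ n, (A ∩ spanningSets μ n) ×ˢ B := by
        rw [← Set.iUnion_prod_const, ← Set.inter_iUnion, iUnion_spanningSets, Set.inter_univ]
      show MeasurableSet[m] (A ×ˢ B)
      rw [this]
      refine MeasurableSet.iUnion fun n => hfin _ _ (hA.inter (measurableSet_spanningSets μ n)) hB ?_
      exact (measure_mono Set.inter_subset_right).trans_lt (measure_spanningSets_lt_top μ n)
    exact fun A hA => hle A hA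
  h4 := by
    refine ⟨fun n => ind p (measurableSet_spanningSets μ n) (measure_spanningSets_lt_top μ n) 1, ?_⟩
    have h0 := Measure.quasiMeasurePreserving_snd (μ := μ) |>.ae (re_ne_zero hpq)
    have h1 := ae_all_iff.2 fun n => xiP_ind hpq (measurableSet_spanningSets μ n) (measure_spanningSets_lt_top μ n) 1
    filter_upwards [h0, h1] with z h0 h1
    have : z.1 ∈ ⋃ n, spanningSets μ n := by rw [iUnion_spanningSets]; trivial
    obtain ⟨n, hn⟩ := Set.mem_iUnion.1 this
    refine ⟨n, ?_⟩
    rw [h1 n]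
    simpa [hn, pr] using h0

end caseD


section caseE

variable {X : Type*} [MeasurableSpace X] {μ : Measure X} {q : ℝ} [hq : Fact (0 < q)]
  {ι : Type} [Countable ι]

/-- gaussian data -/
structure GaussData (μ : Measure X) (ι : Type) [Countable ι] (P : Measure (ι → ℝ)) where
  S : LQ μ 2 → ℕ → (ι → ℝ) →ₗ[ℝ] ℝ
  γ : LQ μ 2 → (ι → ℝ) → ℝ
  measS : ∀ f n, Measurable (S f n)
  measγ : ∀ f, Measurable (γ f)
  lim : ∀ f, ∀ᵐ ω ∂P, Tendsto (fun n => S f n ω) atTop (𝓝 (γ f ω))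
  add : ∀ f g, γ (f + g) =ᵐ[P] fun ω => γ f ω + γ g ω
  smul : ∀ (t : ℝ) f, γ (t • f) =ᵐ[P] fun ω => t * γ f ω
  char : ∀ f, ∫ ω, Complex.exp (γ f ω * Complex.I) ∂P = Complex.exp (-((pw μ 2 f.fn).toReal / 2 : ℝ))
  two : ∀ f, ∫⁻ ω, ‖γ f ω‖ₑ ^ (2 : ℝ) ∂P = pw μ 2 f.fn
  e : ι → LQ μ 2
  lim_e : ∀ i y, Tendsto (fun n => S (e i) n y) atTop (𝓝 (y i))
  i0 : ι
  hi0 : ∀ᵐ ω ∂P, ω i0 ≠ 0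

namespace GaussData

variable {P : Measure (ι → ℝ)} [IsProbabilityMeasure P] (d : GaussData μ ι P)

/-- the scaling map -/
def sc (a : (ι → ℝ) × ℂ) : ι → ℝ := a.2.re • a.1

lemma sc_meas : Measurable (sc (ι := ι)) := by
  rw [measurable_pi_iff]
  intro i
  show Measurable fun a : (ι → ℝ) × ℂ => a.2.re * a.1 i
  fun_prop

/-- the big measure -/
noncomputable def MM (P : Measure (ι → ℝ)) (q : ℝ) : Measure (ι → ℝ) := (P.prod (lam 2 q)).map sc

/-- the variable -/
noncomputable def xi (f : LQ μ 2) (y : ι → ℝ) : ℝ := limUnder atTop (fun n => d.S f n y)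

lemma xi_meas (f : LQ μ 2) : Measurable (d.xi f) := by
  have := StronglyMeasurable.limUnder (l := atTop) (f := fun n => (d.S f n : (ι → ℝ) → ℝ))
    (fun n => (d.measS f n).stronglyMeasurable)
  exact this.measurable

lemma xi_sc (f : LQ μ 2) : ∀ᵐ a ∂(P.prod (lam 2 q)), d.xi f (sc a) = a.2.re * d.γ f a.1 := by
  have h := Measure.quasiMeasurePreserving_fst (ν := lam 2 q) |>.ae (d.lim f)
  filter_upwards [h] with a ha
  unfold xi sc
  simp_rw [map_smul, smul_eq_mul]
  exact (ha.const_mul _).limUnder_eq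

lemma xi_e (i : ι) (y : ι → ℝ) : d.xi (d.e i) y = y i := (d.lim_e i y).limUnder_eq

lemma law_eq {J : Type*} [Fintype J] (f g : J → LQ μ 2)
    (h : ∀ t : J → ℝ, pw μ 2 (∑ j, t j • f j).fn = pw μ 2 (∑ j, t j • g j).fn) :
    P.map (fun ω j => d.γ (f j) ω) = P.map (fun ω j => d.γ (g j) ω) := by
  classical
  have hm : ∀ f : J → LQ μ 2, Measurable fun ω j => d.γ (f j) ω := fun f =>
    measurable_pi_iff.2 fun j => d.measγ _
  have hsum : ∀ (s : Finset J) (t : J → ℝ) (f : J → LQ μ 2),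
      d.γ (∑ j ∈ s, t j • f j) =ᵐ[P] fun ω => ∑ j ∈ s, t j * d.γ (f j) ω := by
    intro s t f
    induction s using Finset.induction_on with
    | empty =>
      have := d.smul 0 0
      simpa using this
    | insert a s ha ih =>
      rw [Finset.sum_insert ha]
      filter_upwards [d.add (t a • f a) (∑ j ∈ s, t j • f j), d.smul (t a) (f a), ih] with ω h1 h2 h3
      rw [h1, h2, h3, Finset.sum_insert ha]
  have hc : ∀ (f : J → LQ μ 2) (L : StrongDual ℝ (J → ℝ)), charFunDual (P.map (fun ω j => d.γ (f j) ω)) L =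
      Complex.exp (-((pw μ 2 (∑ j, L (fun k => if j = k then 1 else 0) • f j).fn).toReal / 2 : ℝ)) := by
    intro f L
    rw [charFunDual_apply, integral_map (hm f).aemeasurable (by fun_prop), ← d.char]
    refine integral_congr_ae ?_
    filter_upwards [hsum Finset.univ (fun j => L (fun k => if j = k then 1 else 0)) f] with ω hω
    rw [hω]
    congr 3
    have := LinearMap.pi_apply_eq_sum_univ (L : (J → ℝ) →ₗ[ℝ] ℝ) (fun j => d.γ (f j) ω)
    rw [ContinuousLinearMap.coe_coe] at this
    rw [this]
    exact Finset.sum_congr rfl fun j _ => by rw [smul_eq_mul, mul_comm]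
  have : IsProbabilityMeasure (P.map (fun ω j => d.γ (f j) ω)) := Measure.isProbabilityMeasure_map (hm f).aemeasurable
  have : IsProbabilityMeasure (P.map (fun ω j => d.γ (g j) ω)) := Measure.isProbabilityMeasure_map (hm g).aemeasurable
  refine Measure.ext_of_charFunDual ?_
  funext L
  rw [hc, hc, h]

lemma pr_real (ζ : ℂ) (t : ℝ) : pr ζ (t : ℂ) = ζ.re * t := by
  simp [pr]

lemma pw_MM (k : (ι → ℝ) → ℂ) (hk : Measurable k) : pw (MM P q) q k = pw (P.prod (lam 2 q)) q (fun a => k (sc a)) := by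
  unfold pw MM
  rw [lintegral_map (hk.enorm.pow_const q) sc_meas]

lemma ae_MM {Q : (ι → ℝ) → Prop} (hQ : MeasurableSet {y | Q y}) (h : ∀ᵐ a ∂(P.prod (lam 2 q)), Q (sc a)) :
    ∀ᵐ y ∂(MM P q), Q y := by
  unfold MM
  rw [ae_map_iff sc_meas.aemeasurable hQ]
  exact h

lemma pw_sum (hpq : 2 < q) (w : LQ μ 2 →₀ ℂ) (k : LQ μ 2 → LQ μ 2) :
    pw (MM P q) q (fun z => w.sum fun f c => c * (eE (d.xi (k f) z) - 1)) =
    ∫⁻ v, Th 2 q (w.subtypeDomain (· ∈ w.support)) (fun j => ((v j : ℝ) : ℂ))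
      ∂(P.map fun ω (j : w.support) => d.γ (k j) ω) := by
  haveI : Fact ((0 : ℝ) < 2) := ⟨by norm_num⟩
  haveI := lam_sf (p := 2) (by norm_num) hpq
  have hm : Measurable (fun z => w.sum fun f c => c * (eE (d.xi (k f) z) - 1)) := by
    unfold Finsupp.sum
    refine Finset.measurable_fun_sum _ fun f _ => ?_
    exact ((measurable_eE.comp (d.xi_meas _)).sub_const 1).const_mul _
  rw [pw_MM _ hm]
  set w' := w.subtypeDomain (· ∈ w.support) with hw'
  have e1 : (fun a : (ι → ℝ) × ℂ => w.sum fun f c => c * (eE (d.xi (k f) (sc a)) - 1)) =ᵐ[P.prod (lam 2 q)]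
      fun a => w'.sum fun j c => c * (eE (pr a.2 ((d.γ (k j) a.1 : ℝ) : ℂ)) - 1) := by
    filter_upwards [ae_all_iff.2 fun j : w.support => d.xi_sc (q := q) (k j)] with a ha
    rw [← Finsupp.sum_subtypeDomain_index (p := (· ∈ w.support)) fun x hx => hx]
    refine Finset.sum_congr rfl fun j _ => ?_
    simp only []
    rw [ha j, pr_real]
  rw [pw_congr e1]
  unfold pw
  have hm2 : Measurable fun a : (ι → ℝ) × ℂ => w'.sum fun j c => c * (eE (pr a.2 ((d.γ (k j) a.1 : ℝ) : ℂ)) - 1) :=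
    joint_meas w' (fun j ω => ((d.γ (k j) ω : ℝ) : ℂ)) fun j => Complex.measurable_ofReal.comp (d.measγ _)
  rw [lintegral_prod _ (hm2.enorm.pow_const q).aemeasurable, lintegral_map]
  · rfl
  · exact Th_measurable hpq w' (fun j (v : w.support → ℝ) => ((v j : ℝ) : ℂ)) fun j => by fun_prop
  · exact measurable_pi_iff.2 fun j => d.measγ _

/-- the data for `p = 2` -/
noncomputable def dataE (hpq : 2 < q) : XiData μ 2 (MM P q) q where
  ξ := d.xi
  meas := d.xi_meas
  add := by
    intro f g
    refine ae_MM (measurableSet_eq_fun (d.xi_meas _) ((d.xi_meas f).add (d.xi_meas g))) ?_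
    have h := Measure.quasiMeasurePreserving_fst (ν := lam 2 q) |>.ae (d.add f g)
    filter_upwards [h, d.xi_sc f, d.xi_sc g, d.xi_sc (f + g)] with a h1 h2 h3 h4
    rw [h2, h3, h4, h1, mul_add]
  smul := by
    intro t f
    refine ae_MM (measurableSet_eq_fun (d.xi_meas _) ((d.xi_meas f).const_mul t)) ?_
    have h := Measure.quasiMeasurePreserving_fst (ν := lam 2 q) |>.ae (d.smul t f)
    filter_upwards [h, d.xi_sc f, d.xi_sc (t • f)] with a h1 h2 h3
    rw [h2, h3, h1, mul_left_comm]
  h1 := by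
    intro f
    haveI := lam_sf (p := 2) (by norm_num) hpq
    have hm1 : Measurable (fun z => eE (d.xi f z) - 1) := (measurable_eE.comp (d.xi_meas f)).sub_const 1
    rw [pw_MM _ hm1]
    have e1 : (fun a : (ι → ℝ) × ℂ => eE (d.xi f (sc a)) - 1) =ᵐ[P.prod (lam 2 q)]
        fun a => eE (pr a.2 ((d.γ f a.1 : ℝ) : ℂ)) - 1 := by
      filter_upwards [d.xi_sc (q := q) f] with a ha
      rw [ha, pr_real]
    have hm2 : Measurable fun a : (ι → ℝ) × ℂ => eE (pr a.2 ((d.γ f a.1 : ℝ) : ℂ)) - 1 := by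
      refine Measurable.sub_const (measurable_eE.comp ?_) 1
      exact continuous_pr.measurable.comp
        (measurable_snd.prodMk (Complex.measurable_ofReal.comp ((d.measγ f).comp measurable_fst)))
    have e2 := pw_congr (q := q) e1
    refine e2.trans ?_
    rw [← d.two]
    unfold pw
    rw [lintegral_prod _ (hm2.enorm.pow_const q).aemeasurable]
    refine lintegral_congr fun ω => ?_
    have := Th_one (p := 2) (by norm_num) hpq ((d.γ f ω : ℝ) : ℂ)
    simp only []
    rw [this, ← ofReal_norm_eq_enorm, Complex.norm_real, ofReal_norm_eq_enorm]
  h2 := by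
    intro T w
    rw [d.pw_sum hpq w (fun f => T.lin f), d.pw_sum hpq w (fun f => f)]
    congr 1
    refine d.law_eq _ _ fun t => ?_
    have : ∑ j : w.support, t j • T.lin (j : LQ μ 2) = T.lin (∑ j : w.support, t j • (j : LQ μ 2)) := by
      rw [map_sum]; simp_rw [map_smul]
    rw [this, T.lin_pw]
  h3 := by
    intro m hae hm
    have hle : (MeasurableSpace.pi : MeasurableSpace (ι → ℝ)) ≤ m := by
      unfold MeasurableSpace.pi
      refine iSup_le fun i => ?_
      rw [← measurable_iff_comap_le]
      have he : (fun y : ι → ℝ => y i) = d.xi (d.e i) := by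
        funext y
        exact (d.xi_e i y).symm
      rw [he]
      exact hm (d.e i)
    exact fun A hA => hle A hA
  h4 := by
    haveI := lam_sf (p := 2) (by norm_num) hpq
    haveI : Fact ((0 : ℝ) < 2) := ⟨by norm_num⟩
    refine ⟨fun _ => d.e d.i0, ?_⟩
    simp_rw [d.xi_e]
    refine ae_MM ?_ ?_
    · simp only [exists_const]
      exact (measurableSet_eq_fun (measurable_pi_apply d.i0) measurable_const).compl
    · have h0 := Measure.quasiMeasurePreserving_snd (μ := P) |>.ae (re_ne_zero hpq)
      have h1 := Measure.quasiMeasurePreserving_fst (ν := lam 2 q) |>.ae d.hi0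
      filter_upwards [h0, h1] with a h0 h1
      exact ⟨0, mul_ne_zero h0 h1⟩

end GaussData
end caseE


section gauss
open ProbabilityTheory

/-- product gaussian measure -/
noncomputable def gP (ι : Type) : Measure (ι → ℝ) := Measure.infinitePi (fun _ : ι => gaussianReal 0 1)

instance (ι : Type) : IsProbabilityMeasure (gP ι) := by unfold gP; infer_instance

variable {ι : Type}

lemma gP_eval (i : ι) : MeasurePreserving (fun ω : ι → ℝ => ω i) (gP ι) (gaussianReal 0 1) :=
  measurePreserving_eval_infinitePi (fun _ : ι => gaussianReal 0 1) i

lemma gP_memLp (i : ι) : MemLp (fun ω : ι → ℝ => ω i) 2 (gP ι) := by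
  have := (memLp_id_gaussianReal (μ := 0) (v := 1) 2).comp_measurePreserving (gP_eval i)
  simpa using this

/-- coordinate -/
noncomputable def gX (i : ι) : Lp ℝ 2 (gP ι) := (gP_memLp i).toLp

lemma gP_indep : iIndepFun (fun i (ω : ι → ℝ) => ω i) (gP ι) :=
  iIndepFun_infinitePi (P := fun _ : ι => gaussianReal 0 1) (X := fun _ x => x) (fun _ => measurable_id)

lemma gP_mean (i : ι) : ∫ ω, ω i ∂(gP ι) = 0 := by
  have h : ∫ ω, ω i ∂(gP ι) = ∫ x, x ∂(gaussianReal 0 1) := by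
    rw [← (gP_eval i).map_eq, integral_map (measurable_pi_apply i).aemeasurable (by fun_prop)]
  rw [h, integral_id_gaussianReal]

lemma gP_var (i : ι) : ∫ ω, ω i * ω i ∂(gP ι) = 1 := by
  have h : ∫ ω, ω i * ω i ∂(gP ι) = ∫ x, x ^ 2 ∂(gaussianReal 0 1) := by
    rw [← (gP_eval i).map_eq, integral_map (measurable_pi_apply i).aemeasurable (by fun_prop)]
    simp only [sq]
  rw [h]
  have := variance_of_integral_eq_zero (X := fun x : ℝ => x) (μ := gaussianReal 0 1) (by fun_prop) (by simp [integral_id_gaussianReal])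
  rw [← this, variance_fun_id_gaussianReal]; simp

lemma gX_orth : Orthonormal ℝ (gX (ι := ι)) := by
  classical
  rw [orthonormal_iff_ite]
  intro i j
  rw [L2.inner_def]
  have h : ∫ ω, inner ℝ (gX i ω) (gX j ω) ∂(gP ι) = ∫ ω, ω i * ω j ∂(gP ι) := by
    refine integral_congr_ae ?_
    filter_upwards [(gP_memLp i).coeFn_toLp, (gP_memLp j).coeFn_toLp] with ω h1 h2
    simp only [gX, h1, h2]
    simp [mul_comm]
  rw [h]
  split_ifs with hij
  · subst hij; exact gP_var i
  · rw [(gP_indep.indepFun hij).integral_fun_mul_eq_mul_integral (measurable_pi_apply i).aestronglyMeasurable (measurable_pi_apply j).aestronglyMeasurable, gP_mean, zero_mul]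

lemma gP_char (s : Finset ι) (c : ι → ℝ) :
    ∫ ω, Complex.exp ((∑ i ∈ s, c i * ω i : ℝ) * Complex.I) ∂(gP ι) = Complex.exp (-((∑ i ∈ s, c i ^ 2) / 2 : ℝ)) := by
  have h1 : ∀ ω : ι → ℝ, Complex.exp ((∑ i ∈ s, c i * ω i : ℝ) * Complex.I) =
      (fun y : s → ℝ => ∏ i : s, Complex.exp (c i * y i * Complex.I)) (s.restrict ω) := by
    intro ω
    simp only [Finset.restrict]
    rw [← Complex.exp_sum, ← Finset.sum_mul]
    push_cast
    rw [Finset.sum_coe_sort s (fun i => (c i : ℂ) * ω i)]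
  simp_rw [h1]
  unfold gP
  rw [integral_restrict_infinitePi (μ := fun _ : ι => gaussianReal 0 1) (s := s)
    (f := fun y : s → ℝ => ∏ i : s, Complex.exp (c i * y i * Complex.I)) (by
      apply Measurable.aestronglyMeasurable; fun_prop)]
  rw [integral_fintype_prod_eq_prod (fun (i : s) (x : ℝ) => Complex.exp (c i * x * Complex.I))]
  have h2 : ∀ t : ℝ, ∫ x, Complex.exp (t * x * Complex.I) ∂(gaussianReal 0 1) = Complex.exp (-(t ^ 2 / 2 : ℝ)) := by
    intro t
    rw [← charFun_apply_real, charFun_gaussianReal]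
    congr 1; push_cast; simp
  simp_rw [h2]
  rw [← Complex.exp_sum]
  congr 1
  rw [Finset.sum_coe_sort s (fun i => (-((c i ^ 2 / 2 : ℝ)) : ℂ))]
  push_cast
  rw [Finset.sum_neg_distrib, Finset.sum_div]


variable {H : Type} [NormedAddCommGroup H] [InnerProductSpace ℝ H] [CompleteSpace H]

/-- gaussian embedding -/
noncomputable def gG (b : HilbertBasis ι ℝ H) : H →ₗᵢ[ℝ] Lp ℝ 2 (gP ι) :=
  (gX_orth (ι := ι)).orthogonalFamily.linearIsometry.comp b.repr.toLinearIsometry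

lemma gG_sum (b : HilbertBasis ι ℝ H) (h : H) : HasSum (fun i => b.repr h i • gX i) (gG b h) :=
  (gX_orth (ι := ι)).orthogonalFamily.hasSum_linearIsometry (b.repr h)

lemma gG_seq [Countable ι] (b : HilbertBasis ι ℝ H) (h : H) : ∃ ns : ℕ → Finset ι, Tendsto ns atTop atTop ∧
    ∀ᵐ ω ∂(gP ι), Tendsto (fun n => ∑ i ∈ ns n, b.repr h i * ω i) atTop (𝓝 (gG b h ω)) := by
  have h1 := tendstoInMeasure_of_tendsto_Lp (gG_sum b h)
  obtain ⟨ns, hns, hae⟩ := h1.exists_seq_tendsto_ae'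
  refine ⟨ns, hns, ?_⟩
  have h2 : ∀ i : ι, ∀ᵐ ω ∂(gP ι), (b.repr h i • gX i : Lp ℝ 2 (gP ι)) ω = b.repr h i * ω i := by
    intro i
    filter_upwards [Lp.coeFn_smul (b.repr h i) (gX i), (gP_memLp i).coeFn_toLp] with ω a1 a2
    rw [a1, Pi.smul_apply, smul_eq_mul]
    simp only [gX, a2]
  have h3 : ∀ n, ∀ᵐ ω ∂(gP ι), (∑ i ∈ ns n, b.repr h i • gX i : Lp ℝ 2 (gP ι)) ω =
      ∑ i ∈ ns n, b.repr h i * ω i := by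
    intro n
    filter_upwards [Lp.coeFn_finsetSum (ns n) (fun i => b.repr h i • gX i), ae_all_iff.2 h2] with ω a1 a2
    rw [a1, Finset.sum_apply]
    exact Finset.sum_congr rfl fun i _ => a2 i
  filter_upwards [hae, ae_all_iff.2 h3] with ω a1 a2
  simpa only [a2] using a1

lemma gG_char [Countable ι] (b : HilbertBasis ι ℝ H) (h : H) :
    ∫ ω, Complex.exp (gG b h ω * Complex.I) ∂(gP ι) = Complex.exp (-(‖h‖ ^ 2 / 2 : ℝ)) := by
  obtain ⟨ns, hns, hae⟩ := gG_seq b h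
  have h1 : Tendsto (fun n => ∫ ω, Complex.exp ((∑ i ∈ ns n, b.repr h i * ω i : ℝ) * Complex.I) ∂(gP ι)) atTop
      (𝓝 (∫ ω, Complex.exp (gG b h ω * Complex.I) ∂(gP ι))) := by
    refine tendsto_integral_of_dominated_convergence (fun _ => 1) ?_ (integrable_const _) ?_ ?_
    · intro n
      have : Measurable fun ω : ι → ℝ => ∑ i ∈ ns n, b.repr h i * ω i := by fun_prop
      apply Measurable.aestronglyMeasurable; fun_prop
    · intro n
      refine ae_of_all _ fun ω => ?_
      rw [Complex.norm_exp_ofReal_mul_I]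
    · filter_upwards [hae] with ω hω
      have : Continuous fun t : ℝ => Complex.exp (t * Complex.I) := by fun_prop
      exact (this.tendsto _).comp hω
  have h2 : Tendsto (fun n => Complex.exp (-((∑ i ∈ ns n, b.repr h i ^ 2) / 2 : ℝ))) atTop
      (𝓝 (Complex.exp (-(‖h‖ ^ 2 / 2 : ℝ)))) := by
    have : Continuous fun t : ℝ => Complex.exp (-(t / 2 : ℝ)) := by fun_prop
    refine (this.tendsto (‖h‖ ^ 2)).comp ?_
    have hs := b.hasSum_inner_mul_inner h h
    rw [real_inner_self_eq_norm_sq] at hs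
    have hs' : HasSum (fun i => b.repr h i ^ 2) (‖h‖ ^ 2) := by
      have e : (fun i => b.repr h i ^ 2) = fun i => inner ℝ h (b i) * inner ℝ (b i) h := by
        funext i
        rw [b.repr_apply_apply, sq, real_inner_comm]
      rw [e]; exact hs
    unfold HasSum at hs'
    exact hs'.comp hns
  simp_rw [gP_char] at h1
  exact tendsto_nhds_unique h1 h2

lemma gG_two (b : HilbertBasis ι ℝ H) (h : H) :
    ∫⁻ ω, ‖gG b h ω‖ₑ ^ (2 : ℝ) ∂(gP ι) = ENNReal.ofReal (‖h‖ ^ 2) := by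
  have h1 : eLpNorm (gG b h) 2 (gP ι) = ENNReal.ofReal ‖h‖ := by
    rw [← Lp.enorm_def, ← ofReal_norm, (gG b).norm_map]
  rw [eLpNorm_eq_lintegral_rpow_enorm_toReal (by simp) (by simp)] at h1
  simp only [ENNReal.toReal_ofNat] at h1
  rw [ENNReal.ofReal_pow (norm_nonneg _), ← h1, ← ENNReal.rpow_natCast, ← ENNReal.rpow_mul]
  simp

lemma gP_ne (i : ι) : ∀ᵐ ω ∂(gP ι), ω i ≠ 0 := by
  refine (gP_eval i).quasiMeasurePreserving.ae (p := fun x => x ≠ 0) ?_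
  haveI := nullSingletonClass_gaussianReal (μ := 0) (v := 1) one_ne_zero
  simp [ae_iff]

lemma exists_gauss {X : Type*} [MeasurableSpace X] {μ : Measure X} [Countable ι] (b : HilbertBasis ι ℝ H) (i0 : ι)
    (K : LQ μ 2 ≃ₗ[ℝ] H) (hK : ∀ f, pw μ 2 f.fn = ENNReal.ofReal (‖K f‖ ^ 2)) :
    Nonempty (GaussData μ ι (gP ι)) := by
  classical
  choose ns hns hae using gG_seq b
  refine ⟨{
    S := fun f n => ∑ i ∈ ns (K f) n, b.repr (K f) i • LinearMap.proj i
    γ := fun f => gG b (K f)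
    measS := ?_
    measγ := fun f => (Lp.stronglyMeasurable _).measurable
    lim := ?_
    add := ?_
    smul := ?_
    char := ?_
    two := ?_
    e := fun i => K.symm (b i)
    lim_e := ?_
    i0 := i0
    hi0 := gP_ne i0 }⟩
  · intro f n
    have : (⇑(∑ i ∈ ns (K f) n, b.repr (K f) i • LinearMap.proj i : (ι → ℝ) →ₗ[ℝ] ℝ)) =
      fun ω : ι → ℝ => ∑ i ∈ ns (K f) n, b.repr (K f) i * ω i := by
      ext ω; simp
    rw [this]; fun_prop
  · intro f
    filter_upwards [hae (K f)] with ω hω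
    simpa using hω
  · intro f g
    rw [map_add, map_add]
    exact Lp.coeFn_add _ _
  · intro t f
    rw [map_smul, map_smul]
    exact Lp.coeFn_smul _ _
  · intro f
    rw [gG_char, hK, ENNReal.toReal_ofReal (by positivity)]
  · intro f
    rw [gG_two, hK]
  · intro i y
    refine tendsto_const_nhds.congr' ?_
    filter_upwards [(hns (K (K.symm (b i)))).eventually_ge_atTop {i}] with n hn
    simp only [LinearEquiv.apply_symm_apply] at hn ⊢
    rw [b.repr_self]
    simp [lp.single_apply, Pi.single_apply, Finset.singleton_subset_iff.1 hn]

lemma hb_countable [SecondCountableTopology H] (w : Set H) (hw : Orthonormal ℝ ((↑) : w → H)) : Countable w := by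
  refine Set.countable_coe_iff.2 ?_
  refine Set.PairwiseDisjoint.countable_of_isOpen (s := fun x => Metric.ball x (1/2)) ?_ (fun _ _ => Metric.isOpen_ball)
    (fun x _ => ⟨x, by simp⟩)
  intro x hx y hy hxy
  refine Metric.ball_disjoint_ball ?_
  have h0 := hw.2 (i := ⟨x, hx⟩) (j := ⟨y, hy⟩) (by simpa using hxy)
  have h1 : ‖x‖ = 1 := hw.1 ⟨x, hx⟩
  have h2 : ‖y‖ = 1 := hw.1 ⟨y, hy⟩
  have h3 := norm_sub_sq_real x y
  simp only at h0
  rw [h0, h1, h2] at h3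
  rw [dist_eq_norm]
  nlinarith [norm_nonneg (x - y)]

lemma exists_K {X : Type*} [MeasurableSpace X] {μ : Measure X} (r : ℝ≥0∞) (h : r = 2) :
    ∃ K : Lp ℂ r μ ≃ₗ[ℝ] Lp ℂ 2 μ, ∀ f, K f =ᵐ[μ] f := by
  subst h; exact ⟨LinearEquiv.refl _ _, fun f => by rfl⟩

lemma exists_gauss' {X : Type} [MeasurableSpace X] [StandardBorelSpace X] {μ : Measure X} [SigmaFinite μ]
    (h0 : Nontrivial (LQ μ 2)) :
    ∃ (ι : Type) (_ : Countable ι), Nonempty (GaussData μ ι (gP ι)) := by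
  obtain ⟨K, hK⟩ := exists_K (μ := μ) (ENNReal.ofReal 2) (by simp)
  haveI : Fact ((2:ℝ≥0∞) ≠ ⊤) := ⟨by simp⟩
  haveI : SecondCountableTopology (Lp ℂ 2 μ) := by infer_instance
  obtain ⟨w, b, hb⟩ := exists_hilbertBasis ℝ (Lp ℂ 2 μ)
  have hw : Orthonormal ℝ ((↑) : w → Lp ℂ 2 μ) := by rw [← hb]; exact b.orthonormal
  have hc := hb_countable w hw
  let K' : LQ μ 2 ≃ₗ[ℝ] Lp ℂ 2 μ := K
  haveI : Nontrivial (Lp ℂ 2 μ) := K'.symm.toEquiv.nontrivial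
  have hne : Nonempty w := by
    by_contra hcon
    haveI := not_nonempty_iff.1 hcon
    haveI : Subsingleton (Lp ℂ 2 μ) := b.repr.toEquiv.subsingleton_congr.2 ⟨fun f g => by ext i; exact isEmptyElim i⟩
    exact not_subsingleton (Lp ℂ 2 μ) this
  obtain ⟨i0⟩ := hne
  refine ⟨w, hc, exists_gauss b i0 K' fun f => ?_⟩
  have e1 : pw μ 2 f.fn = pw μ 2 (K f) := pw_congr (hK f).symm
  have e2 := eLpNorm_eq_pw (q := 2) (ν := μ) (by norm_num) (K f)
  have e3 : eLpNorm (K f) (ENNReal.ofReal 2) μ = eLpNorm (K f) 2 μ := by congr 1; simp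
  rw [e3, ← Lp.enorm_def, ← ofReal_norm] at e2
  rw [e1]
  show _ = ENNReal.ofReal (‖K f‖ ^ 2)
  rw [ENNReal.ofReal_pow (norm_nonneg _), e2, ← ENNReal.rpow_natCast, ← ENNReal.rpow_mul]
  simp

end gauss

/-- **Corollary (embedding of isometry groups).** Let `0 < p ≤ q < ∞` and let `(X,μ)`
be a standard σ-finite measure space with `L_p(X,μ)` infinite-dimensional.  Then there
are a standard σ-finite measure space `(Y,ν)` and a group homomorphism
`Ψ : Isom(L_p(X,μ)) → Isom(L_q(Y,ν))` which is a homeomorphism onto its image, whose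
image is closed, and which satisfies `‖g(0)‖_p^p = ‖Ψ(g)(0)‖_q^q` for every `g`. -/
theorem stmt3 {X : Type*} [MeasurableSpace X] [StandardBorelSpace X]
    (μ : Measure X) [SigmaFinite μ]
    {p q : ℝ} (hp : 0 < p) (hpq : p ≤ q)
    (hinf : ∀ s : Set (Lp ℂ (ENNReal.ofReal p) μ), s.Finite → Submodule.span ℝ s ≠ ⊤) :
    ∃ (Y : Type) (_ : MeasurableSpace Y) (ν : Measure Y),
      StandardBorelSpace Y ∧ SigmaFinite ν ∧
      ∃ Ψ : AffIsom μ p → AffIsom ν q,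
        (∀ S T : AffIsom μ p, Ψ (S.comp T) = (Ψ S).comp (Ψ T)) ∧
        Topology.IsEmbedding Ψ ∧
        IsClosed (Set.range Ψ) ∧
        ∀ S : AffIsom μ p,
          pPow μ p ((S.toEquiv 0 : X →ₘ[μ] ℂ)) = pPow ν q (((Ψ S).toEquiv 0 : Y →ₘ[ν] ℂ)) := by
  haveI : Fact (0 < p) := ⟨hp⟩
  haveI : Fact (0 < q) := ⟨hp.trans_le hpq⟩
  obtain ⟨Y, _, _, ⟨e⟩⟩ := exists_type0 (X := X)
  haveI : SigmaFinite (μ.map e) := e.sigmaFinite_map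
  have hg : Good μ p (μ.map e) p := good_map e
  rcases hpq.eq_or_lt with rfl | hlt
  · exact ⟨Y, inferInstance, μ.map e, inferInstance, inferInstance, hg⟩
  by_cases hp2 : p = 2
  · subst hp2
    have hnt : Nontrivial (LQ (μ.map e) 2) := by
      by_contra hcon
      have hs : Subsingleton (LQ (μ.map e) 2) := not_nontrivial_iff_subsingleton.1 hcon
      have hs' : Subsingleton (Lp ℂ (ENNReal.ofReal 2) (μ.map e)) := hs
      have he' : MeasurePreserving e.symm (μ.map e) μ := (e.measurable.measurePreserving μ).symm e
      haveI : Fact (1 ≤ ENNReal.ofReal 2) := ⟨by simp⟩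
      refine hinf ∅ Set.finite_empty ?_
      rw [Submodule.span_empty, eq_comm, eq_bot_iff]
      intro f _
      rw [Submodule.mem_bot, ← norm_eq_zero, ← Lp.norm_compMeasurePreserving f he',
        Subsingleton.elim (Lp.compMeasurePreserving e.symm he' f) 0, norm_zero]
    obtain ⟨ι, _, ⟨d⟩⟩ := exists_gauss' hnt
    have dd := d.dataE hlt
    exact ⟨ι → ℝ, inferInstance, GaussData.MM (gP ι) q, inferInstance, dd.sigmaFinite, hg.trans dd.good⟩
  · have dd := dataD (μ := μ.map e) hp2 hlt
    exact ⟨Y × ℂ, inferInstance, (μ.map e).prod (lam p q), inferInstance, dd.sigmaFinite, hg.trans dd.good⟩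
end

section
/- Let p ≥ 1 and let φ : ℝ → ℝ be a measurable function such that ∫_ℝ ∫_0^∞ |φ(x + λ^{-1/p}) − φ(x)|^p dλ dx < +∞, where dλ and dx denote Lebesgue measure on (0,∞) and on ℝ respectively. Then φ is almost everywhere equal to a constant. -/
open MeasureTheory

set_option maxHeartbeats 1000000 in
/-- **(Remark after Theorem, Section 4.)** Let `p ≥ 1` and let `φ : ℝ → ℝ` be a
measurable function such that
`∫_ℝ ∫_0^∞ |φ(x + λ^{-1/p}) − φ(x)|^p dλ dx < ∞`.
Then `φ` is almost everywhere equal to a constant. -/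
theorem stmt15 {p : ℝ} (hp : 1 ≤ p) (φ : ℝ → ℝ) (hφ : Measurable φ)
    (hint : ∫⁻ x : ℝ, ∫⁻ l in Set.Ioi (0 : ℝ),
        ENNReal.ofReal (|φ (x + l ^ (-p⁻¹)) - φ x| ^ p) < ⊤) :
    ∃ c : ℝ, φ =ᵐ[volume] fun _ => c := by
  have hp0 : 0 < p := by linarith
  let f : ℝ → ℝ → ENNReal := fun l x => ENNReal.ofReal (|φ (x + l ^ (-p⁻¹)) - φ x| ^ p)
  have hfm : Measurable (Function.uncurry f) := by
    have h1 : Measurable (fun z : ℝ × ℝ => z.2 + z.1 ^ (-p⁻¹)) :=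
      measurable_snd.add (measurable_fst.pow_const _)
    have h2 : Measurable (fun z : ℝ × ℝ => φ (z.2 + z.1 ^ (-p⁻¹)) - φ z.2) :=
      (hφ.comp h1).sub (hφ.comp measurable_snd)
    have h3 : Measurable (fun z : ℝ × ℝ => |φ (z.2 + z.1 ^ (-p⁻¹)) - φ z.2| ^ p) := by
      have h4 := h2.norm
      simp only [Real.norm_eq_abs] at h4
      exact h4.pow_const p
    exact h3.ennreal_ofReal
  let F : ℝ → ENNReal := fun l => ∫⁻ x, f l x
  have hFm : Measurable F := hfm.lintegral_prod_right'
  have hswap : ∫⁻ x : ℝ, ∫⁻ l in Set.Ioi (0 : ℝ), f l x = ∫⁻ l in Set.Ioi (0 : ℝ), F l := by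
    rw [lintegral_lintegral_swap]
    exact (hfm.comp measurable_swap).aemeasurable
  let a : ℝ := 2 ^ (-p)
  have ha0 : 0 < a := by positivity
  have ha1 : a < 1 := Real.rpow_lt_one_of_one_lt_of_neg (by norm_num) (by linarith)
  have hainv : a⁻¹ = 2 ^ p := by
    simp only [a]; rw [Real.rpow_neg (by norm_num), inv_inv]
  have hscale : ∀ l : ℝ, 0 < l → (a * l) ^ (-p⁻¹) = l ^ (-p⁻¹) + l ^ (-p⁻¹) := by
    intro l hl
    rw [Real.mul_rpow ha0.le hl.le]
    simp only [a]
    rw [← Real.rpow_mul (by norm_num)]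
    have : -p * -p⁻¹ = 1 := by field_simp
    rw [this, Real.rpow_one]; ring
  have hF : ∀ l : ℝ, 0 < l → F (a * l) ≤ ENNReal.ofReal (2 ^ p) * F l := by
    intro l hl
    have hfl : Measurable (f l) := hfm.comp measurable_prodMk_left
    set h := l ^ (-p⁻¹) with hh
    have htr : ∫⁻ x, f l (x + h) = F l := lintegral_add_right_eq_self (f l) h
    have hpt : ∀ x, f (a * l) x ≤ ENNReal.ofReal (2 ^ (p-1)) * (f l (x + h) + f l x) := by
      intro x
      simp only [f]
      rw [hscale l hl, ← hh, ← ENNReal.ofReal_add (by positivity) (by positivity),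
        ← ENNReal.ofReal_mul (by positivity)]
      apply ENNReal.ofReal_le_ofReal
      have key := ENNReal.rpow_add_le_mul_rpow_add_rpow
        (ENNReal.ofReal |φ (x + h + h) - φ (x + h)|) (ENNReal.ofReal |φ (x + h) - φ x|) hp
      rw [← ENNReal.ofReal_add (by positivity) (by positivity),
        ENNReal.ofReal_rpow_of_nonneg (by positivity) hp0.le,
        ENNReal.ofReal_rpow_of_nonneg (by positivity) hp0.le,
        ENNReal.ofReal_rpow_of_nonneg (by positivity) hp0.le,
        ← ENNReal.ofReal_add (by positivity) (by positivity),
        show (2 : ENNReal) = ENNReal.ofReal 2 by simp,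
        ENNReal.ofReal_rpow_of_nonneg (by positivity) (by linarith),
        ← ENNReal.ofReal_mul (by positivity),
        ENNReal.ofReal_le_ofReal_iff (by positivity)] at key
      refine le_trans (Real.rpow_le_rpow (abs_nonneg _) ?_ hp0.le) key
      rw [← add_assoc]
      have := abs_add_le (φ (x + h + h) - φ (x + h)) (φ (x + h) - φ x)
      simpa using this
    calc F (a * l) ≤ ∫⁻ x, ENNReal.ofReal (2 ^ (p-1)) * (f l (x + h) + f l x) :=
          lintegral_mono hpt
      _ = ENNReal.ofReal (2 ^ (p-1)) * (F l + F l) := by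
          rw [lintegral_const_mul' _ _ ENNReal.ofReal_ne_top, lintegral_add_right _ hfl, htr]
      _ = ENNReal.ofReal (2 ^ p) * F l := by
          have : (2:ℝ) ^ p = 2 ^ (p-1) * 2 := by
            rw [← Real.rpow_add_one (by norm_num)]; simp
          rw [this, ENNReal.ofReal_mul (by positivity), ← two_mul, mul_assoc]; simp
  have hfin : ∫⁻ l in Set.Ioi (0 : ℝ), F l < ⊤ := by rw [← hswap]; exact hint
  have hH : ∀ T : ℝ, 0 < T → ∫⁻ l in Set.Ioi (a * T), F l ≤ ∫⁻ l in Set.Ioi T, F l := by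
    intro T hT
    have hgm : Measurable ((Set.Ioi (a * T)).indicator F) := hFm.indicator measurableSet_Ioi
    have h1 : ∫⁻ l, (Set.Ioi (a * T)).indicator F (a * l)
        = ENNReal.ofReal (2 ^ p) * ∫⁻ l in Set.Ioi (a * T), F l := by
      rw [← lintegral_map hgm (measurable_const_mul a), Real.map_volume_mul_left ha0.ne',
        lintegral_smul_measure, hainv, abs_of_pos (by positivity),
        lintegral_indicator measurableSet_Ioi, smul_eq_mul]
    have h2 : ∫⁻ l, (Set.Ioi (a * T)).indicator F (a * l)
        ≤ ENNReal.ofReal (2 ^ p) * ∫⁻ l in Set.Ioi T, F l := by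
      rw [← lintegral_const_mul' _ _ ENNReal.ofReal_ne_top,
        ← lintegral_indicator measurableSet_Ioi]
      apply lintegral_mono
      intro l
      beta_reduce
      by_cases hl : T < l
      · rw [Set.indicator_of_mem (show a * l ∈ Set.Ioi (a*T) from by
          simp only [Set.mem_Ioi]; gcongr), Set.indicator_of_mem (show l ∈ Set.Ioi T from hl)]
        exact hF l (hT.trans hl)
      · rw [Set.indicator_of_notMem]
        · simp
        · simp only [Set.mem_Ioi, not_lt] at hl ⊢
          gcongr
    rw [h1] at h2
    exact (ENNReal.mul_le_mul_iff_right (by simp; positivity) ENNReal.ofReal_ne_top).1 h2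
  have hzero : ∀ T : ℝ, 0 < T → ∀ᵐ l, l ∈ Set.Ioc (a * T) T → F l = 0 := by
    intro T hT
    have haT : a * T ≤ T := by nlinarith
    have hsplit : ∫⁻ l in Set.Ioi (a * T), F l
        = (∫⁻ l in Set.Ioc (a * T) T, F l) + ∫⁻ l in Set.Ioi T, F l := by
      rw [← Set.Ioc_union_Ioi_eq_Ioi haT, lintegral_union measurableSet_Ioi]
      exact Set.disjoint_left.2 fun x hx hx2 => not_lt.2 hx.2 hx2
    have hlt : ∫⁻ l in Set.Ioi T, F l ≠ ⊤ :=
      ((lintegral_mono_set (Set.Ioi_subset_Ioi hT.le)).trans_lt hfin).ne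
    have h0 : ∫⁻ l in Set.Ioc (a * T) T, F l = 0 := by
      have h3 := hH T hT
      rw [hsplit] at h3
      have h4 : (∫⁻ l in Set.Ioc (a * T) T, F l) + ∫⁻ l in Set.Ioi T, F l
          ≤ 0 + ∫⁻ l in Set.Ioi T, F l := by simpa using h3
      exact le_antisymm ((ENNReal.add_le_add_iff_right hlt).1 h4) zero_le
    rw [lintegral_eq_zero_iff hFm] at h0
    exact (ae_restrict_iff' measurableSet_Ioc).1 h0
  have hF0 : ∀ᵐ l, l ∈ Set.Ioi (0:ℝ) → F l = 0 := by
    have : ∀ᵐ l, ∀ q : ℚ, 0 < (q:ℝ) → l ∈ Set.Ioc (a * q) (q:ℝ) → F l = 0 := by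
      rw [ae_all_iff]
      intro q
      by_cases hq : 0 < (q:ℝ)
      · filter_upwards [hzero q hq] with l hl _ using hl
      · filter_upwards with l h using absurd h hq
    filter_upwards [this] with l hl hl0
    have hl0' : 0 < l := hl0
    obtain ⟨q, hq1, hq2⟩ := exists_rat_btwn (show l < l / a by
      rw [lt_div_iff₀ ha0]; nlinarith)
    refine hl q (hl0'.trans hq1) ⟨?_, hq1.le⟩
    rw [lt_div_iff₀ ha0] at hq2; linarith
  have hI0 : ∫⁻ x : ℝ, ∫⁻ l in Set.Ioi (0 : ℝ), f l x = 0 := by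
    rw [hswap, lintegral_eq_zero_iff hFm]
    exact (ae_restrict_iff' measurableSet_Ioi).2 hF0
  have hgood : ∀ᵐ x, ∀ᵐ y, x < y → φ y = φ x := by
    have hm : Measurable (fun x : ℝ => ∫⁻ l in Set.Ioi (0 : ℝ), f l x) :=
      hfm.lintegral_prod_left'
    rw [lintegral_eq_zero_iff hm] at hI0
    filter_upwards [hI0] with x hx
    have hfx : Measurable (fun l => f l x) := hfm.of_uncurry_right
    have hx' : ∫⁻ l in Set.Ioi (0 : ℝ), f l x = 0 := hx
    rw [lintegral_eq_zero_iff hfx] at hx'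
    have hx2 := (ae_restrict_iff' measurableSet_Ioi).1 hx'
    rw [ae_iff] at hx2
    have himg : volume ((fun l : ℝ => l ^ (-p⁻¹)) ''
        {l | ¬ (l ∈ Set.Ioi (0:ℝ) → f l x = (0 : ℝ → ENNReal) l)}) = 0 := by
      apply addHaar_image_eq_zero_of_differentiableOn_of_addHaar_eq_zero volume _ hx2
      intro l hl
      have hl0 : 0 < l := by
        by_contra hc
        exact hl fun h => absurd h hc
      exact (Real.differentiableAt_rpow_const_of_ne _ hl0.ne').differentiableWithinAt
    have hh : ∀ᵐ h : ℝ, 0 < h → φ (x + h) = φ x := by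
      rw [ae_iff]
      refine measure_mono_null ?_ himg
      intro h hh
      simp only [Set.mem_setOf_eq, Classical.not_imp] at hh
      obtain ⟨h0, hne⟩ := hh
      have hhp : (h ^ (-p)) ^ (-p⁻¹) = h := by
        rw [← Real.rpow_mul h0.le]
        have : -p * -p⁻¹ = 1 := by field_simp
        rw [this, Real.rpow_one]
      refine ⟨h ^ (-p), ?_, hhp⟩
      simp only [Set.mem_setOf_eq, Classical.not_imp]
      refine ⟨Real.rpow_pos_of_pos h0 _, ?_⟩
      simp only [f, hhp, Pi.zero_apply, ENNReal.ofReal_eq_zero, not_le]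
      have := abs_pos.2 (sub_ne_zero.2 hne)
      positivity
    have := (measurePreserving_sub_right volume x).quasiMeasurePreserving.ae hh
    filter_upwards [this] with y hy hxy
    have := hy (by linarith)
    simpa using this
  obtain ⟨x0, hx0⟩ := hgood.exists
  refine ⟨φ x0, ?_⟩
  filter_upwards [hgood] with x hx
  have hb : ∃ᵐ y : ℝ, y ∈ Set.Ioi (max x x0) := by
    rw [frequently_ae_mem_iff]; simp
  obtain ⟨y, hy, h1, h2⟩ := (hb.and_eventually (hx.and hx0)).exists
  rw [← h1 ((le_max_left _ _).trans_lt hy), h2 ((le_max_right _ _).trans_lt hy)]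
end
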